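/- Let ℓ ≥ 2 be an integer, λ ∈ (0,1], c, c₁ ∈ (0,1), δ > 0 and K ≥ 1, and set θ₁(c₁) = max{2c₁ − 1/2, −c₁, −1}. There is a constant C > 0 such that for every ε ∈ (0,1/2), with Q = ⌊1/ε⌋, and every interval I ⊆ [0,1] with K⁻¹·Q^{−c} ≤ |I| ≤ K·Q^{−c}, one has |B_{I,Q}(λ) − c_I·A(ℓ)·I₂(λ)| ≤ C·Q^{δ+θ₁(c₁)} and |C_{I,Q}(λ) − c_I·A(ℓ)·I₂(λ)| ≤ C·Q^{δ+θ₁(c₁)}, where B_{I,Q}(λ) = Σ (1−εq′)/(q·q′·(1+γ′²)) over all pairs γ = a/q < γ′ = a′/q′ of consecutive fractions in F_Q with γ, γ′ ∈ (I ∩ F_Q) ∖ F^{(ℓ)} and q ≤ λQ < q′; C_{I,Q}(λ) = Σ (1−εq)/(q·q′·(1+γ²)) over all such pairs with q′ ≤ λQ < q instead; and I₂(λ) = ∫_{max{λ,1−λ}}^1 ((1−x)/x)·ln(λ/(1−x)) dx. -/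

import Mathlib

open MeasureTheory Real Set Filter

noncomputable def zeta2 : ℝ := π ^ 2 / 6

noncomputable def Cconst (l : ℕ) : ℝ :=
  ((Nat.totient l : ℝ) / l) * ∏' p : {p : ℕ // p.Prime ∧ ¬ p ∣ l}, (1 - 1 / (p.1 : ℝ) ^ 2)

noncomputable def Aconst (l : ℕ) : ℝ := 1 / zeta2 - 2 * Cconst l / l

def FareyQ (Q : ℕ) : Set ℚ := {x | 0 < x ∧ x ≤ 1 ∧ x.den ≤ Q}

def FareyCong (l : ℕ) : Set ℚ := {x | 0 < x ∧ x ≤ 1 ∧ (l : ℤ) ∣ ((x.den : ℤ) - x.num)}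

def ConsecFarey (Q : ℕ) (γ γ' : ℚ) : Prop :=
  γ ∈ FareyQ Q ∧ γ' ∈ FareyQ Q ∧ γ < γ' ∧ ∀ z ∈ FareyQ Q, ¬ (γ < z ∧ z < γ')

/-- The sum `B_{I,Q}(λ)` over pairs of consecutive Farey fractions
`γ = a/q < γ' = a'/q'` in `(I ∩ F_Q) ∖ F^{(ℓ)}` with `q ≤ λQ < q'` of
`(1-εq')/(q·q'·(1+γ'²))`. -/
noncomputable def Bsum (l Q : ℕ) (ε : ℝ) (I : Set ℝ) (lam : ℝ) : ℝ :=
  ∑' p : {p : ℚ × ℚ // ConsecFarey Q p.1 p.2 ∧ (p.1 : ℝ) ∈ I ∧ (p.2 : ℝ) ∈ I ∧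
      p.1 ∉ FareyCong l ∧ p.2 ∉ FareyCong l ∧
      (p.1.den : ℝ) ≤ lam * Q ∧ lam * Q < (p.2.den : ℝ)},
    (1 - ε * (p.1.2.den : ℝ)) / ((p.1.1.den : ℝ) * (p.1.2.den : ℝ) * (1 + (p.1.2 : ℝ) ^ 2))

/-- The sum `C_{I,Q}(λ)` over pairs of consecutive Farey fractions
`γ = a/q < γ' = a'/q'` in `(I ∩ F_Q) ∖ F^{(ℓ)}` with `q' ≤ λQ < q` of
`(1-εq)/(q·q'·(1+γ²))`. -/
noncomputable def Csum (l Q : ℕ) (ε : ℝ) (I : Set ℝ) (lam : ℝ) : ℝ :=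
  ∑' p : {p : ℚ × ℚ // ConsecFarey Q p.1 p.2 ∧ (p.1 : ℝ) ∈ I ∧ (p.2 : ℝ) ∈ I ∧
      p.1 ∉ FareyCong l ∧ p.2 ∉ FareyCong l ∧
      (p.2.den : ℝ) ≤ lam * Q ∧ lam * Q < (p.1.den : ℝ)},
    (1 - ε * (p.1.1.den : ℝ)) / ((p.1.1.den : ℝ) * (p.1.2.den : ℝ) * (1 + (p.1.1 : ℝ) ^ 2))

/-- `I₂(λ) = ∫_{max{λ,1-λ}}^1 ((1-x)/x)·ln(λ/(1-x)) dx`. -/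
noncomputable def I2 (lam : ℝ) : ℝ :=
  ∫ x in (max lam (1 - lam))..1, ((1 - x) / x) * Real.log (lam / (1 - x))

namespace FareyPairs

/-- Submultiplicative growth bound for one prime power factor of the divisor function. -/
lemma exists_prime_pow_factor_bound {η : ℝ} (hη : 0 < η) :
    ∃ c : ℝ, 0 < c ∧ c ≤ 1 ∧ ∃ P : ℕ, ∀ p e : ℕ, 2 ≤ p →
      (if p < P then c else 1) * ((e : ℝ) + 1) ≤ ((p : ℝ) ^ e) ^ η := by
  refine ⟨min 1 (η * Real.log 2), lt_min one_pos (by positivity), min_le_left _ _,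
    ⌈(2 : ℝ) ^ (1 / η)⌉₊, fun p e hp => ?_⟩
  have hp0 : (0 : ℝ) < p := by positivity
  have h2p : (2 : ℝ) ≤ p := by exact_mod_cast hp
  have key : ((p : ℝ) ^ e) ^ η = ((p : ℝ) ^ η) ^ e := by
    rw [← Real.rpow_natCast, ← Real.rpow_natCast, ← Real.rpow_mul hp0.le, ← Real.rpow_mul hp0.le,
      mul_comm]
  split_ifs with h
  · have h1 : ((2 : ℝ) ^ e) ^ η ≤ ((p : ℝ) ^ e) ^ η := by gcongr
    have h2 : ((2 : ℝ) ^ e) ^ η = Real.exp (η * Real.log 2 * e) := by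
      rw [← Real.rpow_natCast, ← Real.rpow_mul (by norm_num), Real.rpow_def_of_pos (by norm_num)]
      congr 1; ring
    have h3 := Real.add_one_le_exp (η * Real.log 2 * e)
    have h4 : min 1 (η * Real.log 2) * e ≤ η * Real.log 2 * e := by
      gcongr; exact min_le_right _ _
    have h5 : min 1 (η * Real.log 2) ≤ 1 := min_le_left _ _
    rw [h2] at h1
    linarith
  · have h1 : (2 : ℝ) ≤ (p : ℝ) ^ η := by
      have : (2 : ℝ) ^ (1 / η) ≤ p := by
        refine (Nat.le_ceil _).trans ?_
        exact_mod_cast not_lt.mp h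
      calc (2 : ℝ) = ((2 : ℝ) ^ (1 / η)) ^ η := by
            rw [← Real.rpow_mul (by norm_num), one_div_mul_cancel hη.ne', Real.rpow_one]
        _ ≤ _ := by gcongr
    rw [key, one_mul]
    calc (e : ℝ) + 1 ≤ (2 : ℝ) ^ e := by
          exact_mod_cast Nat.lt_two_pow_self (n := e)
      _ ≤ _ := by gcongr

lemma exists_card_divisors_le_rpow {η : ℝ} (hη : 0 < η) :
    ∃ C : ℝ, 1 ≤ C ∧ ∀ n : ℕ, 1 ≤ n → (n.divisors.card : ℝ) ≤ C * (n : ℝ) ^ η := by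
  obtain ⟨c, hc0, hc1, P, hP⟩ := exists_prime_pow_factor_bound hη
  refine ⟨(c ^ P)⁻¹, (one_le_inv₀ (by positivity)).2 (pow_le_one₀ hc0.le hc1), fun n hn => ?_⟩
  have hn0 : n ≠ 0 := by omega
  rw [Nat.card_divisors hn0]
  have hfac : (n : ℝ) ^ η = ∏ p ∈ n.primeFactors, ((p : ℝ) ^ (n.factorization p)) ^ η := by
    rw [Real.finsetProd_rpow _ _ (fun i _ => by positivity)]
    congr 1
    conv_lhs => rw [← Nat.prod_factorization_pow_eq_self hn0]
    rw [Finsupp.prod, Nat.support_factorization]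
    push_cast
    rfl
  have h1 : ∏ p ∈ n.primeFactors, ((if p < P then c else 1) * ((n.factorization p : ℝ) + 1))
      ≤ (n : ℝ) ^ η := by
    rw [hfac]
    refine Finset.prod_le_prod (fun p _ => ?_) fun p hp => ?_
    · split_ifs <;> positivity
    · exact hP p _ (Nat.prime_of_mem_primeFactors hp).two_le
  rw [Finset.prod_mul_distrib] at h1
  have h2 : c ^ P ≤ ∏ p ∈ n.primeFactors, (if p < P then c else 1) := by
    rw [Finset.prod_ite, Finset.prod_const, Finset.prod_const_one, mul_one]
    refine pow_le_pow_of_le_one hc0.le hc1 ?_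
    calc _ ≤ (Finset.range P).card := Finset.card_le_card fun p hp => by
          simp only [Finset.mem_filter] at hp; simpa using hp.2
      _ = P := Finset.card_range P
  rw [inv_mul_eq_div, le_div_iff₀ (by positivity)]
  push_cast
  calc _ = c ^ P * ∏ x ∈ n.primeFactors, ((n.factorization x : ℝ) + 1) := mul_comm _ _
    _ ≤ _ := by gcongr
    _ ≤ _ := h1

lemma le_card_divisors_mul_totient (n : ℕ) : n ≤ n.divisors.card * n.totient := by
  rcases Nat.eq_zero_or_pos n with rfl | hn
  · simp
  calc n = ∑ d ∈ n.divisors, d.totient := (Nat.sum_totient n).symm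
    _ ≤ ∑ _d ∈ n.divisors, n.totient := Finset.sum_le_sum fun d hd =>
        Nat.le_of_dvd (Nat.totient_pos.2 hn) (Nat.totient_dvd_of_dvd (Nat.dvd_of_mem_divisors hd))
    _ = _ := by simp

lemma gcd_le_sum_divisors {q : ℕ} (hq : q ≠ 0) (x : ℕ) :
    x.gcd q ≤ ∑ d ∈ q.divisors, if d ∣ x then d else 0 := by
  have hg : x.gcd q ∈ q.divisors := Nat.mem_divisors.2 ⟨Nat.gcd_dvd_right _ _, hq⟩
  refine le_trans ?_ (Finset.single_le_sum (f := fun d => if d ∣ x then d else 0)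
    (fun _ _ => Nat.zero_le _) hg)
  simp [Nat.gcd_dvd_left]

lemma card_range_filter_dvd {q d : ℕ} (hq : q ≠ 0) (hd : d ∣ q) :
    ((Finset.range q).filter (d ∣ ·)).card = q / d := by
  have hd0 : 0 < d := Nat.pos_of_dvd_of_pos hd (Nat.pos_of_ne_zero hq)
  obtain ⟨k, rfl⟩ := hd
  rw [Nat.mul_div_cancel_left _ hd0]
  have : (Finset.range (d * k)).filter (d ∣ ·) = (Finset.range k).image (d * ·) := by
    ext x
    simp only [Finset.mem_filter, Finset.mem_range, Finset.mem_image]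
    constructor
    · rintro ⟨h, y, rfl⟩
      exact ⟨y, lt_of_mul_lt_mul_left h hd0.le, rfl⟩
    · rintro ⟨y, hy, rfl⟩
      exact ⟨Nat.mul_lt_mul_of_pos_left hy hd0, dvd_mul_right _ _⟩
  rw [this, Finset.card_image_of_injective _ (fun a b h => Nat.eq_of_mul_eq_mul_left hd0 h),
    Finset.card_range]

lemma sum_gcd_range_le (q : ℕ) (hq : q ≠ 0) :
    ∑ x ∈ Finset.range q, x.gcd q ≤ q * q.divisors.card := by
  calc ∑ x ∈ Finset.range q, x.gcd q
      ≤ ∑ x ∈ Finset.range q, ∑ d ∈ q.divisors, if d ∣ x then d else 0 :=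
        Finset.sum_le_sum fun x _ => gcd_le_sum_divisors hq x
    _ = ∑ d ∈ q.divisors, ∑ x ∈ Finset.range q, if d ∣ x then d else 0 := Finset.sum_comm
    _ = ∑ _d ∈ q.divisors, q := Finset.sum_congr rfl fun d hd => by
        rw [← Finset.sum_filter, Finset.sum_const,
          card_range_filter_dvd hq (Nat.dvd_of_mem_divisors hd), smul_eq_mul,
          Nat.div_mul_cancel (Nat.dvd_of_mem_divisors hd)]
    _ = _ := by simp [mul_comm]

lemma sum_gcd_zmod_le (q : ℕ) [NeZero q] :
    ∑ x : ZMod q, x.val.gcd q ≤ q * q.divisors.card := by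
  refine le_trans (le_of_eq ?_) (sum_gcd_range_le q (NeZero.ne q))
  refine Finset.sum_bij' (fun x _ => x.val) (fun n _ => (n : ZMod q)) ?_ ?_ ?_ ?_ ?_
  · intro x _; exact Finset.mem_range.2 (ZMod.val_lt x)
  · intro x _; exact Finset.mem_univ _
  · intro x _; simp
  · intro n hn; exact ZMod.val_cast_of_lt (Finset.mem_range.1 hn)
  · intro x _; rfl

lemma sum_Ico_inv_le (n : ℕ) :
    ∑ j ∈ Finset.Ico 1 (n + 1), (1 / (j : ℝ)) ≤ 1 + Real.log n := by
  have := harmonic_le_one_add_log n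
  rw [harmonic_eq_sum_Icc] at this
  push_cast at this
  simpa [Finset.Ico_add_one_right_eq_Icc] using this

lemma sum_gcd_div_le (q : ℕ) (hq : q ≠ 0) :
    ∑ h ∈ Finset.Ico 1 q, ((h.gcd q : ℕ) : ℝ) / h ≤ q.divisors.card * (1 + Real.log q) := by
  calc ∑ h ∈ Finset.Ico 1 q, ((h.gcd q : ℕ) : ℝ) / h
      ≤ ∑ h ∈ Finset.Ico 1 q, ∑ d ∈ q.divisors, (if d ∣ h then (d : ℝ) / h else 0) := by
        refine Finset.sum_le_sum fun h _ => ?_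
        have := gcd_le_sum_divisors hq h
        have h2 : ((h.gcd q : ℕ) : ℝ) ≤ ∑ d ∈ q.divisors, if d ∣ h then (d : ℝ) else 0 := by
          exact_mod_cast this
        calc _ ≤ (∑ d ∈ q.divisors, if d ∣ h then (d : ℝ) else 0) / h := by gcongr
          _ = _ := by
            rw [Finset.sum_div]
            refine Finset.sum_congr rfl fun d _ => ?_
            split_ifs <;> simp
    _ = ∑ d ∈ q.divisors, ∑ h ∈ Finset.Ico 1 q, (if d ∣ h then (d : ℝ) / h else 0) :=
        Finset.sum_comm
    _ ≤ ∑ _d ∈ q.divisors, (1 + Real.log q) := by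
        refine Finset.sum_le_sum fun d hd => ?_
        have hdq := Nat.dvd_of_mem_divisors hd
        have hd0 : 0 < d := Nat.pos_of_mem_divisors hd
        rw [← Finset.sum_filter]
        calc ∑ h ∈ (Finset.Ico 1 q).filter (d ∣ ·), (d : ℝ) / h
            ≤ ∑ h ∈ (Finset.Ico 1 (q + 1)).image (d * ·), (d : ℝ) / h := by
              refine Finset.sum_le_sum_of_subset_of_nonneg ?_ fun _ _ _ => by positivity
              intro h hh
              simp only [Finset.mem_filter, Finset.mem_Ico, Finset.mem_image] at hh ⊢
              obtain ⟨⟨h1, h2⟩, k, rfl⟩ := hh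
              have hk : k ≠ 0 := by rintro rfl; omega
              have : k ≤ d * k := Nat.le_mul_of_pos_left k hd0
              exact ⟨k, ⟨by omega, by omega⟩, rfl⟩
          _ = ∑ j ∈ Finset.Ico 1 (q + 1), (1 / (j : ℝ)) := by
              rw [Finset.sum_image fun a _ b _ h => Nat.eq_of_mul_eq_mul_left hd0 h]
              refine Finset.sum_congr rfl fun j hj => ?_
              have : (d : ℝ) ≠ 0 := by positivity
              have : (j : ℝ) ≠ 0 := by
                have := (Finset.mem_Ico.1 hj).1
                positivity
              push_cast
              field_simp
          _ ≤ _ := sum_Ico_inv_le q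
    _ = _ := by rw [Finset.sum_const, nsmul_eq_mul]

lemma gcd_val_two_le (q : ℕ) : (2 : ZMod q).val.gcd q ≤ 2 := by
  have : (2 : ZMod q).val = 2 % q := by
    have := ZMod.val_natCast q 2
    simpa using this
  rw [this, ← Nat.gcd_rec]
  exact Nat.gcd_le_right _ two_pos

section Count

variable {q : ℕ} [NeZero q]

lemma card_mul_eq_zero_le (c : ZMod q) :
    (Finset.univ.filter fun x : ZMod q => x * c = 0).card ≤ c.val.gcd q := by
  have hq : q ≠ 0 := NeZero.ne q
  have hg : 0 < c.val.gcd q := Nat.gcd_pos_of_pos_right _ (Nat.pos_of_ne_zero hq)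
  have hdvd : q / c.val.gcd q ∣ q := Nat.div_dvd_of_dvd (Nat.gcd_dvd_right _ _)
  have hcard := card_range_filter_dvd hq hdvd
  rw [Nat.div_div_self (Nat.gcd_dvd_right _ _) hq] at hcard
  rw [← hcard]
  refine Finset.card_le_card_of_injOn (fun x => x.val) ?_
    (fun a _ b _ h => ZMod.val_injective q h)
  intro x hx
  simp only [Finset.coe_filter, Finset.mem_univ, true_and, Set.mem_ofPred_eq] at hx
  simp only [Finset.coe_filter, Finset.mem_range, Set.mem_ofPred_eq]
  refine ⟨ZMod.val_lt x, ?_⟩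
  have h1 : q ∣ x.val * c.val := by
    rw [← ZMod.natCast_eq_zero_iff]; push_cast; simpa using hx
  have h2 : q / c.val.gcd q ∣ x.val * (c.val / c.val.gcd q) := by
    rw [← Nat.mul_div_assoc _ (Nat.gcd_dvd_left _ _)]
    exact Nat.div_dvd_div (Nat.gcd_dvd_right _ _) h1
  exact (Nat.Coprime.symm (Nat.coprime_div_gcd_div_gcd hg)).dvd_of_dvd_mul_right h2

lemma card_mul_eq_le (c v : ZMod q) :
    (Finset.univ.filter fun x : ZMod q => x * c = v).card ≤ c.val.gcd q := by
  rcases (Finset.univ.filter fun x : ZMod q => x * c = v).eq_empty_or_nonempty with h | ⟨x₀, h₀⟩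
  · simp [h]
  refine le_trans ?_ (card_mul_eq_zero_le c)
  refine Finset.card_le_card_of_injOn (fun x => x - x₀) ?_ (fun a _ b _ h => sub_left_injective h)
  intro x hx
  simp only [Finset.mem_filter, Finset.mem_univ, true_and] at h₀
  simp only [Finset.coe_filter, Finset.mem_univ, true_and, Set.mem_ofPred_eq] at hx ⊢
  rw [sub_mul, hx, h₀, sub_self]

lemma gcd_val_mul_le (y z : ZMod q) :
    (y * z).val.gcd q ≤ y.val.gcd q * z.val.gcd q := by
  have hq : 0 < q := Nat.pos_of_ne_zero (NeZero.ne q)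
  rw [ZMod.val_mul, ← Nat.gcd_rec]
  refine Nat.le_of_dvd (Nat.mul_pos (Nat.gcd_pos_of_pos_right _ hq)
    (Nat.gcd_pos_of_pos_right _ hq)) ?_
  rw [Nat.gcd_comm y.val, Nat.gcd_comm z.val]
  exact Nat.gcd_mul_right_dvd_mul_gcd _ _ _

lemma card_two_mul_sub_le (y z : ZMod q) :
    (Finset.univ.filter fun x : ZMod q => (2 * x - y - z) * (y * z) = 0).card
      ≤ 2 * (y.val.gcd q * z.val.gcd q) := by
  calc _ ≤ 2 * (Finset.univ.filter fun w : ZMod q => w * (y * z) = 0).card := by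
        refine Finset.card_le_mul_card_image_of_maps_to (f := fun x : ZMod q => 2 * x - y - z)
          ?_ 2 ?_
        · intro x hx
          simpa using hx
        · intro w _
          refine le_trans (Finset.card_le_card (t := Finset.univ.filter
            fun x : ZMod q => x * 2 = w + y + z) ?_) ((card_mul_eq_le _ _).trans (gcd_val_two_le q))
          intro x hx
          simp only [Finset.mem_filter, Finset.mem_univ, true_and] at hx ⊢
          rw [← hx.2]; ring
    _ ≤ _ := by
        gcongr
        exact (card_mul_eq_zero_le _).trans (gcd_val_mul_le y z)

lemma card_cubic_le :
    (Finset.univ.filter fun p : ZMod q × ZMod q × ZMod q =>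
      (p.1 + p.2.1) * ((p.2.2 - p.1) * (p.2.2 - p.2.1)) = 0).card
      ≤ 2 * (q * q.divisors.card) ^ 2 := by
  calc _ ≤ ((Finset.univ : Finset (ZMod q × ZMod q)).sigma fun p =>
        Finset.univ.filter fun x : ZMod q => (2 * x - p.1 - p.2) * (p.1 * p.2) = 0).card := by
        refine Finset.card_le_card_of_injOn
          (fun p => ⟨(p.2.2 - p.1, p.2.2 - p.2.1), p.2.2⟩) ?_ ?_
        · intro p hp
          simp only [Finset.coe_filter, Finset.mem_univ, true_and, Set.mem_ofPred_eq,
            Finset.coe_sigma, Set.mem_sigma_iff, Finset.mem_coe] at hp ⊢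
          rw [← hp]; ring
        · rintro ⟨a, b, c⟩ _ ⟨a', b', c'⟩ _ h
          simp only [Sigma.mk.injEq, Prod.mk.injEq, heq_eq_eq] at h
          obtain ⟨⟨h1, h2⟩, rfl⟩ := h
          simp only [Prod.mk.injEq]
          exact ⟨sub_right_injective h1, sub_right_injective h2, trivial⟩
    _ = ∑ p : ZMod q × ZMod q,
        (Finset.univ.filter fun x : ZMod q => (2 * x - p.1 - p.2) * (p.1 * p.2) = 0).card :=
        Finset.card_sigma _ _
    _ ≤ ∑ p : ZMod q × ZMod q, 2 * (p.1.val.gcd q * p.2.val.gcd q) :=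
        Finset.sum_le_sum fun p _ => card_two_mul_sub_le _ _
    _ = 2 * (∑ x : ZMod q, x.val.gcd q) ^ 2 := by
        rw [← Finset.mul_sum, sq, Finset.sum_mul_sum, Fintype.sum_prod_type]
    _ ≤ _ := by gcongr; exact sum_gcd_zmod_le q

/-- The additive energy of the modular hyperbola. -/
lemma card_energy_le :
    (Finset.univ.filter fun p : ((ZMod q)ˣ × (ZMod q)ˣ) × ((ZMod q)ˣ × (ZMod q)ˣ) =>
      ((p.1.1 : ZMod q) + p.1.2 = p.2.1 + p.2.2) ∧
      (((p.1.1⁻¹ : (ZMod q)ˣ) : ZMod q) + (p.1.2⁻¹ : (ZMod q)ˣ) =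
        (p.2.1⁻¹ : (ZMod q)ˣ) + (p.2.2⁻¹ : (ZMod q)ˣ))).card
      ≤ 2 * (q * q.divisors.card) ^ 2 := by
  refine le_trans ?_ card_cubic_le
  refine Finset.card_le_card_of_injOn
    (fun p => ((p.1.1 : ZMod q), (p.1.2 : ZMod q), (p.2.1 : ZMod q))) ?_ ?_
  · rintro ⟨⟨a, b⟩, c, d⟩ hp
    simp only [Finset.coe_filter, Finset.mem_univ, true_and, Set.mem_ofPred_eq] at hp ⊢
    obtain ⟨h1, h2⟩ := hp
    have ha := a.mul_inv
    have hb := b.mul_inv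
    have hc := c.mul_inv
    have hd := d.mul_inv
    have hd' : (d : ZMod q) = a + b - c := by rw [h1]; ring
    have h3 : ((a : ZMod q) + b) * (c * d) = (c + d) * (a * b) := by
      linear_combination (a * b * c * d : ZMod q) * h2 - (b * c * d : ZMod q) * ha
        - (a * c * d : ZMod q) * hb + (a * b * d : ZMod q) * hc + (a * b * c : ZMod q) * hd
    rw [hd'] at h3
    linear_combination -h3
  · rintro ⟨⟨a, b⟩, c, d⟩ hp ⟨⟨a', b'⟩, c', d'⟩ hp' h
    simp only [Finset.coe_filter, Finset.mem_univ, true_and, Set.mem_ofPred_eq] at hp hp'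
    simp only [Prod.mk.injEq, Units.val_inj] at h
    obtain ⟨rfl, rfl, rfl⟩ := h
    have : (d : ZMod q) = d' := by
      have := hp.1.symm.trans hp'.1
      exact add_left_cancel this
    rw [Units.val_inj] at this
    rw [this]

end Count

section Kloosterman

variable {q : ℕ} [NeZero q]

open ZMod in
/-- The Kloosterman sum `∑ e((h u + k u⁻¹)/q)` over units `u` modulo `q`. -/
noncomputable def kloosterman (h k : ZMod q) : ℂ :=
  ∑ u : (ZMod q)ˣ, stdAddChar (h * (u : ZMod q) + k * ((u⁻¹ : (ZMod q)ˣ) : ZMod q))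

lemma norm_stdAddChar (x : ZMod q) : ‖ZMod.stdAddChar x‖ = 1 := by
  rw [ZMod.stdAddChar_apply, Circle.norm_coe]

lemma kloosterman_zero : kloosterman (0 : ZMod q) 0 = q.totient := by
  simp [kloosterman, ZMod.card_units_eq_totient]

lemma kloosterman_comm (h k : ZMod q) : kloosterman h k = kloosterman k h := by
  unfold kloosterman
  refine Fintype.sum_equiv (Equiv.inv _) _ _ fun u => ?_
  simp [add_comm]

lemma kloosterman_smul (h k : ZMod q) (v : (ZMod q)ˣ) :
    kloosterman (h * (v : ZMod q)) (k * ((v⁻¹ : (ZMod q)ˣ) : ZMod q)) = kloosterman h k := by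
  unfold kloosterman
  refine Fintype.sum_equiv (Equiv.mulLeft v) _ _ fun u => ?_
  simp only [Equiv.coe_mulLeft, mul_inv_rev, Units.val_mul]
  congr 1
  ring

lemma sum_normSq_eq {ι : Type*} [Fintype ι] (s t : ι → ZMod q) :
    ∑ h : ZMod q, ∑ k : ZMod q, ‖∑ i, ZMod.stdAddChar (h * s i + k * t i)‖ ^ 2 =
      q ^ 2 * ((Finset.univ.filter fun p : ι × ι => s p.1 = s p.2 ∧ t p.1 = t p.2).card : ℝ) := by
  have key : ∀ h k : ZMod q, ((‖∑ i, ZMod.stdAddChar (h * s i + k * t i)‖ ^ 2 : ℝ) : ℂ) =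
      ∑ i, ∑ j, ZMod.stdAddChar (h * (s i - s j)) * ZMod.stdAddChar (k * (t i - t j)) := by
    intro h k
    rw [Complex.ofReal_pow, ← Complex.mul_conj', map_sum, Finset.sum_mul_sum]
    refine Finset.sum_congr rfl fun i _ => Finset.sum_congr rfl fun j _ => ?_
    rw [← AddChar.map_neg_eq_conj, ← AddChar.map_add_eq_mul, ← AddChar.map_add_eq_mul]
    congr 1
    ring
  apply Complex.ofReal_injective
  push_cast
  simp only [← Complex.ofReal_pow]
  simp_rw [key]
  have horth : ∀ b : ZMod q, ∑ x : ZMod q, (ZMod.stdAddChar (x * b) : ℂ) =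
      if b = 0 then (q : ℂ) else 0 := by
    intro b
    have := AddChar.sum_mulShift b (ZMod.isPrimitive_stdAddChar q)
    rw [this, ZMod.card]
    simp
  calc _ = ∑ i, ∑ j, (∑ h : ZMod q, ZMod.stdAddChar (h * (s i - s j))) *
        ∑ k : ZMod q, ZMod.stdAddChar (k * (t i - t j)) := by
        simp_rw [Finset.sum_mul_sum]
        rw [Finset.sum_congr rfl fun h _ => Finset.sum_comm, Finset.sum_comm]
        refine Finset.sum_congr rfl fun i _ => ?_
        rw [Finset.sum_congr rfl fun h _ => Finset.sum_comm, Finset.sum_comm]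
    _ = ∑ p : ι × ι, if s p.1 = s p.2 ∧ t p.1 = t p.2 then (q : ℂ) ^ 2 else 0 := by
        rw [Fintype.sum_prod_type]
        refine Finset.sum_congr rfl fun i _ => Finset.sum_congr rfl fun j _ => ?_
        rw [horth, horth]
        simp only [sub_eq_zero]
        split_ifs <;> simp_all [sq]
    _ = _ := by
        rw [← Finset.sum_filter, Finset.sum_const, nsmul_eq_mul, mul_comm]

lemma sum_kloosterman_pow_four_le :
    ∑ h : ZMod q, ∑ k : ZMod q, ‖kloosterman h k‖ ^ 4 ≤
      2 * (q : ℝ) ^ 4 * (q.divisors.card : ℝ) ^ 2 := by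
  have h1 : ∀ h k : ZMod q, ‖kloosterman h k‖ ^ 4 =
      ‖∑ p : (ZMod q)ˣ × (ZMod q)ˣ, ZMod.stdAddChar (h * ((p.1 : ZMod q) + (p.2 : ZMod q)) +
        k * (((p.1⁻¹ : (ZMod q)ˣ) : ZMod q) + ((p.2⁻¹ : (ZMod q)ˣ) : ZMod q)))‖ ^ 2 := by
    intro h k
    have : ‖kloosterman h k‖ ^ 4 = ‖kloosterman h k * kloosterman h k‖ ^ 2 := by
      rw [norm_mul]; ring
    rw [this, kloosterman, Finset.sum_mul_sum, Fintype.sum_prod_type]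
    congr 2
    refine Finset.sum_congr rfl fun i _ => Finset.sum_congr rfl fun j _ => ?_
    rw [← AddChar.map_add_eq_mul]
    congr 1
    ring
  simp_rw [h1]
  rw [sum_normSq_eq]
  have h2 := card_energy_le (q := q)
  have h3 : ((Finset.univ.filter fun p : ((ZMod q)ˣ × (ZMod q)ˣ) × ((ZMod q)ˣ × (ZMod q)ˣ) =>
      ((p.1.1 : ZMod q) + p.1.2 = p.2.1 + p.2.2) ∧
      (((p.1.1⁻¹ : (ZMod q)ˣ) : ZMod q) + (p.1.2⁻¹ : (ZMod q)ˣ) =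
        (p.2.1⁻¹ : (ZMod q)ˣ) + (p.2.2⁻¹ : (ZMod q)ˣ))).card : ℝ)
      ≤ 2 * (q * q.divisors.card) ^ 2 := by exact_mod_cast h2
  calc _ ≤ (q : ℝ) ^ 2 * (2 * (q * q.divisors.card) ^ 2) := by gcongr
    _ = _ := by ring

lemma totient_mul_norm_kloosterman_pow_four_le (h k : ZMod q) :
    (q.totient : ℝ) * ‖kloosterman h k‖ ^ 4 ≤
      (h.val.gcd q : ℝ) * (2 * (q : ℝ) ^ 4 * (q.divisors.card : ℝ) ^ 2) := by
  classical
  have h0 : ∀ h' : ZMod q, ∑ v : (ZMod q)ˣ,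
      (if h * (v : ZMod q) = h' then (1 : ℝ) else 0) ≤ (h.val.gcd q : ℝ) := by
    intro h'
    rw [Finset.sum_boole]
    refine Nat.cast_le.2 (le_trans ?_ (card_mul_eq_le h h'))
    refine Finset.card_le_card_of_injOn (fun v => (v : ZMod q)) ?_
      (fun a _ b _ hab => Units.ext hab)
    intro v hv
    simpa [mul_comm] using hv
  calc (q.totient : ℝ) * ‖kloosterman h k‖ ^ 4
      = ∑ v : (ZMod q)ˣ, ‖kloosterman (h * (v : ZMod q)) (k * ((v⁻¹ : (ZMod q)ˣ) : ZMod q))‖ ^ 4 := by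
        simp_rw [kloosterman_smul]
        simp [ZMod.card_units_eq_totient]
    _ ≤ ∑ v : (ZMod q)ˣ, ∑ k' : ZMod q, ‖kloosterman (h * (v : ZMod q)) k'‖ ^ 4 :=
        Finset.sum_le_sum fun v _ => Finset.single_le_sum
          (f := fun k' => ‖kloosterman (h * (v : ZMod q)) k'‖ ^ 4)
          (fun _ _ => by positivity) (Finset.mem_univ _)
    _ = ∑ v : (ZMod q)ˣ, ∑ h' : ZMod q, (if h * (v : ZMod q) = h' then (1 : ℝ) else 0) *
          ∑ k' : ZMod q, ‖kloosterman h' k'‖ ^ 4 := by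
        refine Finset.sum_congr rfl fun v _ => ?_
        simp
    _ = ∑ h' : ZMod q, (∑ v : (ZMod q)ˣ, if h * (v : ZMod q) = h' then (1 : ℝ) else 0) *
          ∑ k' : ZMod q, ‖kloosterman h' k'‖ ^ 4 := by
        rw [Finset.sum_comm]
        simp_rw [Finset.sum_mul]
    _ ≤ ∑ h' : ZMod q, (h.val.gcd q : ℝ) * ∑ k' : ZMod q, ‖kloosterman h' k'‖ ^ 4 :=
        Finset.sum_le_sum fun h' _ => mul_le_mul_of_nonneg_right (h0 h')
          (Finset.sum_nonneg fun _ _ => by positivity)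
    _ ≤ _ := by
        rw [← Finset.mul_sum]
        exact mul_le_mul_of_nonneg_left sum_kloosterman_pow_four_le (by positivity)

lemma norm_kloosterman_pow_four_le (h k : ZMod q) :
    ‖kloosterman h k‖ ^ 4 ≤ 2 * (q : ℝ) ^ 3 * (q.divisors.card : ℝ) ^ 3 * (h.val.gcd q : ℝ) := by
  have hq : (0 : ℝ) < q := by exact_mod_cast Nat.pos_of_ne_zero (NeZero.ne q)
  have h1 := totient_mul_norm_kloosterman_pow_four_le h k
  have h2 : (q : ℝ) ≤ q.divisors.card * q.totient := by
    exact_mod_cast le_card_divisors_mul_totient q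
  have h3 : (q : ℝ) * ‖kloosterman h k‖ ^ 4 ≤
      q * (2 * (q : ℝ) ^ 3 * (q.divisors.card : ℝ) ^ 3 * (h.val.gcd q : ℝ)) := by
    calc (q : ℝ) * ‖kloosterman h k‖ ^ 4
        ≤ (q.divisors.card * q.totient) * ‖kloosterman h k‖ ^ 4 := by gcongr
      _ = q.divisors.card * (q.totient * ‖kloosterman h k‖ ^ 4) := by ring
      _ ≤ q.divisors.card * ((h.val.gcd q : ℝ) * (2 * (q : ℝ) ^ 4 * (q.divisors.card : ℝ) ^ 2)) := by
          gcongr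
      _ = _ := by ring
  exact le_of_mul_le_mul_left h3 hq

/-- A constant `kloostermanConst q` with `|K(h,k)| ≤ kloostermanConst q * gcd(h,q)`. -/
noncomputable def kloostermanConst (q : ℕ) : ℝ :=
  (2 * (q : ℝ) ^ 3 * (q.divisors.card : ℝ) ^ 3) ^ (1 / 4 : ℝ)

lemma norm_kloosterman_le_left (h k : ZMod q) :
    ‖kloosterman h k‖ ≤ kloostermanConst q * (h.val.gcd q : ℝ) := by
  have hg : (1 : ℝ) ≤ (h.val.gcd q : ℝ) := by
    exact_mod_cast Nat.gcd_pos_of_pos_right _ (Nat.pos_of_ne_zero (NeZero.ne q))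
  have h1 := norm_kloosterman_pow_four_le h k
  have h2 : kloostermanConst q ^ 4 = 2 * (q : ℝ) ^ 3 * (q.divisors.card : ℝ) ^ 3 := by
    rw [kloostermanConst, ← Real.rpow_natCast, ← Real.rpow_mul (by positivity)]
    norm_num
  have h3 : 0 ≤ kloostermanConst q := by unfold kloostermanConst; positivity
  refine le_of_pow_le_pow_left₀ (n := 4) (by norm_num) (by positivity) ?_
  rw [mul_pow, h2]
  refine h1.trans ?_
  gcongr
  exact le_self_pow₀ hg (by norm_num)

lemma norm_kloosterman_le_right (h k : ZMod q) :
    ‖kloosterman h k‖ ≤ kloostermanConst q * (k.val.gcd q : ℝ) := by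
  rw [kloosterman_comm]; exact norm_kloosterman_le_left k h

end Kloosterman

section Box

variable {q : ℕ} [NeZero q]

/-- The Fourier coefficient of an interval modulo `q`. -/
noncomputable def intervalFourier (s : Finset ℕ) (h : ZMod q) : ℂ :=
  ∑ i ∈ s, ZMod.stdAddChar (-(h * (i : ZMod q)))

lemma norm_intervalFourier_le_card (s : Finset ℕ) (h : ZMod q) :
    ‖intervalFourier s h‖ ≤ s.card := by
  refine (norm_sum_le _ _).trans ?_
  simp

lemma le_norm_stdAddChar_sub_one {n : ℕ} (hn : n < q) :
    (4 : ℝ) * min (n : ℝ) (q - n) / q ≤ ‖ZMod.stdAddChar (n : ZMod q) - 1‖ := by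
  have hq : (0 : ℝ) < q := by exact_mod_cast Nat.pos_of_ne_zero (NeZero.ne q)
  have hnq : (n : ℝ) < q := by exact_mod_cast hn
  have h1 : ZMod.stdAddChar (n : ZMod q) = Complex.exp (Complex.I * ((2 * π * n / q : ℝ) : ℂ)) := by
    have := ZMod.stdAddChar_coe (N := q) (n : ℤ)
    rw [Int.cast_natCast] at this
    rw [this]
    congr 1
    push_cast
    ring
  rw [h1, Complex.norm_exp_I_mul_ofReal_sub_one, norm_mul, Real.norm_eq_abs, Real.norm_eq_abs,
    abs_of_pos (two_pos : (0 : ℝ) < 2)]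
  have hx : 2 * π * n / q / 2 = π * (n / q) := by ring
  rw [hx]
  have hpi := Real.pi_pos
  rcases le_total (n : ℝ) (q / 2) with h | h
  · have h2 : (n : ℝ) / q ≤ 1 / 2 := by rw [div_le_iff₀ hq]; linarith
    have h3 := Real.mul_le_sin (x := π * (n / q)) (by positivity) (by nlinarith)
    have h4 : 2 / π * (π * (n / q)) = 2 * (n / q : ℝ) := by field_simp
    rw [h4] at h3
    have h5 : (4 : ℝ) * min (n : ℝ) (q - n) / q ≤ 4 * n / q := by
      gcongr; exact min_le_left _ _
    calc _ ≤ 4 * (n : ℝ) / q := h5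
      _ = 2 * (2 * (n / q : ℝ)) := by ring
      _ ≤ _ := by gcongr; exact h3.trans (le_abs_self _)
  · have h2 : ((q : ℝ) - n) / q ≤ 1 / 2 := by rw [div_le_iff₀ hq]; linarith
    have h6 : 0 ≤ ((q : ℝ) - n) / q := div_nonneg (by linarith) hq.le
    have h3 := Real.mul_le_sin (x := π * ((q - n) / q)) (by positivity) (by nlinarith)
    have h4 : 2 / π * (π * ((q - n) / q)) = 2 * ((q - n) / q : ℝ) := by field_simp
    have h7 : π * ((q - n) / q : ℝ) = π - π * (n / q) := by field_simp
    rw [h4, h7, Real.sin_pi_sub] at h3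
    have h5 : (4 : ℝ) * min (n : ℝ) (q - n) / q ≤ 4 * (q - n) / q := by
      gcongr; exact min_le_right _ _
    calc _ ≤ 4 * ((q : ℝ) - n) / q := h5
      _ = 2 * (2 * ((q - n) / q : ℝ)) := by ring
      _ ≤ _ := by gcongr; exact h3.trans (le_abs_self _)

lemma norm_intervalFourier_le {n : ℕ} (h0 : n ≠ 0) (hn : n < q) (a b : ℕ) :
    ‖intervalFourier (Finset.Ico a b) (n : ZMod q)‖ ≤
      (q : ℝ) / 2 * (1 / n + 1 / ((q - n : ℕ) : ℝ)) := by
  have hq : (0 : ℝ) < q := by exact_mod_cast Nat.pos_of_ne_zero (NeZero.ne q)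
  have hn0 : (0 : ℝ) < n := by positivity
  have hnq : (n : ℝ) < q := by exact_mod_cast hn
  rw [Nat.cast_sub hn.le]
  have hqn : (0 : ℝ) < q - n := by linarith
  rcases le_or_gt b a with hab | hab
  · rw [intervalFourier, Finset.Ico_eq_empty_of_le hab, Finset.sum_empty, norm_zero]
    positivity
  set z : ℂ := ZMod.stdAddChar (-(n : ZMod q)) with hz
  have hlow := le_norm_stdAddChar_sub_one hn
  have hzn : ‖z - 1‖ = ‖ZMod.stdAddChar (n : ZMod q) - 1‖ := by
    rw [hz, AddChar.map_neg_eq_conj, ← Complex.norm_conj (ZMod.stdAddChar (n : ZMod q) - 1)]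
    simp
  have hmin : 0 < min (n : ℝ) (q - n) := lt_min hn0 hqn
  have hpos : 0 < 4 * min (n : ℝ) (q - n) / q := by positivity
  rw [← hzn] at hlow
  have hz1 : z ≠ 1 := by
    intro h
    rw [h, sub_self, norm_zero] at hlow
    linarith
  have hE : intervalFourier (Finset.Ico a b) (n : ZMod q) = ∑ i ∈ Finset.Ico a b, z ^ i := by
    refine Finset.sum_congr rfl fun i _ => ?_
    rw [hz, ← AddChar.map_nsmul_eq_pow]
    congr 1
    simp [mul_comm]
  have hz_norm : ‖z‖ = 1 := norm_stdAddChar _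
  rw [hE, geom_sum_Ico hz1 hab.le, norm_div]
  calc ‖z ^ b - z ^ a‖ / ‖z - 1‖ ≤ 2 / (4 * min (n : ℝ) (q - n) / q) := by
        gcongr
        refine (norm_sub_le _ _).trans ?_
        rw [norm_pow, norm_pow, hz_norm]; norm_num
    _ = (q : ℝ) / 2 * (1 / min (n : ℝ) (q - n)) := by field_simp; norm_num
    _ ≤ _ := by
        gcongr
        rcases min_cases (n : ℝ) (q - n) with ⟨h, _⟩ | ⟨h, _⟩ <;> rw [h]
        · have : 0 ≤ 1 / ((q : ℝ) - n) := by positivity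
          linarith
        · have : 0 ≤ 1 / (n : ℝ) := by positivity
          linarith

/-- `τ(q) (1 + log q)`. -/
noncomputable def divisorLog (q : ℕ) : ℝ := q.divisors.card * (1 + Real.log q)

lemma divisorLog_nonneg (q : ℕ) : 0 ≤ divisorLog q := by
  have := Real.log_natCast_nonneg q
  unfold divisorLog; positivity

lemma sum_norm_intervalFourier_mul_gcd_le (a b : ℕ) :
    ∑ h ∈ Finset.univ.erase (0 : ZMod q),
      ‖intervalFourier (Finset.Ico a b) h‖ * (h.val.gcd q : ℝ) ≤ q * divisorLog q := by
  have hq0 : q ≠ 0 := NeZero.ne q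
  have h1 : ∑ h ∈ Finset.univ.erase (0 : ZMod q),
      ‖intervalFourier (Finset.Ico a b) h‖ * (h.val.gcd q : ℝ) =
      ∑ n ∈ Finset.Ico 1 q, ‖intervalFourier (Finset.Ico a b) (n : ZMod q)‖ * (n.gcd q : ℝ) := by
    refine Finset.sum_bij' (fun x _ => x.val) (fun n _ => (n : ZMod q)) ?_ ?_ ?_ ?_ ?_
    · intro x hx
      rw [Finset.mem_erase] at hx
      exact Finset.mem_Ico.2 ⟨Nat.pos_of_ne_zero fun h => hx.1 ((ZMod.val_eq_zero x).1 h),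
        ZMod.val_lt x⟩
    · intro n hn
      rw [Finset.mem_Ico] at hn
      refine Finset.mem_erase.2 ⟨fun h => ?_, Finset.mem_univ _⟩
      rw [ZMod.natCast_eq_zero_iff] at h
      exact absurd (Nat.le_of_dvd (by omega) h) (by omega)
    · intro x _; simp
    · intro n hn; exact ZMod.val_cast_of_lt (Finset.mem_Ico.1 hn).2
    · intro x _; simp
  rw [h1]
  have hrefl : ∑ n ∈ Finset.Ico 1 q, (n.gcd q : ℝ) / ((q - n : ℕ) : ℝ) =
      ∑ n ∈ Finset.Ico 1 q, (n.gcd q : ℝ) / n := by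
    refine Finset.sum_bij' (fun n _ => q - n) (fun n _ => q - n) ?_ ?_ ?_ ?_ ?_
    · intro n hn; rw [Finset.mem_Ico] at hn ⊢; omega
    · intro n hn; rw [Finset.mem_Ico] at hn ⊢; omega
    · intro n hn; rw [Finset.mem_Ico] at hn; omega
    · intro n hn; rw [Finset.mem_Ico] at hn; omega
    · intro n hn
      rw [Finset.mem_Ico] at hn
      rw [Nat.gcd_comm (q - n), Nat.gcd_self_sub_right hn.2.le, Nat.gcd_comm]
  calc _ ≤ ∑ n ∈ Finset.Ico 1 q,
        ((q : ℝ) / 2 * (1 / n + 1 / ((q - n : ℕ) : ℝ))) * (n.gcd q : ℝ) := by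
        refine Finset.sum_le_sum fun n hn => ?_
        rw [Finset.mem_Ico] at hn
        gcongr
        exact norm_intervalFourier_le (by omega) hn.2 a b
    _ = (q : ℝ) / 2 * (∑ n ∈ Finset.Ico 1 q, (n.gcd q : ℝ) / n +
        ∑ n ∈ Finset.Ico 1 q, (n.gcd q : ℝ) / ((q - n : ℕ) : ℝ)) := by
        rw [← Finset.sum_add_distrib, Finset.mul_sum]
        refine Finset.sum_congr rfl fun n _ => ?_
        ring
    _ = (q : ℝ) * ∑ n ∈ Finset.Ico 1 q, (n.gcd q : ℝ) / n := by rw [hrefl]; ring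
    _ ≤ _ := by
        gcongr
        exact sum_gcd_div_le q hq0

lemma sum_norm_intervalFourier_le {a b : ℕ} (hab : b - a ≤ q) :
    ∑ h : ZMod q, ‖intervalFourier (Finset.Ico a b) h‖ ≤ q * (1 + divisorLog q) := by
  rw [← Finset.add_sum_erase _ _ (Finset.mem_univ (0 : ZMod q)), mul_add, mul_one]
  have h1 : ‖intervalFourier (Finset.Ico a b) (0 : ZMod q)‖ ≤ q := by
    refine (norm_intervalFourier_le_card _ _).trans ?_
    rw [Nat.card_Ico]; exact_mod_cast hab
  refine add_le_add h1 (le_trans (Finset.sum_le_sum fun h _ => ?_)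
    (sum_norm_intervalFourier_mul_gcd_le a b))
  have hg : (1 : ℝ) ≤ (h.val.gcd q : ℝ) := by
    exact_mod_cast Nat.gcd_pos_of_pos_right _ (Nat.pos_of_ne_zero (NeZero.ne q))
  exact le_mul_of_one_le_right (norm_nonneg _) hg

lemma count_eq_sum_kloosterman (c : (ZMod q)ˣ) (s t : Finset ℕ) :
    ((∑ x ∈ s, ∑ y ∈ t, if (x : ZMod q) * y = c then (1 : ℝ) else 0 : ℝ) : ℂ) =
      1 / (q : ℂ) ^ 2 * ∑ h : ZMod q, ∑ k : ZMod q,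
        intervalFourier s h * intervalFourier t k * kloosterman h (k * c) := by
  have hq : (q : ℂ) ≠ 0 := by exact_mod_cast NeZero.ne q
  have horth : ∀ b : ZMod q, ∑ x : ZMod q, (ZMod.stdAddChar (x * b) : ℂ) =
      if b = 0 then (q : ℂ) else 0 := by
    intro b
    rw [AddChar.sum_mulShift b (ZMod.isPrimitive_stdAddChar q), ZMod.card]
    simp
  have hind : ∀ x y : ℕ, ((if (x : ZMod q) * y = c then (1 : ℝ) else 0 : ℝ) : ℂ) =
      1 / (q : ℂ) ^ 2 * ∑ u : (ZMod q)ˣ,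
        (∑ h : ZMod q, ZMod.stdAddChar (h * ((u : ZMod q) - (x : ZMod q)))) *
        ∑ k : ZMod q, ZMod.stdAddChar (k * ((c : ZMod q) * ((u⁻¹ : (ZMod q)ˣ) : ZMod q) - (y : ZMod q))) := by
    intro x y
    simp_rw [horth, sub_eq_zero]
    split_ifs with h
    · have hx : IsUnit (x : ZMod q) := isUnit_of_mul_isUnit_left (h ▸ c.isUnit)
      obtain ⟨v, hv⟩ := hx
      rw [Finset.sum_eq_single v]
      · have : (c : ZMod q) * ((v⁻¹ : (ZMod q)ˣ) : ZMod q) = y := by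
          rw [← h, ← hv, mul_comm, ← mul_assoc]; simp
        rw [if_pos hv, if_pos this]
        field_simp
        simp
      · intro u _ hu
        rw [if_neg, zero_mul]
        intro h'
        exact hu (Units.ext (h'.trans hv.symm))
      · simp
    · rw [Finset.sum_eq_zero, mul_zero]
      · simp
      · intro u _
        split_ifs with h1 h2
        · exfalso
          apply h
          rw [← h1, ← h2, mul_comm, mul_assoc]; simp
        all_goals simp
  have hexp : ∀ (h k : ZMod q), intervalFourier s h * intervalFourier t k * kloosterman h (k * c) =
      ∑ x ∈ s, ∑ y ∈ t, ∑ u : (ZMod q)ˣ, ZMod.stdAddChar (h * ((u : ZMod q) - (x : ZMod q))) *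
        ZMod.stdAddChar (k * ((c : ZMod q) * ((u⁻¹ : (ZMod q)ˣ) : ZMod q) - (y : ZMod q))) := by
    intro h k
    rw [intervalFourier, intervalFourier, kloosterman, Finset.sum_mul_sum, Finset.sum_mul]
    refine Finset.sum_congr rfl fun x _ => ?_
    rw [Finset.sum_mul]
    refine Finset.sum_congr rfl fun y _ => ?_
    rw [Finset.mul_sum]
    refine Finset.sum_congr rfl fun u _ => ?_
    rw [← AddChar.map_add_eq_mul, ← AddChar.map_add_eq_mul, ← AddChar.map_add_eq_mul]
    congr 1
    ring
  push_cast
  simp_rw [hexp]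
  simp_rw [hind, ← Finset.mul_sum]
  congr 1
  simp_rw [Finset.sum_mul_sum]
  symm
  calc _ = ∑ h : ZMod q, ∑ x ∈ s, ∑ k : ZMod q, ∑ y ∈ t, ∑ u : (ZMod q)ˣ,
        ZMod.stdAddChar (h * ((u : ZMod q) - (x : ZMod q))) *
        ZMod.stdAddChar (k * ((c : ZMod q) * ((u⁻¹ : (ZMod q)ˣ) : ZMod q) - (y : ZMod q))) :=
        Finset.sum_congr rfl fun h _ => Finset.sum_comm
    _ = ∑ x ∈ s, ∑ h : ZMod q, ∑ k : ZMod q, ∑ y ∈ t, ∑ u : (ZMod q)ˣ,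
        ZMod.stdAddChar (h * ((u : ZMod q) - (x : ZMod q))) *
        ZMod.stdAddChar (k * ((c : ZMod q) * ((u⁻¹ : (ZMod q)ˣ) : ZMod q) - (y : ZMod q))) := Finset.sum_comm
    _ = _ := by
      refine Finset.sum_congr rfl fun x _ => ?_
      calc _ = ∑ h : ZMod q, ∑ y ∈ t, ∑ u : (ZMod q)ˣ, ∑ k : ZMod q,
            ZMod.stdAddChar (h * ((u : ZMod q) - (x : ZMod q))) *
            ZMod.stdAddChar (k * ((c : ZMod q) * ((u⁻¹ : (ZMod q)ˣ) : ZMod q) - (y : ZMod q))) := by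
            refine Finset.sum_congr rfl fun h _ => ?_
            rw [Finset.sum_comm]
            exact Finset.sum_congr rfl fun y _ => Finset.sum_comm
        _ = _ := by
            rw [Finset.sum_comm]
            exact Finset.sum_congr rfl fun y _ => Finset.sum_comm

/-- Bound for the discrepancy of the modular hyperbola in boxes. -/
noncomputable def boxError (q : ℕ) : ℝ :=
  kloostermanConst q * (divisorLog q * (2 + divisorLog q))

lemma abs_count_sub_le (c : (ZMod q)ˣ) {a b a' b' : ℕ} (hab : b - a ≤ q) (hab' : b' - a' ≤ q) :
    |∑ x ∈ Finset.Ico a b, ∑ y ∈ Finset.Ico a' b',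
      ((if (x : ZMod q) * y = c then (1 : ℝ) else 0) - q.totient / (q : ℝ) ^ 2)| ≤ boxError q := by
  have hq : (0 : ℝ) < q := by exact_mod_cast Nat.pos_of_ne_zero (NeZero.ne q)
  set s := Finset.Ico a b
  set t := Finset.Ico a' b'
  set F : ZMod q → ZMod q → ℂ := fun h k =>
    intervalFourier s h * intervalFourier t k * kloosterman h (k * c) with hF
  have hK0 : 0 ≤ kloostermanConst q := by unfold kloostermanConst; positivity
  have hs0 : ‖intervalFourier s (0 : ZMod q)‖ ≤ q := by
    refine (norm_intervalFourier_le_card _ _).trans ?_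
    rw [Nat.card_Ico]; exact_mod_cast hab
  have hgc : ∀ k : ZMod q, ((k * c).val.gcd q : ℝ) ≤ (k.val.gcd q : ℝ) := by
    intro k
    have h1 := gcd_val_mul_le k (c : ZMod q)
    have h2 : (c : ZMod q).val.gcd q = 1 := ZMod.val_coe_unit_coprime c
    rw [h2, mul_one] at h1
    exact_mod_cast h1
  have hmain : ((∑ x ∈ s, ∑ y ∈ t,
      ((if (x : ZMod q) * y = c then (1 : ℝ) else 0) - q.totient / (q : ℝ) ^ 2) : ℝ) : ℂ) =
      1 / (q : ℂ) ^ 2 * (∑ h ∈ Finset.univ.erase (0 : ZMod q), ∑ k : ZMod q, F h k +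
        ∑ k ∈ Finset.univ.erase (0 : ZMod q), F 0 k) := by
    simp_rw [Finset.sum_sub_distrib]
    rw [Complex.ofReal_sub, count_eq_sum_kloosterman c s t,
      ← Finset.add_sum_erase _ _ (Finset.mem_univ (0 : ZMod q)),
      ← Finset.add_sum_erase _ (fun k => F 0 k) (Finset.mem_univ (0 : ZMod q))]
    have : F 0 0 = (s.card : ℂ) * t.card * q.totient := by
      simp [hF, intervalFourier, kloosterman_zero]
    rw [this]
    push_cast
    simp only [Finset.sum_const, nsmul_eq_mul]
    ring
  have hA : ‖∑ h ∈ Finset.univ.erase (0 : ZMod q), ∑ k : ZMod q, F h k‖ ≤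
      kloostermanConst q * ((q * divisorLog q) * (q * (1 + divisorLog q))) := by
    calc _ ≤ ∑ h ∈ Finset.univ.erase (0 : ZMod q), ∑ k : ZMod q,
          (‖intervalFourier s h‖ * (h.val.gcd q : ℝ)) *
            (‖intervalFourier t k‖ * kloostermanConst q) := by
          refine (norm_sum_le _ _).trans (Finset.sum_le_sum fun h _ =>
            (norm_sum_le _ _).trans (Finset.sum_le_sum fun k _ => ?_))
          rw [hF, norm_mul, norm_mul]
          calc _ ≤ ‖intervalFourier s h‖ * ‖intervalFourier t k‖ *
                (kloostermanConst q * (h.val.gcd q : ℝ)) := by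
                gcongr; exact norm_kloosterman_le_left _ _
            _ = _ := by ring
      _ = (∑ h ∈ Finset.univ.erase (0 : ZMod q), ‖intervalFourier s h‖ * (h.val.gcd q : ℝ)) *
            ((∑ k : ZMod q, ‖intervalFourier t k‖) * kloostermanConst q) := by
          rw [Finset.sum_mul (Finset.univ : Finset (ZMod q)), Finset.sum_mul_sum]
      _ ≤ (q * divisorLog q) * ((q * (1 + divisorLog q)) * kloostermanConst q) := by
          have := divisorLog_nonneg q
          gcongr
          · exact sum_norm_intervalFourier_mul_gcd_le a b
          · exact sum_norm_intervalFourier_le hab'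
      _ = _ := by ring
  have hB : ‖∑ k ∈ Finset.univ.erase (0 : ZMod q), F 0 k‖ ≤
      kloostermanConst q * (q * (q * divisorLog q)) := by
    calc _ ≤ ∑ k ∈ Finset.univ.erase (0 : ZMod q),
          (q * kloostermanConst q) * (‖intervalFourier t k‖ * (k.val.gcd q : ℝ)) := by
          refine (norm_sum_le _ _).trans (Finset.sum_le_sum fun k _ => ?_)
          rw [hF, norm_mul, norm_mul]
          calc _ ≤ q * ‖intervalFourier t k‖ * (kloostermanConst q * (k.val.gcd q : ℝ)) := by
                gcongr
                exact (norm_kloosterman_le_right _ _).trans (by gcongr; exact_mod_cast hgc k)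
            _ = _ := by ring
      _ = (q * kloostermanConst q) *
          ∑ k ∈ Finset.univ.erase (0 : ZMod q), ‖intervalFourier t k‖ * (k.val.gcd q : ℝ) := by
          rw [Finset.mul_sum]
      _ ≤ (q * kloostermanConst q) * (q * divisorLog q) := by
          gcongr; exact sum_norm_intervalFourier_mul_gcd_le a' b'
      _ = _ := by ring
  rw [← Real.norm_eq_abs, ← Complex.norm_real, hmain, norm_mul]
  have hn : ‖(1 : ℂ) / (q : ℂ) ^ 2‖ = 1 / (q : ℝ) ^ 2 := by simp
  rw [hn]
  calc _ ≤ 1 / (q : ℝ) ^ 2 *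
        (kloostermanConst q * ((q * divisorLog q) * (q * (1 + divisorLog q))) +
          kloostermanConst q * (q * (q * divisorLog q))) := by
        gcongr
        exact (norm_add_le _ _).trans (add_le_add hA hB)
    _ = _ := by
        unfold boxError
        field_simp
        ring

end Box

lemma exists_one_add_log_le_rpow {η : ℝ} (hη : 0 < η) :
    ∃ C : ℝ, 1 ≤ C ∧ ∀ n : ℕ, 1 ≤ n → 1 + Real.log n ≤ C * (n : ℝ) ^ η := by
  refine ⟨1 + 1 / η, by have : 0 < 1 / η := by positivity
                        linarith, fun n hn => ?_⟩
  have h1 : (1 : ℝ) ≤ n := by exact_mod_cast hn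
  have h2 := Real.log_le_rpow_div (x := (n : ℝ)) (by positivity) hη
  have h3 : 1 ≤ (n : ℝ) ^ η := Real.one_le_rpow h1 hη.le
  calc 1 + Real.log n ≤ (n : ℝ) ^ η + (n : ℝ) ^ η / η := add_le_add h3 h2
    _ = _ := by ring

lemma exists_boxError_le :
    ∃ C : ℝ, 0 < C ∧ ∀ q : ℕ, 1 ≤ q → boxError q ≤ C * (q : ℝ) ^ (4 / 5 : ℝ) := by
  obtain ⟨C₁, hC₁, h₁⟩ := exists_card_divisors_le_rpow (η := 1 / 100) (by norm_num)
  obtain ⟨C₂, hC₂, h₂⟩ := exists_one_add_log_le_rpow (η := 1 / 100) (by norm_num)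
  refine ⟨(2 * C₁ ^ 3) ^ (1 / 4 : ℝ) * ((C₁ * C₂) * (3 * (C₁ * C₂))), by positivity,
    fun q hq => ?_⟩
  have hq1 : (1 : ℝ) ≤ q := by exact_mod_cast hq
  have hq0 : (0 : ℝ) < q := by linarith
  have hL : divisorLog q ≤ (C₁ * C₂) * (q : ℝ) ^ (1 / 50 : ℝ) := by
    have hlog := Real.log_nonneg hq1
    calc divisorLog q ≤ (C₁ * (q : ℝ) ^ (1 / 100 : ℝ)) * (C₂ * (q : ℝ) ^ (1 / 100 : ℝ)) := by
          unfold divisorLog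
          exact mul_le_mul (h₁ q hq) (h₂ q hq) (by positivity) (by positivity)
      _ = (C₁ * C₂) * ((q : ℝ) ^ (1 / 100 : ℝ) * (q : ℝ) ^ (1 / 100 : ℝ)) := by ring
      _ = _ := by rw [← Real.rpow_add hq0]; norm_num
  have hone : (1 : ℝ) ≤ (C₁ * C₂) * (q : ℝ) ^ (1 / 50 : ℝ) :=
    one_le_mul_of_one_le_of_one_le (one_le_mul_of_one_le_of_one_le hC₁ hC₂)
      (Real.one_le_rpow hq1 (by norm_num))
  have hK : kloostermanConst q ≤ (2 * C₁ ^ 3) ^ (1 / 4 : ℝ) * (q : ℝ) ^ (3 / 4 + 3 / 400 : ℝ) := by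
    unfold kloostermanConst
    calc (2 * (q : ℝ) ^ 3 * (q.divisors.card : ℝ) ^ 3) ^ (1 / 4 : ℝ)
        ≤ (2 * (q : ℝ) ^ 3 * (C₁ * (q : ℝ) ^ (1 / 100 : ℝ)) ^ 3) ^ (1 / 4 : ℝ) := by
          gcongr; exact h₁ q hq
      _ = ((2 * C₁ ^ 3) * ((q : ℝ) ^ (3 + 3 / 100 : ℝ))) ^ (1 / 4 : ℝ) := by
          congr 1
          rw [Real.rpow_add hq0, mul_pow, ← Real.rpow_natCast ((q : ℝ) ^ (1 / 100 : ℝ)),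
            ← Real.rpow_mul hq0.le]
          have : (q : ℝ) ^ (3 : ℝ) = (q : ℝ) ^ 3 := by exact_mod_cast Real.rpow_natCast (q : ℝ) 3
          rw [this]
          norm_num
          ring
      _ = _ := by
          rw [Real.mul_rpow (by positivity) (by positivity), ← Real.rpow_mul hq0.le]
          norm_num
  have hL0 := divisorLog_nonneg q
  calc boxError q ≤ ((2 * C₁ ^ 3) ^ (1 / 4 : ℝ) * (q : ℝ) ^ (3 / 4 + 3 / 400 : ℝ)) *
        (((C₁ * C₂) * (q : ℝ) ^ (1 / 50 : ℝ)) * (3 * ((C₁ * C₂) * (q : ℝ) ^ (1 / 50 : ℝ)))) := by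
        unfold boxError
        gcongr
        linarith
    _ = (2 * C₁ ^ 3) ^ (1 / 4 : ℝ) * ((C₁ * C₂) * (3 * (C₁ * C₂))) *
        ((q : ℝ) ^ (3 / 4 + 3 / 400 : ℝ) * ((q : ℝ) ^ (1 / 50 : ℝ) * (q : ℝ) ^ (1 / 50 : ℝ))) := by
        ring
    _ ≤ _ := by
        gcongr
        rw [← Real.rpow_add hq0, ← Real.rpow_add hq0]
        exact Real.rpow_le_rpow_of_exponent_le hq1 (by norm_num)

lemma abs_sum_mul_le_of_antitoneOn {f a : ℕ → ℝ} {A B : ℕ} {E F : ℝ} (hE0 : 0 ≤ E) (hF0 : 0 ≤ F)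
    (hE : ∀ s t, A ≤ s → s ≤ t → t ≤ B → |∑ i ∈ Finset.Ico s t, a i| ≤ E)
    (hf : AntitoneOn f (Finset.Ico A B)) (h0 : ∀ i ∈ Finset.Ico A B, 0 ≤ f i)
    (hF : ∀ i ∈ Finset.Ico A B, f i ≤ F) :
    |∑ i ∈ Finset.Ico A B, f i * a i| ≤ F * E := by
  induction B generalizing f F with
  | zero => simpa using mul_nonneg hF0 hE0
  | succ B ih =>
    rcases lt_or_ge B A with hBA | hAB
    · rw [Finset.Ico_eq_empty_of_le (by omega)]
      simpa using mul_nonneg hF0 hE0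
    · have hB : B ∈ Finset.Ico A (B + 1) := Finset.mem_Ico.2 ⟨hAB, by omega⟩
      have hsub : Finset.Ico A B ⊆ Finset.Ico A (B + 1) := Finset.Ico_subset_Ico_right (by omega)
      have key : ∑ i ∈ Finset.Ico A (B + 1), f i * a i =
          f B * ∑ i ∈ Finset.Ico A (B + 1), a i + ∑ i ∈ Finset.Ico A B, (f i - f B) * a i := by
        rw [Finset.sum_Ico_succ_top hAB, Finset.sum_Ico_succ_top hAB, mul_add, Finset.mul_sum]
        simp_rw [sub_mul, Finset.sum_sub_distrib]
        ring
      rw [key]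
      have h1 := ih (f := fun i => f i - f B) (F := F - f B) (sub_nonneg.2 (hF B hB))
        (fun s t h1 h2 h3 => hE s t h1 h2 (by omega))
        (fun i hi j hj hij => sub_le_sub_right (hf (hsub hi) (hsub hj) hij) _)
        (fun i hi => sub_nonneg.2 (hf (hsub hi) hB
          (by have := (Finset.mem_Ico.1 hi).2; omega)))
        (fun i hi => sub_le_sub_right (hF i (hsub hi)) _)
      have h2 : |f B * ∑ i ∈ Finset.Ico A (B + 1), a i| ≤ f B * E := by
        rw [abs_mul, abs_of_nonneg (h0 B hB)]
        exact mul_le_mul_of_nonneg_left (hE _ _ le_rfl (by omega) le_rfl) (h0 B hB)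
      calc _ ≤ f B * E + (F - f B) * E := (abs_add_le _ _).trans (add_le_add h2 h1)
        _ = _ := by ring

lemma abs_sum_mul_le_of_monotoneOn {f a : ℕ → ℝ} {A B : ℕ} {E F : ℝ} (hE0 : 0 ≤ E) (hF0 : 0 ≤ F)
    (hE : ∀ s t, A ≤ s → s ≤ t → t ≤ B → |∑ i ∈ Finset.Ico s t, a i| ≤ E)
    (hf : MonotoneOn f (Finset.Ico A B)) (h0 : ∀ i ∈ Finset.Ico A B, 0 ≤ f i)
    (hF : ∀ i ∈ Finset.Ico A B, f i ≤ F) :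
    |∑ i ∈ Finset.Ico A B, f i * a i| ≤ F * E := by
  induction hn : B - A generalizing A f F with
  | zero =>
    rw [Finset.Ico_eq_empty_of_le (by omega)]
    simpa using mul_nonneg hF0 hE0
  | succ n ih =>
    have hAB : A < B := by omega
    have hA : A ∈ Finset.Ico A B := Finset.mem_Ico.2 ⟨le_rfl, hAB⟩
    have hsub : Finset.Ico (A + 1) B ⊆ Finset.Ico A B := Finset.Ico_subset_Ico_left (by omega)
    have key : ∑ i ∈ Finset.Ico A B, f i * a i =
        f A * ∑ i ∈ Finset.Ico A B, a i + ∑ i ∈ Finset.Ico (A + 1) B, (f i - f A) * a i := by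
      rw [Finset.sum_eq_sum_Ico_succ_bot hAB, Finset.sum_eq_sum_Ico_succ_bot hAB, mul_add,
        Finset.mul_sum]
      simp_rw [sub_mul, Finset.sum_sub_distrib]
      ring
    rw [key]
    have h1 := ih (f := fun i => f i - f A) (F := F - f A) (sub_nonneg.2 (hF A hA))
      (fun s t h1 h2 h3 => hE s t (by omega) h2 h3)
      (fun i hi j hj hij => sub_le_sub_right (hf (hsub hi) (hsub hj) hij) _)
      (fun i hi => sub_nonneg.2 (hf hA (hsub hi)
        (by have := (Finset.mem_Ico.1 hi).1; omega)))
      (fun i hi => sub_le_sub_right (hF i (hsub hi)) _) (by omega)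
    have h2 : |f A * ∑ i ∈ Finset.Ico A B, a i| ≤ f A * E := by
      rw [abs_mul, abs_of_nonneg (h0 A hA)]
      exact mul_le_mul_of_nonneg_left (hE _ _ le_rfl hAB.le le_rfl) (h0 A hA)
    calc _ ≤ f A * E + (F - f A) * E := (abs_add_le _ _).trans (add_le_add h2 h1)
      _ = _ := by ring

lemma boxError_nonneg (q : ℕ) : 0 ≤ boxError q := by
  have := divisorLog_nonneg q
  unfold boxError kloostermanConst
  positivity

/-- Equidistribution of the modular hyperbola, with monotone product weights. -/
lemma abs_weighted_count_sub_le {q : ℕ} [NeZero q] (c : (ZMod q)ˣ) {a b a' b' : ℕ}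
    (hab : b - a ≤ q) (hab' : b' - a' ≤ q) {f g : ℕ → ℝ} {F G : ℝ} (hF0 : 0 ≤ F) (hG0 : 0 ≤ G)
    (hf : MonotoneOn f (Finset.Ico a b)) (hf0 : ∀ i ∈ Finset.Ico a b, 0 ≤ f i)
    (hfF : ∀ i ∈ Finset.Ico a b, f i ≤ F)
    (hg : AntitoneOn g (Finset.Ico a' b')) (hg0 : ∀ i ∈ Finset.Ico a' b', 0 ≤ g i)
    (hgG : ∀ i ∈ Finset.Ico a' b', g i ≤ G) :
    |∑ x ∈ Finset.Ico a b, ∑ y ∈ Finset.Ico a' b',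
      f x * g y * ((if (x : ZMod q) * y = c then (1 : ℝ) else 0) - q.totient / (q : ℝ) ^ 2)| ≤
      F * (G * boxError q) := by
  have hE := boxError_nonneg q
  have key : ∀ s t, a ≤ s → s ≤ t → t ≤ b → |∑ x ∈ Finset.Ico s t, ∑ y ∈ Finset.Ico a' b',
      g y * ((if (x : ZMod q) * y = c then (1 : ℝ) else 0) - q.totient / (q : ℝ) ^ 2)| ≤
      G * boxError q := by
    intro s t hs hst ht
    rw [Finset.sum_comm]
    simp_rw [← Finset.mul_sum]
    refine abs_sum_mul_le_of_antitoneOn hE hG0 (fun s' t' hs' hst' ht' => ?_) hg hg0 hgG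
    rw [Finset.sum_comm]
    exact abs_count_sub_le c (by omega) (by omega)
  simp_rw [mul_assoc, ← Finset.mul_sum (Finset.Ico a' b')]
  exact abs_sum_mul_le_of_monotoneOn (by positivity) hF0 key hf hf0 hfF

lemma abs_sum_sub_integral_le_of_monotone {f : ℝ → ℝ} (hf : Monotone f) (h0 : ∀ x, 0 ≤ f x)
    (h1 : ∀ x, f x ≤ 1) {t : ℝ} (ht : 0 < t) :
    |∑ i ∈ Finset.range ⌈1 / t⌉₊, f (t * i) - 1 / t * ∫ x in (0 : ℝ)..1, f x| ≤ 1 := by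
  set n := ⌈1 / t⌉₊ with hn
  have hg : Monotone fun x : ℝ => f (t * x) := fun x y h =>
    hf (mul_le_mul_of_nonneg_left h ht.le)
  have hn1 : 1 ≤ t * n := by
    have := Nat.le_ceil (1 / t)
    rw [div_le_iff₀ ht] at this
    linarith
  have hn2 : t * n < 1 + t := by
    have := Nat.ceil_lt_add_one (a := 1 / t) (by positivity)
    have h2 := mul_lt_mul_of_pos_left this ht
    rw [mul_add, mul_one_div_cancel ht.ne', mul_one] at h2
    exact h2
  have h_int : ∀ a b : ℝ, IntervalIntegrable f volume a b := fun a b => hf.intervalIntegrable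
  have hsub : ∫ x in (0 : ℝ)..(0 + n : ℝ), f (t * x) = 1 / t * ∫ x in (0 : ℝ)..(t * n), f x := by
    rw [intervalIntegral.integral_comp_mul_left _ ht.ne']
    simp
  have hsplit : ∫ x in (0 : ℝ)..(t * n), f x =
      (∫ x in (0 : ℝ)..1, f x) + ∫ x in (1 : ℝ)..(t * n), f x :=
    (intervalIntegral.integral_add_adjacent_intervals (h_int _ _) (h_int _ _)).symm
  have hrest0 : 0 ≤ ∫ x in (1 : ℝ)..(t * n), f x :=
    intervalIntegral.integral_nonneg hn1 fun x _ => h0 x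
  have hrest1 : ∫ x in (1 : ℝ)..(t * n), f x ≤ t := by
    have := intervalIntegral.integral_mono_on (μ := volume) (g := fun _ => (1 : ℝ)) hn1
      (h_int _ _) (by simp) fun x _ => h1 x
    simp only [intervalIntegral.integral_const, smul_eq_mul, mul_one] at this
    linarith
  have hlow := (hg.monotoneOn (Icc 0 (0 + n : ℝ))).sum_le_integral
  have hupp := (hg.monotoneOn (Icc 0 (0 + n : ℝ))).integral_le_sum
  simp only [zero_add] at hlow hupp hsub
  rw [hsub, hsplit] at hlow hupp
  have htel : ∑ i ∈ Finset.range n, f (t * ((i + 1 : ℕ) : ℝ)) =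
      ∑ i ∈ Finset.range n, f (t * i) + (f (t * n) - f (t * (0 : ℕ))) := by
    rw [← Finset.sum_range_sub (fun i : ℕ => f (t * i)), ← Finset.sum_add_distrib]
    simp
  rw [htel] at hupp
  have ht1 : 1 / t * ∫ x in (1 : ℝ)..(t * n), f x ≤ 1 := by
    calc _ ≤ 1 / t * t := mul_le_mul_of_nonneg_left hrest1 (by positivity)
      _ = 1 := by field_simp
  have ht0 : 0 ≤ 1 / t * ∫ x in (1 : ℝ)..(t * n), f x := by positivity
  have := h1 (t * n)
  have := h0 (t * (0 : ℕ))
  rw [mul_add] at hlow hupp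
  generalize f (t * n) = y1 at *
  generalize f (t * (0 : ℕ)) = y2 at *
  generalize 1 / t * ∫ x in (0 : ℝ)..1, f x = y3 at *
  generalize 1 / t * ∫ x in (1 : ℝ)..(t * n), f x = y4 at *
  rw [abs_le]
  constructor <;> linarith

lemma abs_sum_ordConnected_sub_integral_le {J : Set ℝ} (hJ : J.OrdConnected)
    (hJ1 : J ⊆ Icc 0 1) {w : ℝ → ℝ} (hw : MonotoneOn w (Icc 0 1))
    (hw0 : ∀ x ∈ Icc (0 : ℝ) 1, 0 ≤ w x) (hw1 : ∀ x ∈ Icc (0 : ℝ) 1, w x ≤ 1)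
    {t : ℝ} (ht : 0 < t) :
    |∑ i ∈ Finset.range ⌈1 / t⌉₊, J.indicator w (t * i) - 1 / t * ∫ x in J, w x| ≤ 2 := by
  classical
  set w' : ℝ → ℝ := fun x => w (max 0 (min x 1)) with hw'
  have hp : ∀ x : ℝ, max 0 (min x 1) ∈ Icc (0 : ℝ) 1 := fun x =>
    ⟨le_max_left _ _, max_le zero_le_one (min_le_right _ _)⟩
  have hw'm : Monotone w' := fun x y h =>
    hw (hp x) (hp y) (max_le_max le_rfl (min_le_min h le_rfl))
  have hw'0 : ∀ x, 0 ≤ w' x := fun x => hw0 _ (hp x)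
  have hw'1 : ∀ x, w' x ≤ 1 := fun x => hw1 _ (hp x)
  have hww : ∀ x ∈ J, w' x = w x := fun x hx => by
    simp only [hw', min_eq_left (hJ1 hx).2, max_eq_right (hJ1 hx).1]
  set U : Set ℝ := {u | ∃ j ∈ J, j ≤ u}
  have hU : ∀ u v, u ≤ v → u ∈ U → v ∈ U := fun u v h ⟨j, hj, hju⟩ => ⟨j, hj, hju.trans h⟩
  have hV : ∀ u v, u ≤ v → u ∈ U \ J → v ∈ U \ J := by
    rintro u v h ⟨⟨j, hj, hju⟩, huJ⟩
    exact ⟨⟨j, hj, hju.trans h⟩, fun hv => huJ (hJ.out hj hv ⟨hju, h⟩)⟩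
  have key : ∀ V : Set ℝ, (∀ u v, u ≤ v → u ∈ V → v ∈ V) →
      Monotone (V.indicator w') ∧ (∀ x, 0 ≤ V.indicator w' x) ∧ ∀ x, V.indicator w' x ≤ 1 := by
    intro V hV
    refine ⟨fun u v h => ?_, fun x => indicator_nonneg (fun x _ => hw'0 x) x, fun x => ?_⟩
    · by_cases hu : u ∈ V
      · rw [indicator_of_mem hu, indicator_of_mem (hV u v h hu)]
        exact hw'm h
      · rw [indicator_of_notMem hu]
        exact indicator_nonneg (fun x _ => hw'0 x) v
    · by_cases hu : x ∈ V
      · rw [indicator_of_mem hu]; exact hw'1 x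
      · rw [indicator_of_notMem hu]; exact zero_le_one
  obtain ⟨a1, a2, a3⟩ := key U hU
  obtain ⟨b1, b2, b3⟩ := key (U \ J) hV
  have hind : ∀ x, J.indicator w x = U.indicator w' x - (U \ J).indicator w' x := by
    intro x
    by_cases hx : x ∈ J
    · have hxU : x ∈ U := ⟨x, hx, le_rfl⟩
      simp [hx, hxU, hww x hx]
    · by_cases hxU : x ∈ U <;> simp [hx, hxU]
  have h_int : ∫ x in J, w x = (∫ x in (0 : ℝ)..1, U.indicator w' x) -
      ∫ x in (0 : ℝ)..1, (U \ J).indicator w' x := by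
    rw [← intervalIntegral.integral_sub a1.intervalIntegrable b1.intervalIntegrable,
      intervalIntegral.integral_of_le zero_le_one, ← integral_Icc_eq_integral_Ioc]
    simp_rw [← hind]
    rw [setIntegral_indicator hJ.measurableSet, inter_eq_self_of_subset_right hJ1]
  have e1 := abs_sum_sub_integral_le_of_monotone a1 a2 a3 ht
  have e2 := abs_sum_sub_integral_le_of_monotone b1 b2 b3 ht
  simp_rw [hind, Finset.sum_sub_distrib]
  rw [h_int]
  rw [abs_le] at *
  constructor <;> linarith [e1.1, e1.2, e2.1, e2.2]

/-- The weight `1 / (1 + γ²)` in terms of `t = 1 - γ`. -/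
noncomputable def reflWeight (t : ℝ) : ℝ := 1 / (1 + (1 - t) ^ 2)

lemma reflWeight_nonneg (t : ℝ) : 0 ≤ reflWeight t := by unfold reflWeight; positivity

lemma reflWeight_le_one (t : ℝ) : reflWeight t ≤ 1 := by
  unfold reflWeight
  exact (div_le_one (by positivity)).2 (by nlinarith [sq_nonneg (1 - t)])

lemma monotoneOn_reflWeight : MonotoneOn reflWeight (Iic 1) := by
  intro x hx y hy hxy
  simp only [mem_Iic] at hx hy
  unfold reflWeight
  apply one_div_le_one_div_of_le (by positivity)
  nlinarith

lemma abs_reflWeight_sub_le (x y : ℝ) : |reflWeight x - reflWeight y| ≤ |x - y| := by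
  unfold reflWeight
  set a := 1 - x with ha
  set b := 1 - y with hb
  have h : 1 / (1 + a ^ 2) - 1 / (1 + b ^ 2) =
      (x - y) * ((a + b) / ((1 + a ^ 2) * (1 + b ^ 2))) := by
    have : x - y = b - a := by rw [ha, hb]; ring
    rw [this]; field_simp; ring
  rw [h, abs_mul]
  refine mul_le_of_le_one_right (abs_nonneg _) ?_
  rw [abs_div, abs_of_pos (by positivity : (0 : ℝ) < (1 + a ^ 2) * (1 + b ^ 2)),
    div_le_one (by positivity), abs_le]
  constructor <;> nlinarith [sq_nonneg (a - 1), sq_nonneg (b - 1), sq_nonneg (a + 1),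
    sq_nonneg (b + 1), sq_nonneg (a * b)]

/-- The preimage of an order-connected set of reals under `x ↦ t x`, cut off at `n`, is a
discrete interval. -/
lemma exists_filter_eq_Ico (J : Set ℝ) (hJ : J.OrdConnected) {t : ℝ} (ht : 0 < t) (n : ℕ) :
    ∃ A B : ℕ, A ≤ B ∧ B ≤ n ∧ ∀ x : ℕ, (x ∈ Finset.Ico A B ↔ x < n ∧ t * x ∈ J) := by
  classical
  by_cases h : ∃ x : ℕ, x < n ∧ t * (x : ℝ) ∈ J
  · set S := (Finset.range n).filter fun x : ℕ => t * (x : ℝ) ∈ J with hS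
    have hmem : ∀ x, x ∈ S ↔ x < n ∧ t * (x : ℝ) ∈ J := by simp [hS]
    have hne : S.Nonempty := by
      obtain ⟨x, hx⟩ := h
      exact ⟨x, (hmem x).2 hx⟩
    have h1 := (hmem _).1 (S.min'_mem hne)
    have h2 := (hmem _).1 (S.max'_mem hne)
    refine ⟨S.min' hne, S.max' hne + 1, ?_, by omega, fun x => ?_⟩
    · have := S.min'_le _ (S.max'_mem hne)
      omega
    · rw [Finset.mem_Ico, ← hmem]
      constructor
      · rintro ⟨h3, h4⟩
        refine (hmem x).2 ⟨by omega, hJ.out h1.2 h2.2 ⟨?_, ?_⟩⟩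
        · exact mul_le_mul_of_nonneg_left (by exact_mod_cast h3) ht.le
        · exact mul_le_mul_of_nonneg_left (by exact_mod_cast Nat.lt_succ_iff.1 h4) ht.le
      · intro hx
        exact ⟨S.min'_le _ hx, Nat.lt_succ_iff.2 (S.le_max' _ hx)⟩
  · refine ⟨0, 0, le_rfl, Nat.zero_le _, fun x => ?_⟩
    simpa using fun h1 h2 => h ⟨x, h1, h2⟩

lemma ordConnected_abs_sum_le_one {q : ℕ} [NeZero q] (c : (ZMod q)ˣ) {J : Set ℝ}
    (hJ : J.OrdConnected) (hJ1 : J ⊆ Icc 0 1) {t : ℝ} (ht : 0 < t) (htq : ⌈1 / t⌉₊ ≤ q)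
    {a' b' : ℕ} (hab' : b' - a' ≤ q) {v : ℕ → ℝ} {G : ℝ} (hG0 : 0 ≤ G)
    (hv : AntitoneOn v (Finset.Ico a' b')) (hv0 : ∀ i ∈ Finset.Ico a' b', 0 ≤ v i)
    (hvG : ∀ i ∈ Finset.Ico a' b', v i ≤ G) :
    |∑ x ∈ Finset.range ⌈1 / t⌉₊, ∑ y ∈ Finset.Ico a' b', J.indicator reflWeight (t * x) * v y *
        (if (x : ZMod q) * y = c then (1 : ℝ) else 0) -
      q.totient / (q : ℝ) ^ 2 * (1 / t * ∫ u in J, reflWeight u) * ∑ y ∈ Finset.Ico a' b', v y| ≤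
      G * (boxError q + 2) := by
  have hq : 0 < q := NeZero.pos q
  have hq' : (0 : ℝ) < q := by exact_mod_cast hq
  obtain ⟨A, B, hAB, hBn, hmem⟩ := exists_filter_eq_Ico J hJ ht ⌈1 / t⌉₊
  have hsubset : Finset.Ico A B ⊆ Finset.range ⌈1 / t⌉₊ := fun x hx =>
    Finset.mem_range.2 ((hmem x).1 hx).1
  have hJx : ∀ x ∈ Finset.Ico A B, t * (x : ℝ) ∈ J := fun x hx => ((hmem x).1 hx).2
  have hzero : ∀ x ∈ Finset.range ⌈1 / t⌉₊, x ∉ Finset.Ico A B →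
      J.indicator reflWeight (t * (x : ℝ)) = 0 := by
    intro x hx hx'
    exact indicator_of_notMem (fun h => hx' ((hmem x).2 ⟨Finset.mem_range.1 hx, h⟩)) _
  have e1 : ∑ x ∈ Finset.range ⌈1 / t⌉₊, ∑ y ∈ Finset.Ico a' b',
      J.indicator reflWeight (t * x) * v y * (if (x : ZMod q) * y = c then (1 : ℝ) else 0) =
      ∑ x ∈ Finset.Ico A B, ∑ y ∈ Finset.Ico a' b',
      reflWeight (t * x) * v y * (if (x : ZMod q) * y = c then (1 : ℝ) else 0) := by
    rw [← Finset.sum_subset hsubset fun x hx hx' => by simp [hzero x hx hx']]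
    refine Finset.sum_congr rfl fun x hx => Finset.sum_congr rfl fun y _ => ?_
    rw [indicator_of_mem (hJx x hx)]
  have e2 : ∑ x ∈ Finset.range ⌈1 / t⌉₊, J.indicator reflWeight (t * x) =
      ∑ x ∈ Finset.Ico A B, reflWeight (t * x) := by
    rw [← Finset.sum_subset hsubset fun x hx hx' => hzero x hx hx']
    exact Finset.sum_congr rfl fun x hx => indicator_of_mem (hJx x hx) _
  have h1 := abs_weighted_count_sub_le c (a := A) (b := B) (a' := a') (b' := b') (by omega) hab'
    (f := fun x : ℕ => reflWeight (t * x)) (g := v) (F := 1) zero_le_one hG0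
    (fun x hx y hy hxy => monotoneOn_reflWeight (hJ1 (hJx x (by simpa using hx))).2
      (hJ1 (hJx y (by simpa using hy))).2
      (mul_le_mul_of_nonneg_left (by exact_mod_cast hxy) ht.le))
    (fun _ _ => reflWeight_nonneg _) (fun _ _ => reflWeight_le_one _) hv hv0 hvG
  have h2 := abs_sum_ordConnected_sub_integral_le hJ hJ1
    (monotoneOn_reflWeight.mono fun x hx => hx.2) (fun x _ => reflWeight_nonneg x)
    (fun x _ => reflWeight_le_one x) ht
  rw [e1]
  rw [e2] at h2
  set V := ∑ y ∈ Finset.Ico a' b', v y with hV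
  have hV0 : 0 ≤ V := Finset.sum_nonneg hv0
  have hVG : V ≤ q * G := by
    calc V ≤ (Finset.Ico a' b').card • G := Finset.sum_le_card_nsmul _ _ _ hvG
      _ = ((b' - a' : ℕ) : ℝ) * G := by rw [Nat.card_Ico, nsmul_eq_mul]
      _ ≤ q * G := by
        have : ((b' - a' : ℕ) : ℝ) ≤ q := by exact_mod_cast hab'
        exact mul_le_mul_of_nonneg_right this hG0
  set W := ∑ x ∈ Finset.Ico A B, reflWeight (t * x) with hW
  set τ : ℝ := q.totient / (q : ℝ) ^ 2 with hτ
  have hτ0 : 0 ≤ τ := by positivity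
  have hτ1 : τ ≤ 1 / q := by
    rw [hτ, div_le_div_iff₀ (by positivity) hq']
    have : (q.totient : ℝ) ≤ q := by exact_mod_cast Nat.totient_le q
    nlinarith
  have e3 : ∑ x ∈ Finset.Ico A B, ∑ y ∈ Finset.Ico a' b', reflWeight (t * x) * v y *
      ((if (x : ZMod q) * y = c then (1 : ℝ) else 0) - τ) =
      (∑ x ∈ Finset.Ico A B, ∑ y ∈ Finset.Ico a' b', reflWeight (t * x) * v y *
      (if (x : ZMod q) * y = c then (1 : ℝ) else 0)) - τ * W * V := by
    simp_rw [mul_sub, Finset.sum_sub_distrib]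
    congr 1
    rw [mul_assoc, Finset.sum_mul_sum, Finset.mul_sum]
    refine Finset.sum_congr rfl fun x _ => ?_
    rw [Finset.mul_sum]
    exact Finset.sum_congr rfl fun y _ => by ring
  rw [e3] at h1
  set X := ∑ x ∈ Finset.Ico A B, ∑ y ∈ Finset.Ico a' b', reflWeight (t * x) * v y *
      (if (x : ZMod q) * y = c then (1 : ℝ) else 0)
  set c0 := 1 / t * ∫ u in J, reflWeight u
  have h3 : |τ * V * (W - c0)| ≤ 2 * G := by
    rw [abs_mul, abs_of_nonneg (mul_nonneg hτ0 hV0)]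
    calc τ * V * |W - c0| ≤ (1 / q * (q * G)) * 2 := by gcongr
      _ = 2 * G := by field_simp
  calc |X - τ * c0 * V| = |(X - τ * W * V) + τ * V * (W - c0)| := by congr 1; ring
    _ ≤ 1 * (G * boxError q) + 2 * G := (abs_add_le _ _).trans (add_le_add h1 h3)
    _ = _ := by ring

/-- Pairs `(b, n)` encoding the neighbours of `1 - b / m` with denominator `n`, both fractions
lying outside the congruence class modulo `l`. -/
def neighbourPairs (l m a' b' : ℕ) (s : ℤˣ) : Finset (ℕ × ℕ) :=
  (Finset.range m ×ˢ Finset.Ico a' b').filter fun p =>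
    (m : ℤ) ∣ p.1 * p.2 - s ∧ ¬ (l : ℤ) ∣ p.1 ∧ ¬ ((l * m : ℕ) : ℤ) ∣ p.1 * p.2 - s

/-- `m` times the local density of admissible pairs. -/
noncomputable def localDensity (l m : ℕ) : ℝ :=
  (m.totient : ℝ) / m - (if l.Coprime m then (m.totient : ℝ) / (l * m) else 0) -
    ((l * m).totient : ℝ) / (l ^ 2 * m)

lemma intCast_dvd_iff_zmod (q x y : ℕ) (s : ℤˣ) :
    ((q : ℤ) ∣ (x : ℤ) * y - s) ↔
      (x : ZMod q) * y = ((Units.map (Int.castRingHom (ZMod q)).toMonoidHom s : (ZMod q)ˣ) : ZMod q) := by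
  rw [← ZMod.intCast_zmod_eq_zero_iff_dvd]
  push_cast
  rw [sub_eq_zero]
  simp

lemma not_dvd_unit {l : ℕ} (hl : 2 ≤ l) (s : ℤˣ) : ¬ (l : ℤ) ∣ s := by
  intro h
  have := Int.natAbs_dvd_natAbs.2 h
  rw [Int.units_natAbs, Int.natAbs_natCast, Nat.dvd_one] at this
  omega

lemma sum_neighbourPairs (l m a' b' : ℕ) (hl : 2 ≤ l) (s : ℤˣ) (F : ℕ → ℕ → ℝ) :
    ∑ p ∈ neighbourPairs l m a' b' s, F p.1 p.2 =
      ∑ x ∈ Finset.range m, ∑ y ∈ Finset.Ico a' b', F x y *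
        (if (m : ℤ) ∣ (x : ℤ) * y - s then (1 : ℝ) else 0) -
      ∑ x ∈ Finset.range m, ∑ y ∈ Finset.Ico a' b', F x y *
        (if (l : ℤ) ∣ x ∧ (m : ℤ) ∣ (x : ℤ) * y - s then (1 : ℝ) else 0) -
      ∑ x ∈ Finset.range m, ∑ y ∈ Finset.Ico a' b', F x y *
        (if ((l * m : ℕ) : ℤ) ∣ (x : ℤ) * y - s then (1 : ℝ) else 0) := by
  rw [neighbourPairs, Finset.sum_filter, Finset.sum_product, ← Finset.sum_sub_distrib,
    ← Finset.sum_sub_distrib]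
  refine Finset.sum_congr rfl fun x _ => ?_
  rw [← Finset.sum_sub_distrib, ← Finset.sum_sub_distrib]
  refine Finset.sum_congr rfl fun y _ => ?_
  have h1 : ((l * m : ℕ) : ℤ) ∣ (x : ℤ) * y - s → (m : ℤ) ∣ (x : ℤ) * y - s := fun h =>
    (Int.natCast_dvd_natCast.2 (Dvd.intro_left l rfl)).trans h
  have h2 : (l : ℤ) ∣ x → ¬ ((l * m : ℕ) : ℤ) ∣ (x : ℤ) * y - s := fun h h' => by
    have h3 : (l : ℤ) ∣ (x : ℤ) * y - s :=
      (Int.natCast_dvd_natCast.2 (Dvd.intro m rfl)).trans h'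
    exact not_dvd_unit hl s ((Int.dvd_iff_dvd_of_dvd_sub h3).1 (h.mul_right y))
  by_cases p1 : (m : ℤ) ∣ (x : ℤ) * y - s <;> by_cases p2 : (l : ℤ) ∣ x <;>
    by_cases p3 : ((l * m : ℕ) : ℤ) ∣ (x : ℤ) * y - s <;> simp_all

lemma sum_range_dvd (l m : ℕ) (hl : 0 < l) (hm : 0 < m) (F : ℕ → ℝ) :
    ∑ x ∈ Finset.range m, (if (l : ℤ) ∣ x then F x else 0) =
      ∑ x ∈ Finset.range ⌈1 / ((l : ℝ) / m)⌉₊, F (l * x) := by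
  have hm' : (0 : ℝ) < m := by exact_mod_cast hm
  have hl' : (0 : ℝ) < l := by exact_mod_cast hl
  rw [← Finset.sum_filter]
  symm
  refine Finset.sum_bij (fun x _ => l * x) (fun x hx => ?_) (fun x _ y _ h => ?_)
    (fun y hy => ?_) (fun _ _ => rfl)
  · rw [Finset.mem_range, Nat.lt_ceil, one_div_div, lt_div_iff₀ hl'] at hx
    rw [Finset.mem_filter, Finset.mem_range]
    refine ⟨?_, by push_cast; exact Dvd.intro _ rfl⟩
    have : ((l * x : ℕ) : ℝ) < m := by push_cast; linarith
    exact_mod_cast this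
  · exact Nat.eq_of_mul_eq_mul_left hl h
  · rw [Finset.mem_filter, Finset.mem_range] at hy
    obtain ⟨k, hk⟩ := Int.natCast_dvd_natCast.1 hy.2
    refine ⟨k, ?_, hk.symm⟩
    rw [Finset.mem_range, Nat.lt_ceil, one_div_div, lt_div_iff₀ hl']
    have : ((l * k : ℕ) : ℝ) < m := by rw [← hk]; exact_mod_cast hy.1
    push_cast at this; linarith

lemma abs_sum_neighbourPairs_sub_le (l m : ℕ) (hl : 2 ≤ l) (hm : 1 ≤ m) (s : ℤˣ) {J : Set ℝ}
    (hJ : J.OrdConnected) (hJ1 : J ⊆ Icc 0 1)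
    {a' b' : ℕ} (hab' : b' - a' ≤ m) {v : ℕ → ℝ} {G : ℝ} (hG0 : 0 ≤ G)
    (hv : AntitoneOn v (Finset.Ico a' b')) (hv0 : ∀ i ∈ Finset.Ico a' b', 0 ≤ v i)
    (hvG : ∀ i ∈ Finset.Ico a' b', v i ≤ G) :
    |∑ p ∈ neighbourPairs l m a' b' s, J.indicator reflWeight (1 / m * p.1) * v p.2 -
      (∫ u in J, reflWeight u) * localDensity l m * ∑ y ∈ Finset.Ico a' b', v y| ≤
      G * (2 * boxError m + boxError (l * m) + 6) := by
  have hm' : (0 : ℝ) < m := by exact_mod_cast hm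
  have hl' : (0 : ℝ) < l := by exact_mod_cast (by omega : 0 < l)
  have : NeZero m := ⟨by omega⟩
  have : NeZero (l * m) := ⟨by positivity⟩
  have hceil : ⌈1 / (1 / (m : ℝ))⌉₊ = m := by rw [one_div_one_div, Nat.ceil_natCast]
  have hlm : m ≤ l * m := Nat.le_mul_of_pos_left m (by omega)
  rw [sum_neighbourPairs l m a' b' hl s fun x y => J.indicator reflWeight (1 / m * x) * v y]
  have T1 := ordConnected_abs_sum_le_one
    (Units.map (Int.castRingHom (ZMod m)).toMonoidHom s) hJ hJ1
    (t := 1 / m) (by positivity) hceil.le hab' hG0 hv hv0 hvG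
  have T3 := ordConnected_abs_sum_le_one
    (Units.map (Int.castRingHom (ZMod (l * m))).toMonoidHom s) hJ hJ1
    (t := 1 / m) (by positivity) (hceil.le.trans hlm) (hab'.trans hlm) hG0 hv hv0 hvG
  simp_rw [← intCast_dvd_iff_zmod, hceil] at T1 T3
  set V := ∑ y ∈ Finset.Ico a' b', v y
  set cJ := ∫ u in J, reflWeight u
  have T2 : |∑ x ∈ Finset.range m, ∑ y ∈ Finset.Ico a' b',
      J.indicator reflWeight (1 / m * x) * v y *
        (if (l : ℤ) ∣ x ∧ (m : ℤ) ∣ (x : ℤ) * y - s then (1 : ℝ) else 0) -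
      cJ * (if l.Coprime m then (m.totient : ℝ) / (l * m) else 0) * V| ≤
      G * (boxError m + 2) := by
    have e1 : ∑ x ∈ Finset.range m, ∑ y ∈ Finset.Ico a' b',
        J.indicator reflWeight (1 / m * x) * v y *
        (if (l : ℤ) ∣ x ∧ (m : ℤ) ∣ (x : ℤ) * y - s then (1 : ℝ) else 0) =
        ∑ x ∈ Finset.range ⌈1 / ((l : ℝ) / m)⌉₊, ∑ y ∈ Finset.Ico a' b',
        J.indicator reflWeight ((l : ℝ) / m * x) * v y *
        (if (m : ℤ) ∣ (l : ℤ) * x * y - s then (1 : ℝ) else 0) := by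
      refine Eq.trans ?_ ((sum_range_dvd l m (by omega) hm fun x => ∑ y ∈ Finset.Ico a' b',
        J.indicator reflWeight (1 / m * x) * v y *
        (if (m : ℤ) ∣ (x : ℤ) * y - s then (1 : ℝ) else 0)).trans ?_)
      · refine Finset.sum_congr rfl fun x _ => ?_
        by_cases h : (l : ℤ) ∣ x <;> simp [h]
      · refine Finset.sum_congr rfl fun x _ => Finset.sum_congr rfl fun y _ => ?_
        push_cast
        congr 3
        ring
    rw [e1]
    by_cases hco : l.Coprime m
    · rw [if_pos hco]
      have hceil2 : ⌈1 / ((l : ℝ) / m)⌉₊ ≤ m := by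
        rw [Nat.ceil_le, one_div_div, div_le_iff₀ hl']
        have : (1 : ℝ) ≤ l := by exact_mod_cast (by omega : 1 ≤ l)
        nlinarith
      have T := ordConnected_abs_sum_le_one
        (Units.map (Int.castRingHom (ZMod m)).toMonoidHom s * (ZMod.unitOfCoprime l hco)⁻¹) hJ hJ1
        (t := l / m) (by positivity) hceil2 hab' hG0 hv hv0 hvG
      have hcond : ∀ x y : ℕ, ((x : ZMod m) * y =
          ((Units.map (Int.castRingHom (ZMod m)).toMonoidHom s *
            (ZMod.unitOfCoprime l hco)⁻¹ : (ZMod m)ˣ) : ZMod m)) ↔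
          (m : ℤ) ∣ (l : ℤ) * x * y - s := by
        intro x y
        have := intCast_dvd_iff_zmod m (l * x) y s
        push_cast at this
        rw [this, Units.val_mul, Units.eq_mul_inv_iff_mul_eq, ZMod.coe_unitOfCoprime]
        rw [show (x : ZMod m) * y * l = l * x * y by ring]
      simp_rw [hcond] at T
      convert T using 3
      field_simp
      rfl
    · rw [if_neg hco]
      have hz : ∀ x y : ℕ, ¬ (m : ℤ) ∣ (l : ℤ) * x * y - s := by
        intro x y h
        apply hco
        rw [Nat.coprime_iff_gcd_eq_one]
        by_contra hg
        have hg0 : 0 < l.gcd m := Nat.gcd_pos_of_pos_right l hm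
        refine not_dvd_unit (l := l.gcd m) (by omega) s ?_
        have h1 : ((l.gcd m : ℕ) : ℤ) ∣ (l : ℤ) * x * y - s :=
          (Int.natCast_dvd_natCast.2 (Nat.gcd_dvd_right l m)).trans h
        have h2 : ((l.gcd m : ℕ) : ℤ) ∣ (l : ℤ) * x * y :=
          ((Int.natCast_dvd_natCast.2 (Nat.gcd_dvd_left l m)).mul_right _).mul_right _
        exact (Int.dvd_iff_dvd_of_dvd_sub h1).1 h2
      simp_rw [if_neg (hz _ _)]
      have := boxError_nonneg m
      simp only [mul_zero, Finset.sum_const_zero, zero_mul, sub_zero, abs_zero]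
      positivity
  rw [one_div_one_div] at T1 T3
  have hdens : cJ * localDensity l m * V =
      (m.totient : ℝ) / (m : ℝ) ^ 2 * (m * cJ) * V -
      cJ * (if l.Coprime m then (m.totient : ℝ) / (l * m) else 0) * V -
      ((l * m).totient : ℝ) / ((l * m : ℕ) : ℝ) ^ 2 * (m * cJ) * V := by
    unfold localDensity
    have e1 : (m.totient : ℝ) / (m : ℝ) ^ 2 * (m * cJ) = cJ * (m.totient / m) := by field_simp
    have e3 : ((l * m).totient : ℝ) / ((l * m : ℕ) : ℝ) ^ 2 * (m * cJ) =
        cJ * ((l * m).totient / (l ^ 2 * m)) := by push_cast; field_simp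
    rw [e1, e3]; ring
  rw [hdens]
  rw [abs_le] at *
  constructor <;> linarith [T1.1, T1.2, T2.1, T2.2, T3.1, T3.2]

lemma mem_neighbourPairs {l m a' b' : ℕ} {s : ℤˣ} {p : ℕ × ℕ} :
    p ∈ neighbourPairs l m a' b' s ↔ (p.1 < m ∧ a' ≤ p.2 ∧ p.2 < b') ∧
      (m : ℤ) ∣ p.1 * p.2 - s ∧ ¬ (l : ℤ) ∣ p.1 ∧ ¬ ((l * m : ℕ) : ℤ) ∣ p.1 * p.2 - s := by
  simp [neighbourPairs, and_assoc]

lemma neighbourPairs_injOn {l m a' b' : ℕ} (hab' : b' - a' ≤ m) {s : ℤˣ} {p p' : ℕ × ℕ}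
    (hp : p ∈ neighbourPairs l m a' b' s) (hp' : p' ∈ neighbourPairs l m a' b' s)
    (h : p.1 = p'.1) : p = p' := by
  obtain ⟨⟨_, h1, h2⟩, h3, _⟩ := mem_neighbourPairs.1 hp
  obtain ⟨⟨_, h1', h2'⟩, h3', _⟩ := mem_neighbourPairs.1 hp'
  refine Prod.ext h ?_
  rw [← h] at h3'
  have h4 : (m : ℤ) ∣ (p.2 - p'.2) * p.1 := by
    have := dvd_sub h3 h3'
    rwa [show (p.1 : ℤ) * p.2 - s - (p.1 * p'.2 - s) = (p.2 - p'.2) * p.1 by ring] at this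
  have hcop : IsCoprime (m : ℤ) p.1 := by
    obtain ⟨k, hk⟩ := h3
    refine ⟨-(s : ℤ) * k, s * p.2, ?_⟩
    have hs : (s : ℤ) * s = 1 := Int.units_coe_mul_self s
    linear_combination hs + s * hk
  have h5 := hcop.dvd_of_dvd_mul_right h4
  by_contra hne
  have hne' : (p.2 : ℤ) - p'.2 ≠ 0 := by omega
  have := Int.le_of_dvd (abs_pos.2 hne') ((dvd_abs _ _).2 h5)
  rw [le_abs] at this
  omega

lemma card_neighbourPairs_le {l m a' b' : ℕ} (hab' : b' - a' ≤ m) (s : ℤˣ) :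
    (neighbourPairs l m a' b' s).card ≤ m := by
  refine le_of_le_of_eq ?_ (Finset.card_range m)
  refine Finset.card_le_card_of_injOn Prod.fst (fun p hp => ?_) fun p hp p' hp' h =>
    neighbourPairs_injOn hab' hp hp' h
  simpa using (mem_neighbourPairs.1 hp).1.1

/-- The coordinate `1 - γ` of the fraction `γ` with the larger denominator. -/
noncomputable def neighbourCoord (m : ℕ) (s : ℤˣ) (p : ℕ × ℕ) : ℝ :=
  1 / m * p.1 - (s : ℤ) / (m * p.2)

open Classical in
/-- The exact weighted sum over neighbouring fractions of `1 - b / m` lying in `1 - J`. -/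
noncomputable def neighbourSum (l m a' b' : ℕ) (s : ℤˣ) (J : Set ℝ) (ε : ℝ) : ℝ :=
  ∑ p ∈ neighbourPairs l m a' b' s,
    if (1 / m * p.1 : ℝ) ∈ J ∧ neighbourCoord m s p ∈ J then
      (1 / p.2 - ε) * reflWeight (neighbourCoord m s p) else 0

lemma abs_neighbourSum_sub_le (l m Q a' b' : ℕ) (hm : 1 ≤ m) (s : ℤˣ) {J : Set ℝ}
    (hJ : J.OrdConnected) (hab' : b' - a' ≤ m) (ha' : 1 ≤ a') (hb' : b' ≤ Q + 1) {ε G : ℝ}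
    (hε1 : ε ≤ 1 / Q) (hε2 : 1 / Q - 1 / (Q : ℝ) ^ 2 ≤ ε) (hG : 1 / (a' : ℝ) ≤ G) :
    |neighbourSum l m a' b' s J ε -
      ∑ p ∈ neighbourPairs l m a' b' s, J.indicator reflWeight (1 / m * p.1) *
        (1 / p.2 - 1 / Q)| ≤ m / (Q : ℝ) ^ 2 + G ^ 2 + G := by
  classical
  have hm' : (0 : ℝ) < m := by exact_mod_cast hm
  have ha'' : (0 : ℝ) < a' := by exact_mod_cast ha'
  have hG0 : 0 ≤ G := le_trans (by positivity) hG
  set bad := (neighbourPairs l m a' b' s).filter fun p =>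
    (1 / m * p.1 : ℝ) ∈ J ∧ neighbourCoord m s p ∉ J with hbad
  have hbad1 : bad.card ≤ 1 := by
    have key : ∀ p ∈ bad, ∀ p' ∈ bad, ¬ p.1 < p'.1 := by
      intro p hp p' hp' hlt
      rw [hbad, Finset.mem_filter] at hp hp'
      obtain ⟨⟨_, h1, -⟩, -⟩ := mem_neighbourPairs.1 hp.1
      obtain ⟨⟨_, h1', -⟩, -⟩ := mem_neighbourPairs.1 hp'.1
      have hn : (1 : ℝ) ≤ p.2 := by exact_mod_cast (by omega : 1 ≤ p.2)
      have hn' : (1 : ℝ) ≤ p'.2 := by exact_mod_cast (by omega : 1 ≤ p'.2)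
      have hlt' : (p.1 : ℝ) + 1 ≤ p'.1 := by exact_mod_cast hlt
      have h3 : ∀ n : ℝ, 1 ≤ n → 0 ≤ 1 / (m * n) ∧ 1 / (m * n) ≤ 1 / m := by
        intro n hn
        refine ⟨by positivity, one_div_le_one_div_of_le hm' ?_⟩
        nlinarith
      have h4 : 1 / (m : ℝ) * p.1 + 1 / m ≤ 1 / m * p'.1 := by
        have := mul_le_mul_of_nonneg_left hlt' (by positivity : 0 ≤ 1 / (m : ℝ))
        linarith
      obtain ⟨h5, h6⟩ := h3 _ hn
      obtain ⟨h5', h6'⟩ := h3 _ hn'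
      rcases Int.units_eq_one_or s with rfl | rfl
      · refine hp'.2.2 (hJ.out hp.2.1 hp'.2.1 ?_)
        unfold neighbourCoord
        push_cast
        constructor <;> linarith
      · refine hp.2.2 (hJ.out hp.2.1 hp'.2.1 ?_)
        unfold neighbourCoord
        push_cast
        rw [neg_div]
        constructor <;> linarith
    refine Finset.card_le_one.2 fun p hp p' hp' => ?_
    refine neighbourPairs_injOn hab' (Finset.mem_filter.1 hp).1 (Finset.mem_filter.1 hp').1 ?_
    have := key p hp p' hp'
    have := key p' hp' p hp
    omega
  set T : ℝ := 1 / (Q : ℝ) ^ 2 + G ^ 2 / m with hT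
  have hterm : ∀ p ∈ neighbourPairs l m a' b' s,
      |(if (1 / m * p.1 : ℝ) ∈ J ∧ neighbourCoord m s p ∈ J then
        (1 / p.2 - ε) * reflWeight (neighbourCoord m s p) else 0) -
        J.indicator reflWeight (1 / m * p.1) * (1 / p.2 - 1 / Q)| ≤
      T + if (1 / m * p.1 : ℝ) ∈ J ∧ neighbourCoord m s p ∉ J then G else 0 := by
    intro p hp
    obtain ⟨⟨_, h1, h2⟩, -⟩ := mem_neighbourPairs.1 hp
    have hn : (0 : ℝ) < p.2 := by exact_mod_cast (by omega : 0 < p.2)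
    have hnQ : 1 / (Q : ℝ) ≤ 1 / p.2 :=
      one_div_le_one_div_of_le hn (by exact_mod_cast (by omega : p.2 ≤ Q))
    have hnG : 1 / (p.2 : ℝ) ≤ G :=
      (one_div_le_one_div_of_le ha'' (by exact_mod_cast h1)).trans hG
    have hQ0 : 0 ≤ 1 / (Q : ℝ) := by positivity
    have hT0 : 0 ≤ T := by positivity
    set x : ℝ := 1 / m * p.1 with hx
    set y := neighbourCoord m s p with hy
    by_cases hxJ : x ∈ J
    · by_cases hyJ : y ∈ J
      · rw [if_pos ⟨hxJ, hyJ⟩, if_neg (by tauto), indicator_of_mem hxJ, add_zero]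
        have e1 : |reflWeight y - reflWeight x| ≤ G / m := by
          refine (abs_reflWeight_sub_le y x).trans ?_
          rw [hy, neighbourCoord, ← hx, sub_sub_cancel_left, abs_neg, abs_div,
            abs_of_pos (by positivity : (0 : ℝ) < m * p.2)]
          have : |((s : ℤ) : ℝ)| = 1 := by
            rcases Int.units_eq_one_or s with rfl | rfl <;> simp
          rw [this, ← div_div, div_right_comm]
          gcongr
        have e2 : (1 / (p.2 : ℝ) - ε) * reflWeight y - reflWeight x * (1 / p.2 - 1 / Q) =
            (1 / Q - ε) * reflWeight y + (1 / p.2 - 1 / Q) * (reflWeight y - reflWeight x) := by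
          ring
        rw [e2]
        refine (abs_add_le _ _).trans ?_
        rw [abs_mul, abs_mul, abs_of_nonneg (by linarith : 0 ≤ 1 / (Q : ℝ) - ε),
          abs_of_nonneg (reflWeight_nonneg y), abs_of_nonneg (by linarith : 0 ≤ 1 / (p.2 : ℝ) - 1 / Q)]
        have e3 : (1 / (Q : ℝ) - ε) * reflWeight y ≤ 1 / (Q : ℝ) ^ 2 * 1 :=
          mul_le_mul (by linarith) (reflWeight_le_one y) (reflWeight_nonneg y) (by positivity)
        have e4 : (1 / (p.2 : ℝ) - 1 / Q) * |reflWeight y - reflWeight x| ≤ G * (G / m) :=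
          mul_le_mul (by linarith) e1 (abs_nonneg _) hG0
        have e5 : G * (G / m) = G ^ 2 / m := by ring
        rw [hT]; linarith
      · rw [if_neg (by tauto), if_pos ⟨hxJ, hyJ⟩, indicator_of_mem hxJ, zero_sub, abs_neg, abs_mul,
          abs_of_nonneg (reflWeight_nonneg x),
          abs_of_nonneg (by linarith : 0 ≤ 1 / (p.2 : ℝ) - 1 / Q)]
        have := mul_le_mul (reflWeight_le_one x) (by linarith : 1 / (p.2 : ℝ) - 1 / Q ≤ G)
          (by linarith) zero_le_one
        linarith
    · rw [if_neg (by tauto), if_neg (by tauto), indicator_of_notMem hxJ]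
      simpa using hT0
  unfold neighbourSum
  rw [← Finset.sum_sub_distrib]
  refine (Finset.abs_sum_le_sum_abs _ _).trans ((Finset.sum_le_sum hterm).trans ?_)
  rw [Finset.sum_add_distrib, ← Finset.sum_filter, ← hbad, Finset.sum_const, Finset.sum_const,
    nsmul_eq_mul, nsmul_eq_mul]
  have c1 : ((neighbourPairs l m a' b' s).card : ℝ) ≤ m := by
    exact_mod_cast card_neighbourPairs_le hab' s
  have c2 : (bad.card : ℝ) ≤ 1 := by exact_mod_cast hbad1
  calc _ ≤ (m : ℝ) * T + 1 * G := by
        have hT0 : 0 ≤ T := by positivity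
        gcongr
    _ = _ := by rw [hT]; field_simp

lemma sum_inv_mul_rpow_le (N : ℕ) :
    ∑ m ∈ Finset.Icc 1 N, 1 / (m : ℝ) * (m : ℝ) ^ (4 / 5 : ℝ) ≤
      5 / 4 * (N : ℝ) ^ (4 / 5 : ℝ) := by
  induction N with
  | zero => simp
  | succ n ih =>
    rw [Finset.sum_Icc_succ_top (by omega)]
    have hm : (0 : ℝ) < (n + 1 : ℕ) := by positivity
    set M : ℝ := ((n + 1 : ℕ) : ℝ) with hM
    have hn : (n : ℝ) = M * (1 + -(1 / M)) := by
      rw [hM]; push_cast; field_simp; ring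
    have hM1 : 1 / M ≤ 1 := (div_le_one hm).2 (by rw [hM]; push_cast; linarith [n.cast_nonneg (α := ℝ)])
    have h1 := rpow_one_add_le_one_add_mul_self (s := -(1 / M)) (by linarith)
      (p := 4 / 5) (by norm_num) (by norm_num)
    have h2 : (n : ℝ) ^ (4 / 5 : ℝ) ≤ M ^ (4 / 5 : ℝ) * (1 + 4 / 5 * -(1 / M)) := by
      rw [hn, Real.mul_rpow hm.le (by linarith)]
      exact mul_le_mul_of_nonneg_left h1 (by positivity)
    nlinarith

lemma exists_neighbourSum_error (l : ℕ) (hl : 2 ≤ l) {lam : ℝ} (hlam : 0 < lam) :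
    ∃ C, 0 ≤ C ∧ ∀ (Q m : ℕ) (ε : ℝ) (s : ℤˣ) (J : Set ℝ), J.OrdConnected → J ⊆ Icc 0 1 →
      0 < ε → Q = ⌊1 / ε⌋₊ → 1 ≤ Q → 1 ≤ m → m ≤ Q →
      |neighbourSum l m (max ⌊lam * Q⌋₊ (Q - m) + 1) (Q + 1) s J ε -
        (∫ u in J, reflWeight u) * localDensity l m *
          ∑ n ∈ Finset.Ico (max ⌊lam * Q⌋₊ (Q - m) + 1) (Q + 1), (1 / (n : ℝ) - 1 / Q)| ≤
        C / Q * (m : ℝ) ^ (4 / 5 : ℝ) := by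
  obtain ⟨C0, hC0, hbox⟩ := exists_boxError_le
  refine ⟨1 / lam * (2 * C0 + C0 * l + 6) + 1 + 1 / lam ^ 2 + 1 / lam, by positivity, ?_⟩
  intro Q m ε s J hJ hJ1 hε hQε hQ hm hmQ
  have hQ' : (0 : ℝ) < Q := by exact_mod_cast hQ
  have hQ1 : (1 : ℝ) ≤ Q := by exact_mod_cast hQ
  have hm1 : (1 : ℝ) ≤ m := by exact_mod_cast hm
  have hl1 : (1 : ℝ) ≤ l := by exact_mod_cast (by omega : 1 ≤ l)
  set N := ⌊lam * Q⌋₊ with hN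
  set a' := max N (Q - m) + 1 with ha'
  have hNa : N + 1 ≤ a' := by rw [ha']; gcongr; exact le_max_left _ _
  have hMa : Q - m + 1 ≤ a' := by rw [ha']; gcongr; exact le_max_right _ _
  have hlQ : lam * Q ≤ a' := by
    have h1 := (Nat.lt_floor_add_one (lam * Q)).le
    have h2 : ((N + 1 : ℕ) : ℝ) ≤ a' := by exact_mod_cast hNa
    push_cast at h2
    linarith
  set G : ℝ := 1 / (lam * Q) with hG
  have hGa : 1 / (a' : ℝ) ≤ G := one_div_le_one_div_of_le (by positivity) hlQ
  have hε1 : ε ≤ 1 / Q := by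
    have : (Q : ℝ) ≤ 1 / ε := by rw [hQε]; exact Nat.floor_le (by positivity)
    rw [le_div_iff₀ hε] at this
    rw [le_div_iff₀ hQ']
    linarith
  have hε2 : 1 / Q - 1 / (Q : ℝ) ^ 2 ≤ ε := by
    have h1 : 1 / ε < Q + 1 := by rw [hQε]; exact Nat.lt_floor_add_one _
    rw [div_lt_iff₀ hε] at h1
    have h2 : 1 / Q - 1 / (Q : ℝ) ^ 2 = (Q - 1) / (Q : ℝ) ^ 2 := by field_simp
    rw [h2, div_le_iff₀ (by positivity)]
    nlinarith [mul_nonneg (sub_nonneg.2 hQ1) (sub_nonneg.2 h1.le)]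
  have e1 := abs_neighbourSum_sub_le l m Q a' (Q + 1) hm s hJ (by omega) (by omega) le_rfl
    hε1 hε2 hGa
  have hpos : ∀ i ∈ Finset.Ico a' (Q + 1), (0 : ℝ) < i := fun i hi => by
    rw [Finset.mem_Ico] at hi
    exact_mod_cast (by omega : 0 < i)
  have e2 := abs_sum_neighbourPairs_sub_le l m hl hm s hJ hJ1 (a' := a') (b' := Q + 1) (by omega)
    (v := fun n => 1 / (n : ℝ) - 1 / Q) (G := G) (by positivity)
    (fun i hi j hj hij => sub_le_sub_right
      (one_div_le_one_div_of_le (hpos i (by simpa using hi)) (by exact_mod_cast hij)) _)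
    (fun i hi => sub_nonneg.2 (one_div_le_one_div_of_le (hpos i hi) (by
      have := (Finset.mem_Ico.1 hi).2
      exact_mod_cast (by omega : i ≤ Q))))
    (fun i hi => by
      have h1 : 1 / (i : ℝ) ≤ 1 / a' := one_div_le_one_div_of_le
        (by exact_mod_cast (by omega : 0 < a')) (by exact_mod_cast (Finset.mem_Ico.1 hi).1)
      have h2 : 0 ≤ 1 / (Q : ℝ) := by positivity
      linarith)
  have hp1 : 1 ≤ (m : ℝ) ^ (4 / 5 : ℝ) := one_le_rpow hm1 (by norm_num)
  set P := (m : ℝ) ^ (4 / 5 : ℝ) with hP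
  have hb1 : boxError m ≤ C0 * P := hbox m hm
  have hb2 : boxError (l * m) ≤ C0 * (l * P) := by
    refine (hbox (l * m) (by nlinarith)).trans ?_
    rw [Nat.cast_mul, Real.mul_rpow (by positivity) (by positivity)]
    have : (l : ℝ) ^ (4 / 5 : ℝ) ≤ l := by
      simpa using rpow_le_rpow_of_exponent_le hl1 (by norm_num : (4 / 5 : ℝ) ≤ 1)
    gcongr
  have h1 : G * (2 * boxError m + boxError (l * m) + 6) ≤
      G * ((2 * C0 + C0 * l + 6) * P) := by
    refine mul_le_mul_of_nonneg_left ?_ (by positivity)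
    nlinarith
  have h2 : m / (Q : ℝ) ^ 2 ≤ 1 / Q * P := by
    calc (m : ℝ) / (Q : ℝ) ^ 2 ≤ (Q : ℝ) / (Q : ℝ) ^ 2 := by gcongr
      _ = 1 / (Q : ℝ) * 1 := by field_simp
      _ ≤ _ := by gcongr
  have h3 : G ^ 2 ≤ 1 / lam ^ 2 * (1 / Q) * P := by
    calc G ^ 2 = 1 / lam ^ 2 * (1 / Q * (1 / Q)) * 1 := by rw [hG]; field_simp
      _ ≤ 1 / lam ^ 2 * (1 / Q * 1) * P := by
        gcongr
        exact (div_le_one hQ').2 hQ1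
      _ = _ := by ring
  have h4 : G ≤ G * P := le_mul_of_one_le_right (by positivity) hp1
  refine (abs_sub_le _ _ _).trans ((add_le_add e1 e2).trans ?_)
  have h5 : (1 / lam * (2 * C0 + C0 * l + 6) + 1 + 1 / lam ^ 2 + 1 / lam) / Q * P =
      G * ((2 * C0 + C0 * l + 6) * P) + 1 / Q * P + 1 / lam ^ 2 * (1 / Q) * P + G * P := by
    rw [hG]; field_simp
  rw [h5]
  linarith

lemma exists_sum_neighbourSum_error (l : ℕ) (hl : 2 ≤ l) {lam : ℝ} (hlam : 0 < lam)
    (hlam1 : lam ≤ 1) :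
    ∃ C, 0 ≤ C ∧ ∀ (Q : ℕ) (ε : ℝ) (s : ℤˣ) (J : Set ℝ), J.OrdConnected → J ⊆ Icc 0 1 →
      0 < ε → Q = ⌊1 / ε⌋₊ → 1 ≤ Q →
      |∑ m ∈ Finset.Icc 1 ⌊lam * Q⌋₊,
          1 / (m : ℝ) * neighbourSum l m (max ⌊lam * Q⌋₊ (Q - m) + 1) (Q + 1) s J ε -
        (∫ u in J, reflWeight u) * ∑ m ∈ Finset.Icc 1 ⌊lam * Q⌋₊,
          1 / (m : ℝ) * (localDensity l m *
          ∑ n ∈ Finset.Ico (max ⌊lam * Q⌋₊ (Q - m) + 1) (Q + 1), (1 / (n : ℝ) - 1 / Q))| ≤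
        C * (Q : ℝ) ^ (-(1 / 5) : ℝ) := by
  obtain ⟨C, hC, h⟩ := exists_neighbourSum_error l hl hlam
  refine ⟨C * (5 / 4), by positivity, ?_⟩
  intro Q ε s J hJ hJ1 hε hQε hQ
  have hQ' : (0 : ℝ) < Q := by exact_mod_cast hQ
  have hNQ : ⌊lam * Q⌋₊ ≤ Q := by
    refine Nat.floor_le_of_le ?_
    nlinarith
  rw [Finset.mul_sum, ← Finset.sum_sub_distrib]
  refine (Finset.abs_sum_le_sum_abs _ _).trans ?_
  calc _ ≤ ∑ m ∈ Finset.Icc 1 ⌊lam * Q⌋₊,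
        C / Q * (1 / (m : ℝ) * (m : ℝ) ^ (4 / 5 : ℝ)) := by
        refine Finset.sum_le_sum fun m hm => ?_
        rw [Finset.mem_Icc] at hm
        have hm0 : (0 : ℝ) < m := by exact_mod_cast hm.1
        have := h Q m ε s J hJ hJ1 hε hQε hQ hm.1 (hm.2.trans hNQ)
        rw [mul_left_comm, ← mul_sub, abs_mul, abs_of_pos (by positivity : 0 < 1 / (m : ℝ)),
          ← mul_assoc (∫ u in J, reflWeight u), mul_left_comm (C / Q)]
        exact mul_le_mul_of_nonneg_left this (by positivity)
    _ ≤ C / Q * (5 / 4 * (Q : ℝ) ^ (4 / 5 : ℝ)) := by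
        rw [← Finset.mul_sum]
        refine mul_le_mul_of_nonneg_left ((sum_inv_mul_rpow_le _).trans ?_) (by positivity)
        have : ((⌊lam * Q⌋₊ : ℕ) : ℝ) ≤ Q := by exact_mod_cast hNQ
        gcongr
    _ = C * (5 / 4) * (Q : ℝ) ^ (-(1 / 5) : ℝ) := by
        have : (Q : ℝ) ^ (-(1 / 5) : ℝ) = (Q : ℝ) ^ (4 / 5 : ℝ) / Q := by
          rw [← Real.rpow_sub_one hQ'.ne']; norm_num
        rw [this]; ring

/-- The arithmetic function `d ↦ μ(d) / d`, restricted to `d` coprime to `l`. -/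
noncomputable def moebiusDiv (l : ℕ) : ArithmeticFunction ℝ where
  toFun d := if d.Coprime l then (ArithmeticFunction.moebius d : ℝ) / d else 0
  map_zero' := by simp

/-- The indicator function of the positive integers coprime to `l`. -/
noncomputable def coprimeIndicator (l : ℕ) : ArithmeticFunction ℝ where
  toFun d := if d ≠ 0 ∧ d.Coprime l then 1 else 0
  map_zero' := by simp

lemma moebiusDiv_apply (l d : ℕ) : moebiusDiv l d =
    if d.Coprime l then (ArithmeticFunction.moebius d : ℝ) / d else 0 := rfl

lemma coprimeIndicator_apply (l d : ℕ) : coprimeIndicator l d =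
    if d ≠ 0 ∧ d.Coprime l then 1 else 0 := rfl

lemma isMultiplicative_moebiusDiv (l : ℕ) : (moebiusDiv l).IsMultiplicative := by
  refine ⟨by simp [moebiusDiv_apply], fun {m n} h => ?_⟩
  have hc : (m * n).Coprime l ↔ m.Coprime l ∧ n.Coprime l := Nat.coprime_mul_iff_left
  simp only [moebiusDiv_apply, ArithmeticFunction.isMultiplicative_moebius.map_mul_of_coprime h]
  by_cases h1 : m.Coprime l
  · by_cases h2 : n.Coprime l
    · rw [if_pos (hc.2 ⟨h1, h2⟩), if_pos h1, if_pos h2, Nat.cast_mul, Int.cast_mul,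
        mul_div_mul_comm]
    · rw [if_neg fun h => h2 (hc.1 h).2, if_neg h2, mul_zero]
  · rw [if_neg fun h => h1 (hc.1 h).1, if_neg h1, zero_mul]

lemma abs_moebiusDiv_le (l d : ℕ) : |moebiusDiv l d| ≤ 1 / d := by
  rw [moebiusDiv_apply]
  split_ifs
  · rw [abs_div, Nat.abs_cast]
    gcongr
    exact_mod_cast ArithmeticFunction.abs_moebius_le_one
  · simp

lemma moebiusDiv_prime_pow (l : ℕ) {p k : ℕ} (hp : p.Prime) (hk : 2 ≤ k) :
    moebiusDiv l (p ^ k) = 0 := by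
  rw [moebiusDiv_apply, ArithmeticFunction.moebius_apply_prime_pow hp (by omega),
    if_neg (by omega : k ≠ 1)]
  simp

lemma moebiusDiv_prime (l : ℕ) {p : ℕ} (hp : p.Prime) :
    moebiusDiv l p = if p ∣ l then 0 else -1 / (p : ℝ) := by
  rw [moebiusDiv_apply, ArithmeticFunction.moebius_apply_prime hp]
  by_cases h : p ∣ l <;> simp [hp.coprime_iff_not_dvd, h]

lemma moebiusDiv_mul_zeta_prime_pow (l : ℕ) {p k : ℕ} (hp : p.Prime) (hk : k ≠ 0) :
    (moebiusDiv l * (ArithmeticFunction.zeta : ArithmeticFunction ℝ)) (p ^ k) =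
      if p ∣ l then 1 else 1 - 1 / (p : ℝ) := by
  rw [ArithmeticFunction.coe_mul_zeta_apply, Nat.sum_divisors_prime_pow hp]
  obtain ⟨k, rfl⟩ := Nat.exists_eq_succ_of_ne_zero hk
  rw [Finset.sum_range_succ', Finset.sum_range_succ']
  rw [Finset.sum_eq_zero fun i _ => moebiusDiv_prime_pow l hp (by omega)]
  rw [zero_add, zero_add, pow_one, pow_zero, (isMultiplicative_moebiusDiv l).map_one,
    moebiusDiv_prime l hp]
  split_ifs <;> ring

lemma totient_eq_mul_prod (n : ℕ) :
    (n.totient : ℝ) = n * ∏ p ∈ n.primeFactors, (1 - 1 / (p : ℝ)) := by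
  have := congrArg (fun x : ℚ => (x : ℝ)) (Nat.totient_eq_mul_prod_factors n)
  push_cast at this
  simpa using this

lemma moebiusDiv_mul_zeta_apply {l m : ℕ} (hl : l ≠ 0) (hm : m ≠ 0) :
    (l.totient : ℝ) * (moebiusDiv l * (ArithmeticFunction.zeta : ArithmeticFunction ℝ)) m =
      (l * m).totient / m := by
  have hmul : (moebiusDiv l * (ArithmeticFunction.zeta : ArithmeticFunction ℝ)).IsMultiplicative :=
    (isMultiplicative_moebiusDiv l).mul ArithmeticFunction.isMultiplicative_zeta.natCast
  rw [hmul.multiplicative_factorization _ hm, Finsupp.prod, Nat.support_factorization,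
    Finset.prod_congr rfl fun p hp => moebiusDiv_mul_zeta_prime_pow l
      (Nat.prime_of_mem_primeFactors hp) (Finsupp.mem_support_iff.1 (by
        rwa [Nat.support_factorization]))]
  rw [totient_eq_mul_prod l, totient_eq_mul_prod (l * m), Nat.primeFactors_mul hl hm]
  have h1 : ∏ p ∈ m.primeFactors, (if p ∣ l then 1 else 1 - 1 / (p : ℝ)) =
      ∏ p ∈ m.primeFactors \ l.primeFactors, (1 - 1 / (p : ℝ)) := by
    rw [← Finset.prod_subset Finset.sdiff_subset fun p hp hp' => ?_]
    · refine Finset.prod_congr rfl fun p hp => if_neg fun h => ?_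
      rw [Finset.mem_sdiff] at hp
      exact hp.2 (Nat.mem_primeFactors.2 ⟨Nat.prime_of_mem_primeFactors hp.1, h, hl⟩)
    · rw [Finset.mem_sdiff, not_and_not_right] at hp'
      exact if_pos (Nat.dvd_of_mem_primeFactors (hp' hp))
  rw [h1, ← Finset.union_sdiff_self_eq_union, Finset.prod_union Finset.disjoint_sdiff]
  have : (m : ℝ) ≠ 0 := by exact_mod_cast hm
  push_cast
  field_simp

lemma moebiusDiv_mul_coprimeIndicator_apply {l m : ℕ} (hl : l ≠ 0) (hm : m ≠ 0) :
    (moebiusDiv l * coprimeIndicator l) m =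
      if l.Coprime m then (m.totient : ℝ) / m else 0 := by
  have hl0 : (l.totient : ℝ) ≠ 0 := by
    exact_mod_cast (Nat.totient_pos.2 (Nat.pos_of_ne_zero hl)).ne'
  split_ifs with h
  · have h1 := moebiusDiv_mul_zeta_apply hl hm
    rw [Nat.totient_mul h] at h1
    push_cast at h1
    rw [mul_div_assoc] at h1
    rw [← mul_left_cancel₀ hl0 h1, ArithmeticFunction.mul_apply, ArithmeticFunction.mul_apply]
    refine Finset.sum_congr rfl fun x hx => ?_
    rw [Nat.mem_divisorsAntidiagonal] at hx
    have hx2 : x.2 ≠ 0 := fun h0 => hm (by rw [← hx.1, h0, mul_zero])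
    have hc : x.2.Coprime l := (h.coprime_dvd_right (Dvd.intro_left x.1 hx.1)).symm
    rw [coprimeIndicator_apply, if_pos ⟨hx2, hc⟩]
    simp [hx2]
  · rw [ArithmeticFunction.mul_apply]
    refine Finset.sum_eq_zero fun x hx => ?_
    rw [Nat.mem_divisorsAntidiagonal] at hx
    rw [moebiusDiv_apply, coprimeIndicator_apply]
    by_cases h1 : x.1.Coprime l
    · by_cases h2 : x.2.Coprime l
      · refine absurd ?_ h
        rw [← hx.1]
        exact (h1.mul_left h2).symm
      · simp [h2]
    · simp [h1]

lemma localDensity_eq {l m : ℕ} (hl : l ≠ 0) (hm : m ≠ 0) :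
    localDensity l m =
      (moebiusDiv 1 * (ArithmeticFunction.zeta : ArithmeticFunction ℝ)) m -
      1 / l * (moebiusDiv l * coprimeIndicator l) m -
      (l.totient : ℝ) / l ^ 2 *
        (moebiusDiv l * (ArithmeticFunction.zeta : ArithmeticFunction ℝ)) m := by
  have h1 := moebiusDiv_mul_zeta_apply one_ne_zero hm
  rw [Nat.totient_one, Nat.cast_one, one_mul, one_mul] at h1
  have h2 := moebiusDiv_mul_zeta_apply hl hm
  rw [h1, moebiusDiv_mul_coprimeIndicator_apply hl hm, div_mul_eq_mul_div (l.totient : ℝ), h2,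
    localDensity]
  have : (m : ℝ) ≠ 0 := by exact_mod_cast hm
  have : (l : ℝ) ≠ 0 := by exact_mod_cast hl
  split_ifs
  · field_simp
  · field_simp
    ring

/-- The density constant `∑ μ(d) / d²` over `d` coprime to `l`. -/
noncomputable def moebiusConst (l : ℕ) : ℝ := ∑' d : ℕ, moebiusDiv l d / d

lemma summable_moebiusDiv_div (l : ℕ) : Summable fun d : ℕ => ‖moebiusDiv l d / (d : ℝ)‖ := by
  refine Summable.of_nonneg_of_le (fun _ => norm_nonneg _) (fun d => ?_)
    (Real.summable_one_div_nat_pow.2 one_lt_two)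
  rw [norm_eq_abs, abs_div, Nat.abs_cast]
  calc _ ≤ 1 / (d : ℝ) / d := by gcongr; exact abs_moebiusDiv_le l d
    _ = _ := by rw [div_div, sq]

lemma abs_sum_moebiusDiv_mul_sub_le (l : ℕ) {g : ArithmeticFunction ℝ} {β L : ℝ} (hβ0 : 0 ≤ β)
    (hβ1 : β ≤ 1) (hL : 0 ≤ L)
    (hg : ∀ K : ℕ, |∑ m ∈ Finset.Ioc 0 K, g m - β * K| ≤ L) (M : ℕ) :
    |∑ m ∈ Finset.Ioc 0 M, (moebiusDiv l * g) m - β * moebiusConst l * M| ≤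
      (L + 1) * (∑' d : ℕ, 1 / (d : ℝ) ^ (3 / 2 : ℝ)) * √M := by
  set T : ℕ → ℝ := fun K => ∑ m ∈ Finset.Ioc 0 K, g m with hT
  have hcount : ∀ d : ℕ, d ≠ 0 → |T (M / d) - β * (M / d)| ≤ (L + 1) * √((M : ℝ) / d) := by
    intro d hd
    have hd' : (0 : ℝ) < d := by exact_mod_cast Nat.pos_of_ne_zero hd
    rcases lt_or_ge M d with h | h
    · rw [Nat.div_eq_of_lt h, hT]
      simp only [Finset.Ioc_self, Finset.sum_empty, zero_sub, abs_neg]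
      have h1 : (M : ℝ) / d ≤ 1 := (div_le_one hd').2 (by exact_mod_cast h.le)
      have h0 : 0 ≤ (M : ℝ) / d := by positivity
      rw [abs_of_nonneg (by positivity)]
      have h2 : (M : ℝ) / d ≤ √((M : ℝ) / d) := Real.le_sqrt_of_sq_le (by nlinarith)
      have := Real.sqrt_nonneg ((M : ℝ) / d)
      nlinarith
    · have h1 : 1 ≤ (M : ℝ) / d := (one_le_div hd').2 (by exact_mod_cast h)
      have h2 : 1 ≤ √((M : ℝ) / d) := Real.one_le_sqrt.2 h1
      have h3 : ((M / d : ℕ) : ℝ) ≤ M / d := Nat.cast_div_le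
      have h4 : (M : ℝ) / d < (M / d : ℕ) + 1 := by
        rw [div_lt_iff₀ hd']
        have := Nat.lt_mul_div_succ M (Nat.pos_of_ne_zero hd)
        have h5 : (M : ℝ) < d * ((M / d : ℕ) + 1) := by exact_mod_cast this
        linarith
      have h6 : |β * ((M / d : ℕ) : ℝ) - β * (M / d)| ≤ 1 := by
        rw [← mul_sub, abs_mul, abs_of_nonneg hβ0]
        have : |((M / d : ℕ) : ℝ) - M / d| ≤ 1 := by
          rw [abs_le]; constructor <;> linarith
        calc _ ≤ 1 * (1 : ℝ) := by gcongr
          _ = 1 := one_mul 1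
      calc _ ≤ |T (M / d) - β * ((M / d : ℕ) : ℝ)| + |β * ((M / d : ℕ) : ℝ) - β * (M / d)| :=
            abs_sub_le _ _ _
        _ ≤ L + 1 := add_le_add (hg _) h6
        _ ≤ _ := le_mul_of_one_le_right (by positivity) h2
  have hsum0 : ∑ m ∈ Finset.Ioc 0 M, (moebiusDiv l * g) m =
      ∑' d : ℕ, moebiusDiv l d * T (M / d) := by
    rw [ArithmeticFunction.sum_Ioc_mul_eq_sum_sum, tsum_eq_sum]
    intro d hd
    rw [Finset.mem_Ioc, not_and_or] at hd
    rcases hd with hd | hd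
    · have : d = 0 := by omega
      rw [this, ArithmeticFunction.map_zero, zero_mul]
    · rw [Nat.div_eq_of_lt (by omega), hT]
      simp
  have hs1 : Summable fun d : ℕ => moebiusDiv l d * T (M / d) := by
    refine summable_of_ne_finset_zero (s := Finset.Ioc 0 M) fun d hd => ?_
    rw [Finset.mem_Ioc, not_and_or] at hd
    rcases hd with hd | hd
    · have : d = 0 := by omega
      rw [this, ArithmeticFunction.map_zero, zero_mul]
    · rw [Nat.div_eq_of_lt (by omega), hT]
      simp
  have hs2 : Summable fun d : ℕ => β * M * (moebiusDiv l d / d) :=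
    (summable_moebiusDiv_div l).of_norm.mul_left _
  have hs3 : Summable fun d : ℕ => 1 / (d : ℝ) ^ (3 / 2 : ℝ) :=
    Real.summable_one_div_nat_rpow.2 (by norm_num)
  rw [hsum0, moebiusConst, mul_right_comm, ← tsum_mul_left, ← hs1.tsum_sub hs2,
    mul_right_comm, ← tsum_mul_left, ← norm_eq_abs]
  refine tsum_of_norm_bounded (hs3.mul_left _).hasSum fun d => ?_
  rcases eq_or_ne d 0 with rfl | hd
  · simp only [ArithmeticFunction.map_zero, zero_mul, zero_div, mul_zero, sub_zero, norm_zero]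
    positivity
  · have hd' : (0 : ℝ) < d := by exact_mod_cast Nat.pos_of_ne_zero hd
    have e1 : moebiusDiv l d * T (M / d) - β * M * (moebiusDiv l d / d) =
        moebiusDiv l d * (T (M / d) - β * (M / d)) := by ring
    rw [e1, norm_eq_abs, abs_mul]
    calc _ ≤ 1 / (d : ℝ) * ((L + 1) * √((M : ℝ) / d)) :=
          mul_le_mul (abs_moebiusDiv_le l d) (hcount d hd) (abs_nonneg _) (by positivity)
      _ = _ := by
          have : (d : ℝ) ^ (3 / 2 : ℝ) = d * √d := by
            rw [Real.sqrt_eq_rpow, ← Real.rpow_one_add' hd'.le (by norm_num)]; norm_num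
          rw [Real.sqrt_div (by positivity), this]
          field_simp

lemma hasProd_moebiusConst (l : ℕ) :
    HasProd (fun p : Nat.Primes => if (p : ℕ) ∣ l then (1 : ℝ) else 1 - 1 / (p : ℝ) ^ 2)
      (moebiusConst l) := by
  have h := EulerProduct.eulerProduct_hasProd (f := fun d : ℕ => moebiusDiv l d / (d : ℝ))
    (by simp [(isMultiplicative_moebiusDiv l).map_one])
    (fun {m n} h => by
      simp only [(isMultiplicative_moebiusDiv l).map_mul_of_coprime h, Nat.cast_mul,
        mul_div_mul_comm])
    (summable_moebiusDiv_div l) (by simp)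
  refine (congrArg (fun f => HasProd f (moebiusConst l)) (funext fun p => ?_)).mp h
  have hp := p.2
  rw [tsum_eq_sum (s := Finset.range 2) fun e he => by
    rw [moebiusDiv_prime_pow l hp (by rw [Finset.mem_range] at he; omega), zero_div], Finset.sum_range_succ,
    Finset.sum_range_one, pow_zero, pow_one, (isMultiplicative_moebiusDiv l).map_one,
    moebiusDiv_prime l hp]
  split_ifs
  · simp
  · rw [Nat.cast_one, div_one, div_div, ← sq]
    ring

lemma moebiusConst_eq_tprod (l : ℕ) :
    moebiusConst l = ∏' p : {p : ℕ // p.Prime ∧ ¬ p ∣ l}, (1 - 1 / (p.1 : ℝ) ^ 2) := by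
  have h := hasProd_moebiusConst l
  have h1 : (fun p : Nat.Primes => if (p : ℕ) ∣ l then (1 : ℝ) else 1 - 1 / (p : ℝ) ^ 2) =
      (fun p : ℕ => if p ∣ l then (1 : ℝ) else 1 - 1 / (p : ℝ) ^ 2) ∘
        ((↑) : {p : ℕ | p.Prime} → ℕ) := rfl
  rw [h1] at h
  have h2 := hasProd_subtype_iff_mulIndicator.1 h
  have h3 : Set.mulIndicator {p : ℕ | p.Prime}
      (fun p : ℕ => if p ∣ l then (1 : ℝ) else 1 - 1 / (p : ℝ) ^ 2) =
      Set.mulIndicator {p : ℕ | p.Prime ∧ ¬ p ∣ l} fun p : ℕ => 1 - 1 / (p : ℝ) ^ 2 := by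
    funext p
    by_cases hp : p.Prime <;> by_cases hd : p ∣ l <;> simp [Set.mulIndicator, hp, hd]
  rw [h3] at h2
  exact (hasProd_subtype_iff_mulIndicator.2 h2).tprod_eq.symm

lemma moebiusConst_one : moebiusConst 1 = 1 / zeta2 := by
  have h1 := hasProd_moebiusConst 1
  have hz : HasSum (fun n : ℕ => 1 / (n : ℝ) ^ 2) zeta2 := hasSum_zeta_two
  let f : ℕ →*₀ ℝ :=
    { toFun := fun n => 1 / (n : ℝ) ^ 2
      map_zero' := by simp
      map_one' := by simp
      map_mul' := fun m n => by push_cast; rw [mul_pow, one_div_mul_one_div] }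
  have h2 := EulerProduct.eulerProduct_completely_multiplicative_hasProd (f := f) (by
    refine hz.summable.congr fun n => ?_
    change _ = ‖1 / (n : ℝ) ^ 2‖
    rw [Real.norm_of_nonneg (by positivity)])
  have h3 : ∑' n, f n = zeta2 := hz.tsum_eq
  rw [h3] at h2
  have h4 := h1.mul h2
  have h5 : (fun p : Nat.Primes => (if (p : ℕ) ∣ 1 then (1 : ℝ) else 1 - 1 / (p : ℝ) ^ 2) *
      (1 - f p)⁻¹) = fun _ => 1 := by
    funext p
    have hp : (1 : ℝ) < p := by exact_mod_cast p.2.one_lt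
    have hp' : ¬ (p : ℕ) ∣ 1 := by
      rw [Nat.dvd_one]; exact p.2.one_lt.ne'
    have : 1 - 1 / (p : ℝ) ^ 2 ≠ 0 := by
      have : 1 / (p : ℝ) ^ 2 < 1 := (div_lt_one (by positivity)).2 (by nlinarith)
      linarith
    rw [if_neg hp']
    exact mul_inv_cancel₀ this
  rw [h5] at h4
  have h6 : moebiusConst 1 * zeta2 = 1 := h4.unique hasProd_one
  have : zeta2 ≠ 0 := by unfold zeta2; positivity
  rw [eq_div_iff this, h6]

lemma card_coprime_sub_le {l : ℕ} (hl : 0 < l) (K : ℕ) :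
    |∑ m ∈ Finset.Ioc 0 K, coprimeIndicator l m - (l.totient : ℝ) / l * K| ≤ l := by
  have hl' : (0 : ℝ) < l := by exact_mod_cast hl
  have hφ : (l.totient : ℝ) ≤ l := by exact_mod_cast Nat.totient_le l
  have hcard : ∀ a b : ℕ, 1 ≤ a → ∑ m ∈ Finset.Ico a b, coprimeIndicator l m =
      ((Finset.Ico a b).filter fun m => l.Coprime m).card := by
    intro a b ha
    rw [← Finset.sum_boole]
    refine Finset.sum_congr rfl fun m hm => ?_
    rw [Finset.mem_Ico] at hm
    rw [coprimeIndicator_apply]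
    have : (m ≠ 0 ∧ m.Coprime l) ↔ l.Coprime m := by
      rw [Nat.coprime_comm]
      exact ⟨fun h => h.2, fun h => ⟨by omega, h⟩⟩
    exact if_congr this rfl rfl
  have hIco : ∀ K, Finset.Ioc 0 K = Finset.Ico 1 (K + 1) := fun K => by
    ext x; simp only [Finset.mem_Ioc, Finset.mem_Ico]; omega
  have hsmall : ∀ r < l, |∑ m ∈ Finset.Ioc 0 r, coprimeIndicator l m -
      (l.totient : ℝ) / l * r| ≤ l := by
    intro r hr
    rw [hIco, hcard _ _ le_rfl]
    have h1 : ((Finset.Ico 1 (r + 1)).filter fun m => l.Coprime m).card ≤ r :=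
      (Finset.card_filter_le _ _).trans (by simp)
    have h2 : (((Finset.Ico 1 (r + 1)).filter fun m => l.Coprime m).card : ℝ) ≤ r := by
      exact_mod_cast h1
    have h3 : (r : ℝ) ≤ l := by exact_mod_cast hr.le
    have h4 : (l.totient : ℝ) / l * r ≤ 1 * r := by
      gcongr; exact (div_le_one hl').2 hφ
    have h5 : 0 ≤ (l.totient : ℝ) / l * r := by positivity
    have h6 : (0 : ℝ) ≤ ((Finset.Ico 1 (r + 1)).filter fun m => l.Coprime m).card := by positivity
    rw [abs_le]
    constructor <;> linarith
  have hstep : ∀ r j : ℕ, ∑ m ∈ Finset.Ioc 0 (r + l * j), coprimeIndicator l m =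
      ∑ m ∈ Finset.Ioc 0 r, coprimeIndicator l m + l.totient * j := by
    intro r j
    induction j with
    | zero => simp
    | succ j ih =>
      rw [hIco] at ih ⊢
      rw [← Finset.sum_Ico_consecutive _ (by omega : 1 ≤ r + l * j + 1)
        (by rw [mul_add]; omega : r + l * j + 1 ≤ r + l * (j + 1) + 1), ih,
        hcard _ _ (by omega : 1 ≤ r + l * j + 1),
        show r + l * (j + 1) + 1 = r + l * j + 1 + l by ring,
        Nat.filter_coprime_Ico_eq_totient]
      push_cast; ring
  rw [← Nat.mod_add_div K l, hstep]
  have := hsmall (K % l) (Nat.mod_lt _ hl)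
  convert this using 2
  push_cast
  field_simp
  ring

lemma sum_zeta_eq (K : ℕ) :
    ∑ m ∈ Finset.Ioc 0 K, (ArithmeticFunction.zeta : ArithmeticFunction ℝ) m = K := by
  rw [Finset.sum_congr rfl fun m hm => (by
    rw [Finset.mem_Ioc] at hm
    have : m ≠ 0 := by omega
    simp [this] :
    (ArithmeticFunction.zeta : ArithmeticFunction ℝ) m = 1)]
  simp

lemma exists_sum_localDensity_sub_le {l : ℕ} (hl : 0 < l) :
    ∃ C, 0 ≤ C ∧ ∀ M : ℕ,
      |∑ m ∈ Finset.Ioc 0 M, localDensity l m - Aconst l * M| ≤ C * √M := by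
  have hl' : (0 : ℝ) < l := by exact_mod_cast hl
  have hφ : (l.totient : ℝ) ≤ l := by exact_mod_cast Nat.totient_le l
  have hZ : ∀ K : ℕ, |∑ m ∈ Finset.Ioc 0 K,
      (ArithmeticFunction.zeta : ArithmeticFunction ℝ) m - 1 * K| ≤ 0 := fun K => by
    rw [sum_zeta_eq]; simp
  set S := ∑' d : ℕ, 1 / (d : ℝ) ^ (3 / 2 : ℝ) with hS
  have hS0 : 0 ≤ S := tsum_nonneg fun d => by positivity
  have e1 := abs_sum_moebiusDiv_mul_sub_le 1 zero_le_one le_rfl le_rfl hZ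
  have e2 := abs_sum_moebiusDiv_mul_sub_le l (by positivity) ((div_le_one hl').2 hφ) hl'.le
    (card_coprime_sub_le hl)
  have e3 := abs_sum_moebiusDiv_mul_sub_le l zero_le_one le_rfl le_rfl hZ
  refine ⟨(0 + 1) * S + 1 / l * ((l + 1) * S) + (l.totient : ℝ) / l ^ 2 * ((0 + 1) * S),
    by positivity, fun M => ?_⟩
  have hA : Aconst l = 1 * moebiusConst 1 - 1 / l * ((l.totient : ℝ) / l * moebiusConst l) -
      (l.totient : ℝ) / l ^ 2 * (1 * moebiusConst l) := by
    rw [Aconst, Cconst, ← moebiusConst_eq_tprod, moebiusConst_one]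
    field_simp
    ring
  have hsum : ∑ m ∈ Finset.Ioc 0 M, localDensity l m =
      ∑ m ∈ Finset.Ioc 0 M, (moebiusDiv 1 * (ArithmeticFunction.zeta : ArithmeticFunction ℝ)) m -
      1 / l * ∑ m ∈ Finset.Ioc 0 M, (moebiusDiv l * coprimeIndicator l) m -
      (l.totient : ℝ) / l ^ 2 * ∑ m ∈ Finset.Ioc 0 M,
        (moebiusDiv l * (ArithmeticFunction.zeta : ArithmeticFunction ℝ)) m := by
    rw [Finset.mul_sum, Finset.mul_sum, ← Finset.sum_sub_distrib, ← Finset.sum_sub_distrib]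
    refine Finset.sum_congr rfl fun m hm => ?_
    rw [Finset.mem_Ioc] at hm
    exact localDensity_eq hl.ne' (by omega)
  rw [hsum, hA]
  specialize e1 M
  specialize e2 M
  specialize e3 M
  set X1 := ∑ m ∈ Finset.Ioc 0 M,
    (moebiusDiv 1 * (ArithmeticFunction.zeta : ArithmeticFunction ℝ)) m
  set X2 := ∑ m ∈ Finset.Ioc 0 M, (moebiusDiv l * coprimeIndicator l) m
  set X3 := ∑ m ∈ Finset.Ioc 0 M,
    (moebiusDiv l * (ArithmeticFunction.zeta : ArithmeticFunction ℝ)) m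
  have f2 : |1 / (l : ℝ) * (X2 - (l.totient : ℝ) / l * moebiusConst l * M)| ≤
      1 / l * ((l + 1) * S * √M) := by
    rw [abs_mul, abs_of_pos (by positivity)]
    exact mul_le_mul_of_nonneg_left e2 (by positivity)
  have f3 : |(l.totient : ℝ) / l ^ 2 * (X3 - 1 * moebiusConst l * M)| ≤
      (l.totient : ℝ) / l ^ 2 * ((0 + 1) * S * √M) := by
    rw [abs_mul, abs_of_nonneg (by positivity)]
    exact mul_le_mul_of_nonneg_left e3 (by positivity)
  calc _ = |(X1 - 1 * moebiusConst 1 * M) -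
        1 / l * (X2 - (l.totient : ℝ) / l * moebiusConst l * M) -
        (l.totient : ℝ) / l ^ 2 * (X3 - 1 * moebiusConst l * M)| := by congr 1; ring
    _ ≤ _ := (abs_sub _ _).trans (add_le_add ((abs_sub _ _).trans (add_le_add e1 f2)) f3)
    _ = _ := by ring

lemma abs_negMulLog_sub_le {x y : ℝ} (hx0 : 0 ≤ x) (hx1 : x ≤ 1) (hy0 : 0 ≤ y) (hy1 : y ≤ 1) :
    |negMulLog x - negMulLog y| ≤ 2 * √|x - y| := by
  wlog h : y ≤ x generalizing x y
  · rw [abs_sub_comm, abs_sub_comm x]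
    exact this hy0 hy1 hx0 hx1 (le_of_not_ge h)
  rcases h.eq_or_lt with rfl | h
  · simp
  have hx : 0 < x := hy0.trans_lt h
  set t := x - y with ht
  have ht0 : 0 < t := sub_pos.2 h
  have ht1 : t ≤ 1 := by linarith
  have hlogx : log x ≤ 0 := log_nonpos hx0 hx1
  have hs : 0 < √t := sqrt_pos.2 ht0
  have hst : √t * √t = t := mul_self_sqrt ht0.le
  have hs1 : √t ≤ 1 := sqrt_le_one.2 ht1
  have hlogt : -(t * log t) ≤ 2 * √t := by
    have h1 : log (√t)⁻¹ ≤ (√t)⁻¹ - 1 := log_le_sub_one_of_pos (by positivity)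
    rw [log_inv] at h1
    have h2 : log t = 2 * log √t := by
      conv_lhs => rw [← hst]
      rw [log_mul hs.ne' hs.ne']; ring
    have h3 : t * (√t)⁻¹ = √t := by
      rw [← div_eq_mul_inv, div_sqrt]
    have h4 : t * -log √t ≤ t * ((√t)⁻¹ - 1) := mul_le_mul_of_nonneg_left h1 ht0.le
    rw [h2]
    nlinarith
  have hlogtx : log t ≤ log x := log_le_log ht0 (by linarith)
  rw [abs_of_pos ht0, abs_le, negMulLog, negMulLog]
  rcases hy0.eq_or_lt with rfl | hy
  · have : x = t := by linarith
    rw [this] at hlogx ⊢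
    constructor
    · nlinarith
    · linarith
  · have h5 : log x - log y ≤ x / y - 1 := by
      rw [← log_div hx.ne' hy.ne']; exact log_le_sub_one_of_pos (by positivity)
    have h6 : y * (log x - log y) ≤ y * (x / y - 1) := mul_le_mul_of_nonneg_left h5 hy.le
    have h7 : y * (x / y - 1) = t := by field_simp; rfl
    have h8 : log y ≤ log x := log_le_log hy h.le
    have hx' : x = y + t := by linarith
    constructor
    · nlinarith
    · have : -x * log x - -y * log y = -(y * (log x - log y)) - t * log x := by
        rw [hx']; ring
      nlinarith [mul_nonneg hy.le (sub_nonneg.2 h8)]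

/-- The positive part of `u log (r / u)`, extended continuously to `u = 0`. -/
noncomputable def logKernel (r u : ℝ) : ℝ := max 0 (u * log r + negMulLog u)

lemma logKernel_nonneg (r u : ℝ) : 0 ≤ logKernel r u := le_max_left _ _

lemma continuous_logKernel (r : ℝ) : Continuous (logKernel r) := by
  unfold logKernel
  have := continuous_negMulLog
  fun_prop

lemma logKernel_eq {r u : ℝ} (hr : 0 < r) (hu : 0 ≤ u) :
    logKernel r u = u * max 0 (log (r / u)) := by
  rcases hu.eq_or_lt with rfl | hu
  · simp [logKernel]
  · rw [logKernel, mul_max_of_nonneg _ _ hu.le, mul_zero, log_div hr.ne' hu.ne', negMulLog]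
    congr 1; ring

lemma abs_logKernel_sub_le (r : ℝ) {x y : ℝ} (hx0 : 0 ≤ x) (hx1 : x ≤ 1) (hy0 : 0 ≤ y)
    (hy1 : y ≤ 1) : |logKernel r x - logKernel r y| ≤ (|log r| + 2) * √|x - y| := by
  have h1 : |x - y| ≤ √|x - y| := by
    refine Real.le_sqrt_of_sq_le ?_
    have : |x - y| ≤ 1 := abs_le.2 ⟨by linarith, by linarith⟩
    nlinarith [abs_nonneg (x - y)]
  calc _ ≤ |(x * log r + negMulLog x) - (y * log r + negMulLog y)| := by
        unfold logKernel
        rw [max_comm 0, max_comm 0]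
        exact abs_max_sub_max_le_abs _ _ _
    _ = |log r * (x - y) + (negMulLog x - negMulLog y)| := by congr 1; ring
    _ ≤ |log r| * |x - y| + 2 * √|x - y| := by
        refine (abs_add_le _ _).trans (add_le_add (abs_mul _ _).le ?_)
        exact abs_negMulLog_sub_le hx0 hx1 hy0 hy1
    _ ≤ |log r| * √|x - y| + 2 * √|x - y| := by gcongr
    _ = _ := by ring

lemma logKernel_le (r : ℝ) {x : ℝ} (hx0 : 0 ≤ x) (hx1 : x ≤ 1) :
    logKernel r x ≤ |log r| + 2 := by
  have h := abs_logKernel_sub_le r hx0 hx1 le_rfl zero_le_one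
  have h0 : logKernel r 0 = 0 := by simp [logKernel]
  rw [h0, sub_zero, sub_zero, abs_of_nonneg (logKernel_nonneg _ _), abs_of_nonneg hx0] at h
  refine h.trans (mul_le_of_le_one_right (by positivity) (sqrt_le_one.2 hx1))

/-- The continuous extension to `[0, 1]` of the integrand of `I2`. -/
noncomputable def pairDensity (r x : ℝ) : ℝ := logKernel r (1 - x) / max x r

lemma pairDensity_nonneg {r : ℝ} (hr : 0 < r) (x : ℝ) : 0 ≤ pairDensity r x :=
  div_nonneg (logKernel_nonneg _ _) (hr.le.trans (le_max_right _ _))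

lemma continuous_pairDensity {r : ℝ} (hr : 0 < r) : Continuous (pairDensity r) := by
  unfold pairDensity
  have := continuous_logKernel r
  refine Continuous.div (by fun_prop) (by fun_prop) fun x => ?_
  exact (hr.trans_le (le_max_right _ _)).ne'

lemma pairDensity_le {r x : ℝ} (hr : 0 < r) (hx0 : 0 ≤ x) (hx1 : x ≤ 1) :
    pairDensity r x ≤ (|log r| + 2) / r := by
  unfold pairDensity
  gcongr
  · exact logKernel_le r (by linarith) (by linarith)
  · exact le_max_right _ _

lemma exists_abs_pairDensity_sub_le {r : ℝ} (hr : 0 < r) :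
    ∃ C, 0 ≤ C ∧ ∀ x y : ℝ, 0 ≤ x → x ≤ 1 → 0 ≤ y → y ≤ 1 →
      |pairDensity r x - pairDensity r y| ≤ C * √|x - y| := by
  set B := |log r| + 2 with hB
  have hB0 : 0 ≤ B := by positivity
  refine ⟨B / r + B / r ^ 2, by positivity, fun x y hx0 hx1 hy0 hy1 => ?_⟩
  have h1 : |x - y| ≤ √|x - y| := by
    refine Real.le_sqrt_of_sq_le ?_
    have : |x - y| ≤ 1 := abs_le.2 ⟨by linarith, by linarith⟩
    nlinarith [abs_nonneg (x - y)]
  have hk := abs_logKernel_sub_le r (x := 1 - x) (y := 1 - y) (by linarith) (by linarith)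
    (by linarith) (by linarith)
  rw [show 1 - x - (1 - y) = -(x - y) by ring, abs_neg] at hk
  have hmx : r ≤ max x r := le_max_right _ _
  have hmy : r ≤ max y r := le_max_right _ _
  have hmx0 : 0 < max x r := hr.trans_le hmx
  have hmy0 : 0 < max y r := hr.trans_le hmy
  have hmm : |max y r - max x r| ≤ |x - y| := by
    rw [abs_sub_comm]; exact abs_max_sub_max_le_abs _ _ _
  have e : pairDensity r x - pairDensity r y =
      (logKernel r (1 - x) - logKernel r (1 - y)) / max x r +
      logKernel r (1 - y) * (max y r - max x r) / (max x r * max y r) := by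
    unfold pairDensity
    field_simp
    ring
  rw [e]
  refine (abs_add_le _ _).trans ?_
  rw [abs_div, abs_div, abs_mul, abs_of_pos hmx0, abs_of_nonneg (logKernel_nonneg _ _),
    abs_of_pos (mul_pos hmx0 hmy0)]
  have h2 : |logKernel r (1 - x) - logKernel r (1 - y)| / max x r ≤ B * √|x - y| / r := by
    gcongr
  have h3 : logKernel r (1 - y) * |max y r - max x r| / (max x r * max y r) ≤
      B * √|x - y| / r ^ 2 := by
    rw [sq]
    gcongr
    · exact logKernel_le r (by linarith) (by linarith)
    · exact hmm.trans h1
  calc _ ≤ _ := add_le_add h2 h3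
    _ = _ := by ring

lemma integral_pairDensity_eq_I2 {r : ℝ} (hr : 0 < r) (hr1 : r ≤ 1) :
    ∫ x in r..1, pairDensity r x = I2 r := by
  have h_int : ∀ a b : ℝ, IntervalIntegrable (pairDensity r) volume a b :=
    fun a b => (continuous_pairDensity hr).intervalIntegrable a b
  have hm1 : max r (1 - r) ≤ 1 := max_le hr1 (by linarith)
  rw [← intervalIntegral.integral_add_adjacent_intervals (h_int r (max r (1 - r))) (h_int _ _)]
  have h1 : ∫ x in r..max r (1 - r), pairDensity r x = 0 := by
    rcases le_total (1 - r) r with h | h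
    · rw [max_eq_left h, intervalIntegral.integral_same]
    rw [max_eq_right h, ← intervalIntegral.integral_zero (a := r) (b := 1 - r) (μ := volume)]
    refine intervalIntegral.integral_congr fun x hx => ?_
    rw [uIcc_of_le h] at hx
    change pairDensity r x = 0
    rw [pairDensity, logKernel_eq hr (by linarith [hx.2]), max_eq_left, mul_zero, zero_div]
    exact log_nonpos (div_nonneg hr.le (by linarith [hx.2]))
      (div_le_one_of_le₀ (by linarith [hx.2]) (by linarith [hx.2]))
  rw [h1, zero_add, I2]
  refine intervalIntegral.integral_congr fun x hx => ?_
  rw [uIcc_of_le hm1] at hx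
  have hxr : r ≤ x := (le_max_left _ _).trans hx.1
  have hx1r : 1 - r ≤ x := (le_max_right _ _).trans hx.1
  change pairDensity r x = (1 - x) / x * log (r / (1 - x))
  rw [pairDensity, logKernel_eq hr (by linarith [hx.2]), max_eq_left hxr]
  rcases hx.2.eq_or_lt with rfl | hx2
  · simp
  · rw [max_eq_right]
    · ring
    · exact log_nonneg ((one_le_div (by linarith)).2 (by linarith))

lemma exists_sum_pairDensity_sub_I2_le {r : ℝ} (hr : 0 < r) (hr1 : r ≤ 1) :
    ∃ C, 0 ≤ C ∧ ∀ Q : ℕ, 1 ≤ Q →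
      |∑ n ∈ Finset.Ico ⌊r * Q⌋₊ Q, 1 / (Q : ℝ) * pairDensity r ((n + 1 : ℕ) / Q) - I2 r| ≤
        C * √(1 / (Q : ℝ)) := by
  obtain ⟨C, hC0, hC⟩ := exists_abs_pairDensity_sub_le hr
  set B := (|log r| + 2) / r with hB
  have hB0 : 0 ≤ B := by positivity
  refine ⟨C + B, by positivity, fun Q hQ => ?_⟩
  have hQ0 : (0 : ℝ) < Q := by exact_mod_cast hQ
  set N := ⌊r * Q⌋₊ with hN
  have hNr : (N : ℝ) ≤ r * Q := Nat.floor_le (by positivity)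
  have hNr' : r * Q < N + 1 := Nat.lt_floor_add_one _
  have hNQ : N ≤ Q := by
    have : (N : ℝ) ≤ Q := hNr.trans (mul_le_of_le_one_left hQ0.le hr1)
    exact_mod_cast this
  have hcont := continuous_pairDensity hr
  have h_int : ∀ a b : ℝ, IntervalIntegrable (pairDensity r) volume a b :=
    fun a b => hcont.intervalIntegrable a b
  have hsplit : ∑ n ∈ Finset.Ico N Q, ∫ x in ((n : ℕ) : ℝ) / Q..((n + 1 : ℕ) : ℝ) / Q,
      pairDensity r x = ∫ x in (N : ℝ) / Q..(Q : ℝ) / Q, pairDensity r x :=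
    intervalIntegral.sum_integral_adjacent_intervals_Ico (a := fun n : ℕ => (n : ℝ) / Q) hNQ
      fun k _ => h_int _ _
  have hcell : ∀ n ∈ Finset.Ico N Q, |1 / (Q : ℝ) * pairDensity r ((n + 1 : ℕ) / Q) -
      ∫ x in ((n : ℕ) : ℝ) / Q..((n + 1 : ℕ) : ℝ) / Q, pairDensity r x| ≤
        C * √(1 / (Q : ℝ)) * (1 / Q) := by
    intro n hn
    rw [Finset.mem_Ico] at hn
    have hn1 : ((n + 1 : ℕ) : ℝ) ≤ Q := by exact_mod_cast hn.2
    have hlen : ((n + 1 : ℕ) : ℝ) / Q - (n : ℝ) / Q = 1 / Q := by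
      rw [← sub_div]; push_cast; ring
    have hle : (n : ℝ) / Q ≤ ((n + 1 : ℕ) : ℝ) / Q := by
      gcongr; omega
    have hconst : 1 / (Q : ℝ) * pairDensity r ((n + 1 : ℕ) / Q) =
        ∫ _ in ((n : ℕ) : ℝ) / Q..((n + 1 : ℕ) : ℝ) / Q, pairDensity r ((n + 1 : ℕ) / Q) := by
      rw [intervalIntegral.integral_const, hlen, smul_eq_mul]
    rw [hconst, ← intervalIntegral.integral_sub (by simp) (h_int _ _)]
    have := intervalIntegral.norm_integral_le_of_norm_le_const
      (a := (n : ℝ) / Q) (b := ((n + 1 : ℕ) : ℝ) / Q) (C := C * √(1 / (Q : ℝ)))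
      (f := fun x => pairDensity r ((n + 1 : ℕ) / Q) - pairDensity r x) (fun x hx => by
        rw [uIoc_of_le hle] at hx
        have hx0 : 0 ≤ x := le_trans (by positivity) hx.1.le
        have hn1' : ((n + 1 : ℕ) : ℝ) / Q ≤ 1 := (div_le_one hQ0).2 hn1
        rw [norm_eq_abs]
        refine (hC _ _ (by positivity) hn1' hx0 (hx.2.trans hn1')).trans ?_
        gcongr
        rw [abs_of_nonneg (by linarith [hx.2])]
        linarith [hx.1])
    rwa [norm_eq_abs, hlen, abs_of_pos (by positivity : (0 : ℝ) < 1 / Q)] at this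
  have h1 : |∑ n ∈ Finset.Ico N Q, 1 / (Q : ℝ) * pairDensity r ((n + 1 : ℕ) / Q) -
      ∫ x in (N : ℝ) / Q..(Q : ℝ) / Q, pairDensity r x| ≤ C * √(1 / (Q : ℝ)) := by
    rw [← hsplit, ← Finset.sum_sub_distrib]
    refine (Finset.abs_sum_le_sum_abs _ _).trans ((Finset.sum_le_sum hcell).trans ?_)
    rw [Finset.sum_const, Nat.card_Ico, nsmul_eq_mul]
    have : ((Q - N : ℕ) : ℝ) ≤ Q := by exact_mod_cast Nat.sub_le _ _
    calc _ ≤ (Q : ℝ) * (C * √(1 / (Q : ℝ)) * (1 / Q)) := by gcongr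
      _ = _ := by field_simp
  have hI := integral_pairDensity_eq_I2 hr hr1
  rw [← intervalIntegral.integral_add_adjacent_intervals (h_int _ r) (h_int _ _),
    div_self hQ0.ne', hI] at h1
  have hNQr : (N : ℝ) / Q ≤ r := (div_le_iff₀ hQ0).2 hNr
  have h2 : |∫ x in (N : ℝ) / Q..r, pairDensity r x| ≤ B * √(1 / (Q : ℝ)) := by
    have := intervalIntegral.norm_integral_le_of_norm_le_const
      (a := (N : ℝ) / Q) (b := r) (C := B) (f := pairDensity r) (fun x hx => by
        rw [uIoc_of_le hNQr] at hx
        have hx0 : 0 ≤ x := le_trans (by positivity) hx.1.le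
        rw [norm_eq_abs, abs_of_nonneg (pairDensity_nonneg hr x)]
        exact pairDensity_le hr hx0 (hx.2.trans hr1))
    rw [norm_eq_abs] at this
    refine this.trans ?_
    gcongr
    have h3 : |r - N / Q| ≤ 1 / Q := by
      rw [abs_of_nonneg (by linarith), sub_le_iff_le_add, ← add_div, le_div_iff₀ hQ0]
      linarith
    refine h3.trans (Real.le_sqrt_of_sq_le ?_)
    have : 1 / (Q : ℝ) ≤ 1 := (div_le_one hQ0).2 (by exact_mod_cast hQ)
    have : 0 ≤ 1 / (Q : ℝ) := by positivity
    nlinarith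
  rw [abs_le] at h1 h2 ⊢
  constructor <;> linarith [h1.1, h1.2, h2.1, h2.2]

lemma sum_Ioc_inv_le_log {a b : ℕ} (ha : 1 ≤ a) (hab : a ≤ b) :
    ∑ m ∈ Finset.Ioc a b, 1 / (m : ℝ) ≤ log ((b : ℝ) / a) := by
  have ha0 : (0 : ℝ) < a := by exact_mod_cast ha
  induction b, hab using Nat.le_induction with
  | base => simp [div_self ha0.ne']
  | succ b hab ih =>
    have hb0 : (0 : ℝ) < b := ha0.trans_le (by exact_mod_cast hab)
    rw [← Finset.insert_Ioc_right_eq_Ioc_add_one hab, Finset.sum_insert (by simp)]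
    have h := log_le_sub_one_of_pos (by positivity : 0 < (b : ℝ) / (b + 1 : ℕ))
    have e : (b : ℝ) / (b + 1 : ℕ) - 1 = -(1 / ((b + 1 : ℕ) : ℝ)) := by
      push_cast; field_simp; ring
    rw [e, log_div hb0.ne' (by positivity)] at h
    rw [log_div hb0.ne' ha0.ne'] at ih
    rw [log_div (by positivity) ha0.ne']
    linarith

lemma log_le_sum_Ioc_inv {a b : ℕ} (hab : a ≤ b) :
    log (((b : ℝ) + 1) / (a + 1)) ≤ ∑ m ∈ Finset.Ioc a b, 1 / (m : ℝ) := by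
  induction b, hab using Nat.le_induction with
  | base => simp [div_self (by positivity : (a : ℝ) + 1 ≠ 0)]
  | succ b hab ih =>
    rw [← Finset.insert_Ioc_right_eq_Ioc_add_one hab, Finset.sum_insert (by simp)]
    have h := log_le_sub_one_of_pos (by positivity : 0 < ((b : ℝ) + 1 + 1) / (b + 1))
    have e : ((b : ℝ) + 1 + 1) / (b + 1) - 1 = 1 / (b + 1) := by field_simp; ring
    rw [e, log_div (by positivity) (by positivity)] at h
    rw [log_div (by positivity) (by positivity)] at ih
    push_cast
    rw [log_div (by positivity) (by positivity)]
    linarith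

lemma abs_sum_Ioc_inv_sub_log_le {x : ℝ} (hx : 0 < x) {M : ℕ} (hM : 1 ≤ M) :
    |∑ m ∈ Finset.Ioc M ⌊x⌋₊, 1 / (m : ℝ) - max 0 (log (x / M))| ≤ 1 / M := by
  have hM0 : (0 : ℝ) < M := by exact_mod_cast hM
  have hfl : (⌊x⌋₊ : ℝ) ≤ x := Nat.floor_le hx.le
  have hfl' : x < ⌊x⌋₊ + 1 := Nat.lt_floor_add_one _
  rcases le_or_gt M ⌊x⌋₊ with h | h
  · have hMN : (M : ℝ) ≤ ⌊x⌋₊ := by exact_mod_cast h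
    have h1 := sum_Ioc_inv_le_log hM h
    have h2 := log_le_sum_Ioc_inv h
    have h3 : log ((⌊x⌋₊ : ℝ) / M) ≤ log (x / M) := by
      apply log_le_log (div_pos (hM0.trans_le hMN) hM0); gcongr
    have h4 : log (x / M) ≤ log (((⌊x⌋₊ : ℝ) + 1) / (M + 1)) + 1 / M := by
      have h5 := log_le_sub_one_of_pos (by positivity : 0 < ((M : ℝ) + 1) / M)
      have e : ((M : ℝ) + 1) / M - 1 = 1 / M := by field_simp; ring
      rw [e, log_div (by positivity) hM0.ne'] at h5
      rw [log_div hx.ne' hM0.ne', log_div (by positivity) (by positivity)]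
      linarith [log_le_log hx hfl'.le]
    rw [max_eq_right (log_nonneg ((one_le_div hM0).2 (hMN.trans hfl))), abs_le]
    constructor <;> linarith [show 0 ≤ 1 / (M : ℝ) by positivity]
  · have : x < M := (Nat.floor_lt hx.le).1 h
    rw [Finset.Ioc_eq_empty_of_le h.le, Finset.sum_empty,
      max_eq_left (log_nonpos (by positivity) ((div_le_one hM0).2 this.le))]
    simp

lemma exists_sum_localDensity_div_sub_le {l : ℕ} (hl : 0 < l) :
    ∃ C, 0 ≤ C ∧ ∀ M N : ℕ,
      |∑ m ∈ Finset.Ioc M N, 1 / (m : ℝ) * localDensity l m -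
        Aconst l * ∑ m ∈ Finset.Ioc M N, 1 / (m : ℝ)| ≤ C * √N / (M + 1) := by
  obtain ⟨C, hC0, hC⟩ := exists_sum_localDensity_sub_le hl
  refine ⟨2 * C, by positivity, fun M N => ?_⟩
  have hpart : ∀ k : ℕ, k ≤ N →
      |∑ m ∈ Finset.Ico 1 (k + 1), (localDensity l m - Aconst l)| ≤ C * √N := by
    intro k hk
    have h := hC k
    have e : ∑ m ∈ Finset.Ico 1 (k + 1), (localDensity l m - Aconst l) =
        ∑ m ∈ Finset.Ioc 0 k, localDensity l m - Aconst l * k := by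
      rw [Finset.sum_sub_distrib, Finset.sum_const, Nat.card_Ico, nsmul_eq_mul]
      have : Finset.Ico 1 (k + 1) = Finset.Ioc 0 k := by
        ext x; simp only [Finset.mem_Ioc, Finset.mem_Ico]; omega
      rw [this, Nat.add_sub_cancel, mul_comm]
    rw [e]
    refine h.trans ?_
    gcongr
  have hE : ∀ s t : ℕ, M + 1 ≤ s → s ≤ t → t ≤ N + 1 →
      |∑ m ∈ Finset.Ico s t, (localDensity l m - Aconst l)| ≤ 2 * C * √N := by
    intro s t hs hst ht
    have h1 := hpart (t - 1) (by omega)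
    have h2 := hpart (s - 1) (by omega)
    rw [Nat.sub_add_cancel (by omega)] at h1 h2
    have h3 := Finset.sum_Ico_consecutive (fun m => localDensity l m - Aconst l)
      (by omega : 1 ≤ s) hst
    rw [abs_le] at h1 h2 ⊢
    constructor <;> linarith [h1.1, h1.2, h2.1, h2.2]
  have hIco : Finset.Ioc M N = Finset.Ico (M + 1) (N + 1) := by
    ext x; simp only [Finset.mem_Ioc, Finset.mem_Ico]; omega
  have h := abs_sum_mul_le_of_antitoneOn (f := fun m : ℕ => 1 / (m : ℝ))
    (a := fun m => localDensity l m - Aconst l) (A := M + 1) (B := N + 1)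
    (E := 2 * C * √N) (F := 1 / ((M + 1 : ℕ) : ℝ)) (by positivity) (by positivity) hE
    (fun x hx y _ hxy => by
      rw [Finset.coe_Ico, Set.mem_Ico] at hx
      have : (0 : ℝ) < x := by exact_mod_cast (by omega : 0 < x)
      exact one_div_le_one_div_of_le this (by exact_mod_cast hxy))
    (fun i _ => by positivity)
    (fun i hi => by
      rw [Finset.mem_Ico] at hi
      exact one_div_le_one_div_of_le (by positivity) (by exact_mod_cast hi.1))
  rw [hIco, Finset.mul_sum, ← Finset.sum_sub_distrib]
  calc _ = |∑ m ∈ Finset.Ico (M + 1) (N + 1), 1 / (m : ℝ) * (localDensity l m - Aconst l)| := by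
        congr 1
        exact Finset.sum_congr rfl fun m _ => by ring
    _ ≤ _ := h
    _ = _ := by push_cast; ring

lemma exists_sum_localDensity_sub_I2_le {l : ℕ} (hl : 0 < l) {r : ℝ} (hr : 0 < r)
    (hr1 : r ≤ 1) :
    ∃ C, 0 ≤ C ∧ ∀ Q : ℕ, 1 ≤ Q →
      |∑ m ∈ Finset.Icc 1 ⌊r * Q⌋₊, 1 / (m : ℝ) * (localDensity l m *
        ∑ n ∈ Finset.Ico (max ⌊r * Q⌋₊ (Q - m) + 1) (Q + 1), (1 / (n : ℝ) - 1 / Q)) -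
          Aconst l * I2 r| ≤ C * √(1 / (Q : ℝ)) := by
  obtain ⟨C, hC0, hC⟩ := exists_sum_localDensity_div_sub_le hl
  obtain ⟨C', hC0', hC'⟩ := exists_sum_pairDensity_sub_I2_le hr hr1
  refine ⟨(C + |Aconst l|) / r + |Aconst l| * C', by positivity, fun Q hQ => ?_⟩
  have hQ0 : (0 : ℝ) < Q := by exact_mod_cast hQ
  have hQ1 : (1 : ℝ) ≤ Q := by exact_mod_cast hQ
  specialize hC' Q hQ
  set N := ⌊r * Q⌋₊ with hN
  have hNr : (N : ℝ) ≤ r * Q := Nat.floor_le (by positivity)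
  have hNr' : r * Q < N + 1 := Nat.lt_floor_add_one _
  have hNQ' : (N : ℝ) ≤ Q := hNr.trans (mul_le_of_le_one_left hQ0.le hr1)
  have hNQ : N ≤ Q := by exact_mod_cast hNQ'
  have hswap : ∑ m ∈ Finset.Icc 1 N, 1 / (m : ℝ) * (localDensity l m *
        ∑ n ∈ Finset.Ico (max N (Q - m) + 1) (Q + 1), (1 / (n : ℝ) - 1 / Q)) =
      ∑ n ∈ Finset.Ico N Q, (1 / ((n + 1 : ℕ) : ℝ) - 1 / Q) *
        ∑ m ∈ Finset.Ioc (Q - (n + 1)) N, 1 / (m : ℝ) * localDensity l m := by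
    calc _ = ∑ m ∈ Finset.Icc 1 N, ∑ n ∈ Finset.Ico (max N (Q - m)) Q,
          (1 / ((n + 1 : ℕ) : ℝ) - 1 / Q) * (1 / (m : ℝ) * localDensity l m) := by
          refine Finset.sum_congr rfl fun m _ => ?_
          rw [← Finset.sum_Ico_add' (fun n : ℕ => 1 / (n : ℝ) - 1 / Q) _ _ 1, ← mul_assoc,
            Finset.mul_sum]
          exact Finset.sum_congr rfl fun n _ => mul_comm _ _
      _ = ∑ n ∈ Finset.Ico N Q, ∑ m ∈ Finset.Ioc (Q - (n + 1)) N,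
          (1 / ((n + 1 : ℕ) : ℝ) - 1 / Q) * (1 / (m : ℝ) * localDensity l m) := by
          refine Finset.sum_comm' fun m n => ?_
          simp only [Finset.mem_Icc, Finset.mem_Ico, Finset.mem_Ioc]
          omega
      _ = _ := Finset.sum_congr rfl fun n _ => (Finset.mul_sum _ _ _).symm
  have hterm : ∀ n ∈ Finset.Ico N Q, |(1 / ((n + 1 : ℕ) : ℝ) - 1 / Q) *
      ∑ m ∈ Finset.Ioc (Q - (n + 1)) N, 1 / (m : ℝ) * localDensity l m -
        Aconst l * (1 / (Q : ℝ) * pairDensity r ((n + 1 : ℕ) / Q))| ≤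
      (C + |Aconst l|) / r * √Q / (Q * Q) := by
    intro n hn
    rw [Finset.mem_Ico] at hn
    obtain ⟨M, hM⟩ : ∃ M, M = Q - (n + 1) := ⟨_, rfl⟩
    have hMQ : (Q : ℝ) = M + (n + 1 : ℕ) := by
      exact_mod_cast (by omega : Q = M + (n + 1))
    have hn0 : (0 : ℝ) < (n + 1 : ℕ) := by positivity
    have hrn : r * Q ≤ (n + 1 : ℕ) := by
      refine hNr'.le.trans ?_
      exact_mod_cast (by omega : N + 1 ≤ n + 1)
    have hv : 1 / ((n + 1 : ℕ) : ℝ) - 1 / Q = M / ((n + 1 : ℕ) * Q) := by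
      rw [div_sub_div _ _ hn0.ne' hQ0.ne']
      congr 1
      linarith
    have hp : 1 / (Q : ℝ) * pairDensity r ((n + 1 : ℕ) / Q) =
        M / ((n + 1 : ℕ) * Q) * max 0 (log (r * Q / M)) := by
      have h1 : 1 - ((n + 1 : ℕ) : ℝ) / Q = M / Q := by
        rw [eq_div_iff hQ0.ne', sub_mul, div_mul_cancel₀ _ hQ0.ne']; linarith
      have h2 : r / ((M : ℝ) / Q) = r * Q / M := by rw [div_div_eq_mul_div]
      rw [pairDensity, h1, logKernel_eq hr (by positivity), h2,
        max_eq_left ((le_div_iff₀ hQ0).2 hrn)]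
      field_simp
    rw [hv, hp, ← hM]
    rcases Nat.eq_zero_or_pos M with h0 | hMpos
    · rw [h0]; simp only [Nat.cast_zero, zero_div, zero_mul, mul_zero, sub_zero, abs_zero]
      positivity
    have hM0 : (0 : ℝ) < M := by exact_mod_cast hMpos
    have e1 := hC M N
    have e2 := abs_sum_Ioc_inv_sub_log_le (mul_pos hr hQ0) hMpos
    rw [← hN] at e2
    set X := ∑ m ∈ Finset.Ioc M N, 1 / (m : ℝ) * localDensity l m
    set Y := ∑ m ∈ Finset.Ioc M N, 1 / (m : ℝ)
    set L := max 0 (log (r * Q / M))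
    have hsN : √(N : ℝ) ≤ √Q := sqrt_le_sqrt hNQ'
    have hsQ : 1 ≤ √(Q : ℝ) := one_le_sqrt.2 hQ1
    have e3 : |X - Aconst l * L| ≤ (C + |Aconst l|) * √Q / M := by
      calc |X - Aconst l * L| = |(X - Aconst l * Y) + Aconst l * (Y - L)| := by congr 1; ring
        _ ≤ C * √N / (M + 1) + |Aconst l| * (1 / M) := by
          refine (abs_add_le _ _).trans (add_le_add e1 ?_)
          rw [abs_mul]
          gcongr
        _ ≤ C * √Q / M + |Aconst l| * (√Q / M) := by
          gcongr
          linarith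
        _ = _ := by ring
    calc _ = M / ((n + 1 : ℕ) * Q) * |X - Aconst l * L| := by
          rw [← abs_of_pos (by positivity : 0 < (M : ℝ) / ((n + 1 : ℕ) * Q)), ← abs_mul,
            abs_of_pos (by positivity : 0 < (M : ℝ) / ((n + 1 : ℕ) * Q))]
          congr 1; ring
      _ ≤ M / ((n + 1 : ℕ) * Q) * ((C + |Aconst l|) * √Q / M) := by gcongr
      _ = (C + |Aconst l|) * √Q / ((n + 1 : ℕ) * Q) := by field_simp
      _ ≤ (C + |Aconst l|) * √Q / (r * Q * Q) := by gcongr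
      _ = _ := by field_simp
  have hsq : √(1 / (Q : ℝ)) = √Q / Q := by
    rw [sqrt_div zero_le_one, sqrt_one, one_div, Real.sqrt_div_self]
  have h1 : |∑ n ∈ Finset.Ico N Q, (1 / ((n + 1 : ℕ) : ℝ) - 1 / Q) *
        ∑ m ∈ Finset.Ioc (Q - (n + 1)) N, 1 / (m : ℝ) * localDensity l m -
      Aconst l * ∑ n ∈ Finset.Ico N Q, 1 / (Q : ℝ) * pairDensity r ((n + 1 : ℕ) / Q)| ≤
        (C + |Aconst l|) / r * √(1 / (Q : ℝ)) := by
    rw [Finset.mul_sum, ← Finset.sum_sub_distrib]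
    refine (Finset.abs_sum_le_sum_abs _ _).trans ((Finset.sum_le_sum hterm).trans ?_)
    rw [Finset.sum_const, Nat.card_Ico, nsmul_eq_mul]
    have : ((Q - N : ℕ) : ℝ) ≤ Q := by exact_mod_cast Nat.sub_le _ _
    calc _ ≤ (Q : ℝ) * ((C + |Aconst l|) / r * √Q / (Q * Q)) := by gcongr
      _ = (C + |Aconst l|) / r * (√Q / Q) := by field_simp
      _ = _ := by rw [hsq]
  rw [hswap]
  set Z := ∑ n ∈ Finset.Ico N Q, 1 / (Q : ℝ) * pairDensity r ((n + 1 : ℕ) / Q)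
  refine (abs_sub_le _ (Aconst l * Z) _).trans ?_
  rw [add_mul]
  refine add_le_add h1 ?_
  rw [← mul_sub, abs_mul, mul_assoc]
  gcongr

/-- Pairs `(1 - γ, 1 - γ')` of reflected neighbouring Farey fractions, with the fraction of small
denominator first and orientation `s`. -/
structure IsReflectedPair (l Q N : ℕ) (s : ℤˣ) (J : Set ℝ) (p : ℚ × ℚ) : Prop where
  fst_nonneg : 0 ≤ p.1
  fst_lt_one : p.1 < 1
  snd_nonneg : 0 ≤ p.2
  snd_lt_one : p.2 < 1
  det_eq : p.1.num * p.2.den - p.2.num * p.1.den = s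
  fst_den_le : p.1.den ≤ N
  lt_snd_den : N < p.2.den
  snd_den_le : p.2.den ≤ Q
  lt_den_add_den : Q < p.1.den + p.2.den
  not_dvd_fst : ¬ (l : ℤ) ∣ p.1.num
  not_dvd_snd : ¬ (l : ℤ) ∣ p.2.num
  fst_mem : (p.1 : ℝ) ∈ J
  snd_mem : (p.2 : ℝ) ∈ J

/-- The pair of fractions `(b / m, c / n)` with `b n - c m = s`. -/
def pairOfIndex (s : ℤˣ) (x : (_ : ℕ) × (ℕ × ℕ)) : ℚ × ℚ :=
  (((x.2.1 : ℤ) : ℚ) / ((x.1 : ℤ) : ℚ),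
    ((((x.2.1 : ℤ) * x.2.2 - s) / x.1 : ℤ) : ℚ) / ((x.2.2 : ℤ) : ℚ))

lemma isCoprime_of_mul_sub_mul_eq_unit {a b c d : ℤ} {s : ℤˣ} (h : a * b - c * d = s) :
    IsCoprime a d ∧ IsCoprime c b := by
  have hs : (s : ℤ) * s = 1 := by
    rw [← Units.val_mul, Int.units_mul_self, Units.val_one]
  exact ⟨⟨s * b, -(s * c), by linear_combination (s : ℤ) * h + hs⟩,
    ⟨-(s * d), s * a, by linear_combination (s : ℤ) * h + hs⟩⟩

lemma pairOfIndex_spec {l m N Q b n : ℕ} {s : ℤˣ} (hm : 1 ≤ m) (hmN : m ≤ N)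
    (hp : (b, n) ∈ neighbourPairs l m (max N (Q - m) + 1) (Q + 1) s) :
    ∃ c : ℤ, (b : ℤ) * n - c * m = s ∧ 0 ≤ c ∧ c < n ∧ ¬ (l : ℤ) ∣ c ∧
      pairOfIndex s ⟨m, b, n⟩ = (((b : ℤ) : ℚ) / ((m : ℤ) : ℚ), (c : ℚ) / ((n : ℤ) : ℚ)) ∧
      (pairOfIndex s ⟨m, b, n⟩).1.num = b ∧ (pairOfIndex s ⟨m, b, n⟩).1.den = m ∧
      (pairOfIndex s ⟨m, b, n⟩).2.num = c ∧ (pairOfIndex s ⟨m, b, n⟩).2.den = n := by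
  obtain ⟨⟨h1, h2, h3⟩, ⟨c, hc⟩, h5, h6⟩ := mem_neighbourPairs.1 hp
  simp only at h1 h2 h3 hc h5 h6
  have hm0 : (0 : ℤ) < m := by exact_mod_cast hm
  have hn2 : (2 : ℤ) ≤ n := by exact_mod_cast (by omega : 2 ≤ n)
  have hb1 : (1 : ℤ) ≤ b := by
    rcases Nat.eq_zero_or_pos b with h | h
    · simp [h] at h5
    · exact_mod_cast h
  have hbm : (b : ℤ) + 1 ≤ m := by exact_mod_cast h1
  have hs : (s : ℤ) = 1 ∨ (s : ℤ) = -1 := by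
    rcases Int.units_eq_one_or s with h | h <;> simp [h]
  have hdet : (b : ℤ) * n - c * m = s := by linarith
  obtain ⟨hcop1, hcop2⟩ := isCoprime_of_mul_sub_mul_eq_unit hdet
  rw [Int.isCoprime_iff_nat_coprime] at hcop1 hcop2
  have hpair : pairOfIndex s ⟨m, b, n⟩ =
      (((b : ℤ) : ℚ) / ((m : ℤ) : ℚ), (c : ℚ) / ((n : ℤ) : ℚ)) := by
    simp only [pairOfIndex]
    rw [hc, Int.mul_ediv_cancel_left _ hm0.ne']
  refine ⟨c, hdet, ?_, ?_, ?_, hpair, ?_, ?_, ?_, ?_⟩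
  · by_contra! hneg
    have : (m : ℤ) * c ≤ m * (-1) := mul_le_mul_of_nonneg_left (by omega) hm0.le
    have : (1 : ℤ) * n ≤ b * n := mul_le_mul_of_nonneg_right hb1 (by omega)
    omega
  · by_contra! hge
    have : (m : ℤ) * n ≤ m * c := mul_le_mul_of_nonneg_left hge hm0.le
    have : ((b : ℤ) + 1) * n ≤ m * n := mul_le_mul_of_nonneg_right hbm (by omega)
    rw [add_mul, one_mul] at this
    omega
  · intro h
    apply h6
    rw [hc, Nat.cast_mul, mul_comm (l : ℤ)]
    exact mul_dvd_mul_left _ h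
  · rw [hpair]; exact Rat.num_div_eq_of_coprime hm0 hcop1
  · rw [hpair]; exact_mod_cast Rat.den_div_eq_of_coprime hm0 hcop1
  · rw [hpair]; exact Rat.num_div_eq_of_coprime (by omega) hcop2
  · rw [hpair]; exact_mod_cast Rat.den_div_eq_of_coprime (by omega : (0 : ℤ) < n) hcop2

lemma neighbourCoord_eq {m b n : ℕ} {s : ℤˣ} {c : ℤ} (hm : m ≠ 0) (hn : n ≠ 0)
    (h : (b : ℤ) * n - c * m = s) : neighbourCoord m s (b, n) = c / n := by
  have h' : (b : ℝ) * n - c * m = (s : ℤ) := by exact_mod_cast congrArg (Int.cast (R := ℝ)) h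
  have : (m : ℝ) ≠ 0 := by exact_mod_cast hm
  have : (n : ℝ) ≠ 0 := by exact_mod_cast hn
  rw [neighbourCoord, ← h']
  field_simp
  ring

lemma tsum_isReflectedPair_eq (l Q N : ℕ) (s : ℤˣ) (J : Set ℝ) (ε : ℝ) :
    ∑' p : {p : ℚ × ℚ // IsReflectedPair l Q N s J p},
      (1 - ε * (p.1.2.den : ℝ)) / ((p.1.1.den : ℝ) * p.1.2.den * (1 + (1 - (p.1.2 : ℝ)) ^ 2)) =
    ∑ m ∈ Finset.Icc 1 N, 1 / (m : ℝ) *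
      neighbourSum l m (max N (Q - m) + 1) (Q + 1) s J ε := by
  classical
  set P : Finset ((_ : ℕ) × (ℕ × ℕ)) := (Finset.Icc 1 N).sigma fun m =>
    (neighbourPairs l m (max N (Q - m) + 1) (Q + 1) s).filter fun p =>
      (1 / m * p.1 : ℝ) ∈ J ∧ neighbourCoord m s p ∈ J with hP
  have hmemP : ∀ m b n, (⟨m, b, n⟩ : (_ : ℕ) × (ℕ × ℕ)) ∈ P ↔ (1 ≤ m ∧ m ≤ N) ∧
      (b, n) ∈ neighbourPairs l m (max N (Q - m) + 1) (Q + 1) s ∧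
        (1 / m * b : ℝ) ∈ J ∧ neighbourCoord m s (b, n) ∈ J := fun m b n => by
    rw [hP, Finset.mem_sigma, Finset.mem_filter, Finset.mem_Icc]
  have hinj : Set.InjOn (pairOfIndex s) (P : Set ((_ : ℕ) × (ℕ × ℕ))) := by
    rintro ⟨m, b, n⟩ hx ⟨m', b', n'⟩ hx' h
    rw [Finset.mem_coe, hmemP] at hx hx'
    obtain ⟨c, -, -, -, -, -, h1, h2, h3, h4⟩ := pairOfIndex_spec hx.1.1 hx.1.2 hx.2.1
    obtain ⟨c', -, -, -, -, -, h1', h2', h3', h4'⟩ := pairOfIndex_spec hx'.1.1 hx'.1.2 hx'.2.1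
    rw [← h] at h1' h2' h4'
    have e1 : m = m' := h2.symm.trans h2'
    have e2 : b = b' := by exact_mod_cast h1.symm.trans h1'
    have e3 : n = n' := h4.symm.trans h4'
    rw [e1, e2, e3]
  have hset : {p : ℚ × ℚ | IsReflectedPair l Q N s J p} =
      ((P.image (pairOfIndex s) : Finset (ℚ × ℚ)) : Set (ℚ × ℚ)) := by
    ext ⟨x, y⟩
    rw [Set.mem_ofPred_eq, Finset.mem_coe, Finset.mem_image]
    constructor
    · intro h
      have hb0 : 0 ≤ x.num := Rat.num_nonneg.2 h.fst_nonneg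
      have hbm : x.num < x.den := Rat.num_lt_denom_iff.2 h.fst_lt_one
      obtain ⟨b, hb⟩ := Int.eq_ofNat_of_zero_le hb0
      have hdet := h.det_eq
      have hd1 := h.fst_den_le
      have hd2 := h.lt_snd_den
      have hd3 := h.snd_den_le
      have hd4 := h.lt_den_add_den
      have hl1 := h.not_dvd_fst
      have hl2 := h.not_dvd_snd
      have hJ1 := h.fst_mem
      have hJ2 := h.snd_mem
      simp only at hdet hd1 hd2 hd3 hd4 hl1 hl2 hJ1 hJ2
      rw [hb] at hdet hl1 hbm
      have hm0 : (x.den : ℤ) ≠ 0 := by exact_mod_cast x.den_nz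
      have hquot : (b : ℤ) * y.den - s = x.den * y.num := by linear_combination hdet
      refine ⟨⟨x.den, b, y.den⟩, (hmemP _ _ _).2 ⟨⟨x.pos, hd1⟩, mem_neighbourPairs.2
        ⟨⟨by exact_mod_cast hbm, by simp only; omega, by simp only; omega⟩,
          ⟨y.num, hquot⟩, hl1, ?_⟩, ?_, ?_⟩, ?_⟩
      · simp only
        rw [hquot, Nat.cast_mul, mul_comm (l : ℤ)]
        exact fun hdv => hl2 (Int.dvd_of_mul_dvd_mul_left hm0 hdv)
      · rw [one_div_mul_eq_div]
        rwa [Rat.cast_def, hb, Int.cast_natCast] at hJ1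
      · rw [neighbourCoord_eq x.den_nz y.den_nz hdet]
        rwa [Rat.cast_def] at hJ2
      · simp only [pairOfIndex]
        rw [hquot, Int.mul_ediv_cancel_left _ hm0, ← hb]
        exact Prod.ext (Rat.num_div_den x) (Rat.num_div_den y)
    · rintro ⟨⟨m, b, n⟩, hx, hxy⟩
      rw [hmemP] at hx
      obtain ⟨c, hdet, hc0, hcn, hlc, hpair, h1, h2, h3, h4⟩ :=
        pairOfIndex_spec hx.1.1 hx.1.2 hx.2.1
      rw [hxy] at hpair h1 h2 h3 h4
      obtain ⟨⟨hbm, hn1, hn2⟩, -, hlb, -⟩ := mem_neighbourPairs.1 hx.2.1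
      simp only at hbm hn1 hn2 hlb h1 h2 h3 h4
      have hx0 := x.num_div_den
      have hy0 := y.num_div_den
      have hm0 : (0 : ℚ) < m := by exact_mod_cast hx.1.1
      have hn0 : (0 : ℚ) < n := by exact_mod_cast (by omega : 0 < n)
      rw [h1, h2] at hx0
      rw [h3, h4] at hy0
      refine ⟨?_, ?_, ?_, ?_, ?_, ?_, ?_, ?_, ?_, ?_, ?_, ?_, ?_⟩ <;> simp only
      · exact Rat.num_nonneg.1 (by omega)
      · rw [← hx0, div_lt_one hm0]; exact_mod_cast hbm
      · exact Rat.num_nonneg.1 (by omega)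
      · rw [← hy0, div_lt_one hn0]; exact_mod_cast hcn
      · rw [h1, h2, h3, h4]; exact hdet
      · omega
      · omega
      · omega
      · omega
      · rwa [h1]
      · rwa [h3]
      · have := hx.2.2.1
        rw [one_div_mul_eq_div] at this
        rwa [Rat.cast_def, h1, h2, Int.cast_natCast]
      · have := hx.2.2.2
        rw [neighbourCoord_eq (by omega) (by omega) hdet] at this
        rw [Rat.cast_def, h3, h4]
        exact this
  set f : ℚ × ℚ → ℝ := fun p =>
    (1 - ε * (p.2.den : ℝ)) / ((p.1.den : ℝ) * p.2.den * (1 + (1 - (p.2 : ℝ)) ^ 2)) with hf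
  calc _ = ∑' p : {p : ℚ × ℚ | IsReflectedPair l Q N s J p}, f p := rfl
    _ = ∑ p ∈ P.image (pairOfIndex s), f p := by rw [hset, Finset.tsum_subtype']
    _ = ∑ x ∈ P, f (pairOfIndex s x) := Finset.sum_image hinj
    _ = ∑ m ∈ Finset.Icc 1 N, ∑ p ∈ (neighbourPairs l m (max N (Q - m) + 1) (Q + 1) s).filter
          (fun p => (1 / m * p.1 : ℝ) ∈ J ∧ neighbourCoord m s p ∈ J),
            f (pairOfIndex s ⟨m, p⟩) := Finset.sum_sigma _ _ _
    _ = _ := by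
      refine Finset.sum_congr rfl fun m hm => ?_
      rw [Finset.mem_Icc] at hm
      rw [neighbourSum, ← Finset.sum_filter, Finset.mul_sum]
      refine Finset.sum_congr ?_ ?_
      · ext; simp only [Finset.mem_filter]
      rintro ⟨b, n⟩ hp
      rw [Finset.mem_filter] at hp
      obtain ⟨c, hdet, hc0, hcn, hlc, hpair, h1, h2, h3, h4⟩ :=
        pairOfIndex_spec hm.1 hm.2 hp.1
      have hn0 : n ≠ 0 := by omega
      have hn : (n : ℝ) ≠ 0 := by exact_mod_cast hn0
      have hm' : (m : ℝ) ≠ 0 := by exact_mod_cast (by omega : m ≠ 0)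
      have hy : ((pairOfIndex s ⟨m, b, n⟩).2 : ℝ) = c / n := by
        rw [Rat.cast_def, h3, h4]
      have hpos : 1 + (1 - (c : ℝ) / n) ^ 2 ≠ 0 := by positivity
      rw [neighbourCoord_eq (by omega) hn0 hdet, reflWeight]
      simp only [hf]
      rw [h2, h4, hy]
      generalize 1 + (1 - (c : ℝ) / n) ^ 2 = W at hpos
      field_simp

lemma add_den_le_of_lt_of_lt {x y z : ℚ} (hdet : y.num * x.den - x.num * y.den = 1)
    (hxz : x < z) (hzy : z < y) : x.den + y.den ≤ z.den := by
  rw [Rat.lt_iff] at hxz hzy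
  have hx : (0 : ℤ) < x.den := by exact_mod_cast x.pos
  have hy : (0 : ℤ) < y.den := by exact_mod_cast y.pos
  have h1 : (x.den : ℤ) * 1 ≤ x.den * (y.num * z.den - z.num * y.den) :=
    mul_le_mul_of_nonneg_left (by omega) hx.le
  have h2 : (y.den : ℤ) * 1 ≤ y.den * (z.num * x.den - x.num * z.den) :=
    mul_le_mul_of_nonneg_left (by omega) hy.le
  have h3 : (z.den : ℤ) = x.den * (y.num * z.den - z.num * y.den) +
      y.den * (z.num * x.den - x.num * z.den) := by
    linear_combination -(z.den : ℤ) * hdet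
  zify
  linarith

lemma exists_farey_successor {Q : ℕ} {x : ℚ} (hx0 : 0 < x) (hx1 : x < 1) (hxQ : x.den ≤ Q) :
    ∃ y ∈ FareyQ Q, y.num * x.den - x.num * y.den = 1 ∧ Q < x.den + y.den := by
  obtain ⟨u, v, huv⟩ : IsCoprime x.num x.den := Int.isCoprime_iff_nat_coprime.2 (by
    simpa using x.reduced)
  have ha : 0 < x.num := Rat.num_pos.2 hx0
  have haq : x.num < x.den := Rat.num_lt_denom_iff.2 hx1
  have hq : (0 : ℤ) < x.den := by exact_mod_cast x.pos
  have hqQ : (x.den : ℤ) ≤ Q := by exact_mod_cast hxQ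
  set a := x.num
  set q : ℤ := (x.den : ℤ) with hqdef
  set n : ℤ := Q - (Q + u) % q with hn
  have hr0 := Int.emod_nonneg (Q + u) hq.ne'
  have hr1 := Int.emod_lt_of_pos (Q + u) hq
  have hn0 : 0 < n := by omega
  obtain ⟨k, hk⟩ : q ∣ n + u := by
    have := Int.dvd_self_sub_emod (x := Q + u) (m := q)
    rwa [show (Q : ℤ) + u - (Q + u) % q = n + u by rw [hn]; ring] at this
  obtain ⟨c, hc⟩ : ∃ c, c * q - a * n = 1 :=
    ⟨a * k + v, by linear_combination huv - a * hk⟩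
  have hcn : c ≤ n := by
    by_contra! h
    have h1 : (n + 1) * q ≤ c * q := mul_le_mul_of_nonneg_right h hq.le
    have h2 : a * n ≤ (q - 1) * n := mul_le_mul_of_nonneg_right (by omega) hn0.le
    nlinarith
  have hc0 : 0 < c := by
    by_contra! h
    have h1 : c * q ≤ 0 := mul_nonpos_of_nonpos_of_nonneg h hq.le
    have h2 : 0 < a * n := mul_pos ha hn0
    linarith
  have hcop : Nat.Coprime c.natAbs n.natAbs := by
    rw [← Int.isCoprime_iff_nat_coprime]
    exact ⟨q, -a, by linear_combination hc⟩
  have hnum := Rat.num_div_eq_of_coprime hn0 hcop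
  have hden := Rat.den_div_eq_of_coprime hn0 hcop
  have hnQ : (0 : ℚ) < n := by exact_mod_cast hn0
  have hcQ : (0 : ℚ) < c := by exact_mod_cast hc0
  refine ⟨c / n, ⟨div_pos hcQ hnQ, (div_le_one hnQ).2 (by exact_mod_cast hcn), ?_⟩, ?_, ?_⟩
  · zify; omega
  · rw [hnum, hden]; exact hc
  · zify; omega

lemma lt_of_det_eq_one {x y : ℚ} (hdet : y.num * x.den - x.num * y.den = 1) : x < y := by
  rw [Rat.lt_iff]; omega

lemma consecFarey_iff {Q : ℕ} {x y : ℚ} :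
    ConsecFarey Q x y ↔ x ∈ FareyQ Q ∧ y ∈ FareyQ Q ∧
      y.num * x.den - x.num * y.den = 1 ∧ Q < x.den + y.den := by
  constructor
  · rintro ⟨hx, hy, hxy, hcons⟩
    obtain ⟨z, hz, hdet, hlt⟩ := exists_farey_successor hx.1 (hxy.trans_le hy.2.1) hx.2.2
    have hxz := lt_of_det_eq_one hdet
    obtain rfl : z = y := by
      rcases lt_trichotomy z y with h | h | h
      · exact absurd ⟨hxz, h⟩ (hcons z hz)
      · exact h
      · have := add_den_le_of_lt_of_lt hdet hxy h
        have := hy.2.2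
        omega
    exact ⟨hx, hy, hdet, hlt⟩
  · rintro ⟨hx, hy, hdet, hlt⟩
    refine ⟨hx, hy, lt_of_det_eq_one hdet, fun z hz h => ?_⟩
    have := add_den_le_of_lt_of_lt hdet h.1 h.2
    have := hz.2.2
    omega

lemma one_sub_num (x : ℚ) : (1 - x).num = x.den - x.num ∧ (1 - x).den = x.den := by
  have hcop : Nat.Coprime ((x.den : ℤ) - x.num).natAbs (x.den : ℤ).natAbs := by
    rw [← Int.isCoprime_iff_nat_coprime]
    have : IsCoprime x.num x.den := Int.isCoprime_iff_nat_coprime.2 (by simpa using x.reduced)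
    obtain ⟨u, v, huv⟩ := this
    exact ⟨-u, u + v, by linear_combination huv⟩
  have hq : (0 : ℤ) < x.den := by exact_mod_cast x.pos
  have e : 1 - x = (((x.den : ℤ) - x.num : ℤ) : ℚ) / ((x.den : ℤ) : ℚ) := by
    have h := x.num_div_den
    have hq' : (x.den : ℚ) ≠ 0 := by exact_mod_cast x.den_nz
    push_cast
    rw [sub_div, h, div_self hq']
  rw [e]
  exact ⟨Rat.num_div_eq_of_coprime hq hcop, by exact_mod_cast Rat.den_div_eq_of_coprime hq hcop⟩

lemma isReflectedPair_one_iff {l Q : ℕ} {r : ℝ} (hr : 0 ≤ r) {I : Set ℝ} {x y : ℚ} :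
    IsReflectedPair l Q ⌊r * Q⌋₊ 1 ((fun t : ℝ => 1 - t) ⁻¹' I) (1 - x, 1 - y) ↔
      ConsecFarey Q x y ∧ (x : ℝ) ∈ I ∧ (y : ℝ) ∈ I ∧ x ∉ FareyCong l ∧ y ∉ FareyCong l ∧
        (x.den : ℝ) ≤ r * Q ∧ r * Q < (y.den : ℝ) := by
  obtain ⟨hx1, hx2⟩ := one_sub_num x
  obtain ⟨hy1, hy2⟩ := one_sub_num y
  have hcast : ∀ z : ℚ, ((1 - z : ℚ) : ℝ) ∈ (fun t : ℝ => 1 - t) ⁻¹' I ↔ (z : ℝ) ∈ I := by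
    intro z
    rw [Set.mem_preimage]
    push_cast
    rw [sub_sub_cancel]
  rw [consecFarey_iff, ← Nat.le_floor_iff (by positivity), ← Nat.floor_lt (by positivity)]
  constructor
  · rintro ⟨h1, h2, h3, h4, h5, h6, h7, h8, h9, h10, h11, h12, h13⟩
    simp only [hx1, hx2, hy1, hy2] at h1 h2 h3 h4 h5 h6 h7 h8 h9 h10 h11 h12 h13
    refine ⟨⟨⟨by linarith, by linarith, by omega⟩, ⟨by linarith, by linarith, h8⟩, ?_, h9⟩,
      (hcast x).1 h12, (hcast y).1 h13, fun h => h10 h.2.2, fun h => h11 h.2.2, h6, h7⟩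
    rw [Units.val_one] at h5
    linarith
  · rintro ⟨⟨⟨h1, h2, h3⟩, ⟨h4, h5, h6⟩, h7, h8⟩, h9, h10, h11, h12, h13, h14⟩
    constructor <;> simp only [hx1, hx2, hy1, hy2]
    · linarith
    · linarith
    · linarith
    · linarith
    · rw [Units.val_one]; linarith
    · exact h13
    · exact h14
    · exact h6
    · exact h8
    · exact fun h => h11 ⟨h1, h2, h⟩
    · exact fun h => h12 ⟨h4, h5, h⟩
    · exact (hcast x).2 h9
    · exact (hcast y).2 h10

lemma isReflectedPair_neg_one_iff {l Q : ℕ} {r : ℝ} (hr : 0 ≤ r) {I : Set ℝ} {x y : ℚ} :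
    IsReflectedPair l Q ⌊r * Q⌋₊ (-1) ((fun t : ℝ => 1 - t) ⁻¹' I) (1 - y, 1 - x) ↔
      ConsecFarey Q x y ∧ (x : ℝ) ∈ I ∧ (y : ℝ) ∈ I ∧ x ∉ FareyCong l ∧ y ∉ FareyCong l ∧
        (y.den : ℝ) ≤ r * Q ∧ r * Q < (x.den : ℝ) := by
  obtain ⟨hx1, hx2⟩ := one_sub_num x
  obtain ⟨hy1, hy2⟩ := one_sub_num y
  have hcast : ∀ z : ℚ, ((1 - z : ℚ) : ℝ) ∈ (fun t : ℝ => 1 - t) ⁻¹' I ↔ (z : ℝ) ∈ I := by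
    intro z
    rw [Set.mem_preimage]
    push_cast
    rw [sub_sub_cancel]
  rw [consecFarey_iff, ← Nat.le_floor_iff (by positivity), ← Nat.floor_lt (by positivity)]
  constructor
  · rintro ⟨h1, h2, h3, h4, h5, h6, h7, h8, h9, h10, h11, h12, h13⟩
    simp only [hx1, hx2, hy1, hy2] at h1 h2 h3 h4 h5 h6 h7 h8 h9 h10 h11 h12 h13
    refine ⟨⟨⟨by linarith, by linarith, h8⟩, ⟨by linarith, by linarith, by omega⟩, ?_, by omega⟩,
      (hcast x).1 h13, (hcast y).1 h12, fun h => h11 h.2.2, fun h => h10 h.2.2, h6, h7⟩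
    rw [Units.val_neg, Units.val_one] at h5
    linarith
  · rintro ⟨⟨⟨h1, h2, h3⟩, ⟨h4, h5, h6⟩, h7, h8⟩, h9, h10, h11, h12, h13, h14⟩
    constructor <;> simp only [hx1, hx2, hy1, hy2]
    · linarith
    · linarith
    · linarith
    · linarith
    · rw [Units.val_neg, Units.val_one]; linarith
    · exact h13
    · exact h14
    · exact h3
    · omega
    · exact fun h => h12 ⟨h4, h5, h⟩
    · exact fun h => h11 ⟨h1, h2, h⟩
    · exact (hcast y).2 h10
    · exact (hcast x).2 h9

lemma Bsum_eq (l Q : ℕ) (ε : ℝ) (I : Set ℝ) {r : ℝ} (hr : 0 ≤ r) :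
    Bsum l Q ε I r = ∑ m ∈ Finset.Icc 1 ⌊r * Q⌋₊, 1 / (m : ℝ) *
      neighbourSum l m (max ⌊r * Q⌋₊ (Q - m) + 1) (Q + 1) 1 ((fun t : ℝ => 1 - t) ⁻¹' I) ε := by
  rw [← tsum_isReflectedPair_eq, Bsum]
  let e : ℚ × ℚ ≃ ℚ × ℚ := (Equiv.subLeft 1).prodCongr (Equiv.subLeft 1)
  rw [← (e.subtypeEquiv fun p => (isReflectedPair_one_iff (l := l) (Q := Q) hr (I := I)
    (x := p.1) (y := p.2)).symm).tsum_eq]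
  refine tsum_congr fun p => ?_
  change _ = (1 - ε * ((1 - p.1.2).den : ℝ)) / (((1 - p.1.1).den : ℝ) * (1 - p.1.2).den *
    (1 + (1 - ((1 - p.1.2 : ℚ) : ℝ)) ^ 2))
  rw [(one_sub_num _).2, (one_sub_num _).2]
  push_cast
  rw [sub_sub_cancel]

lemma Csum_eq (l Q : ℕ) (ε : ℝ) (I : Set ℝ) {r : ℝ} (hr : 0 ≤ r) :
    Csum l Q ε I r = ∑ m ∈ Finset.Icc 1 ⌊r * Q⌋₊, 1 / (m : ℝ) *
      neighbourSum l m (max ⌊r * Q⌋₊ (Q - m) + 1) (Q + 1) (-1)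
        ((fun t : ℝ => 1 - t) ⁻¹' I) ε := by
  rw [← tsum_isReflectedPair_eq, Csum]
  let e : ℚ × ℚ ≃ ℚ × ℚ :=
    (Equiv.prodComm ℚ ℚ).trans ((Equiv.subLeft 1).prodCongr (Equiv.subLeft 1))
  rw [← (e.subtypeEquiv fun p => (isReflectedPair_neg_one_iff (l := l) (Q := Q) hr (I := I)
    (x := p.1) (y := p.2)).symm).tsum_eq]
  refine tsum_congr fun p => ?_
  change _ = (1 - ε * ((1 - p.1.1).den : ℝ)) / (((1 - p.1.2).den : ℝ) * (1 - p.1.1).den *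
    (1 + (1 - ((1 - p.1.1 : ℚ) : ℝ)) ^ 2))
  rw [(one_sub_num _).2, (one_sub_num _).2]
  push_cast
  rw [sub_sub_cancel, mul_comm (p.1.1.den : ℝ)]

lemma setIntegral_reflWeight_preimage (I : Set ℝ) :
    ∫ u in (fun t : ℝ => 1 - t) ⁻¹' I, reflWeight u = ∫ u in I, 1 / (1 + u ^ 2) := by
  have h := (Measure.measurePreserving_sub_left volume (1 : ℝ)).setIntegral_preimage_emb
    (MeasurableEquiv.subLeft (1 : ℝ)).measurableEmbedding (fun u : ℝ => 1 / (1 + u ^ 2)) I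
  exact h

lemma abs_setIntegral_inv_one_add_sq_le {I : Set ℝ} (hI : I ⊆ Set.Icc 0 1) :
    |∫ u in I, 1 / (1 + u ^ 2 : ℝ)| ≤ 1 := by
  have hv : volume I ≤ 1 := (measure_mono hI).trans (by simp)
  have h := norm_setIntegral_le_of_norm_le_const (μ := volume) (s := I)
    (f := fun u : ℝ => 1 / (1 + u ^ 2)) (C := 1) (hv.trans_lt ENNReal.one_lt_top) fun u _ => by
      rw [norm_of_nonneg (by positivity), div_le_one (by positivity)]
      nlinarith [sq_nonneg u]
  rw [norm_eq_abs, one_mul] at h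
  refine h.trans ?_
  exact ENNReal.toReal_le_of_le_ofReal zero_le_one (by simpa using hv)

lemma exists_pairSums_sub_le (l : ℕ) (hl : 2 ≤ l) {r : ℝ} (hr : 0 < r) (hr1 : r ≤ 1) :
    ∃ C, 0 ≤ C ∧
      (∀ (Q : ℕ) (ε : ℝ) (I : Set ℝ), I.OrdConnected → I ⊆ Set.Icc 0 1 → 0 < ε →
        Q = ⌊1 / ε⌋₊ → 1 ≤ Q →
        |Bsum l Q ε I r - (∫ u in I, 1 / (1 + u ^ 2)) * Aconst l * I2 r| ≤
          C * (Q : ℝ) ^ (-(1 / 5) : ℝ)) ∧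
      ∀ (Q : ℕ) (ε : ℝ) (I : Set ℝ), I.OrdConnected → I ⊆ Set.Icc 0 1 → 0 < ε →
        Q = ⌊1 / ε⌋₊ → 1 ≤ Q →
        |Csum l Q ε I r - (∫ u in I, 1 / (1 + u ^ 2)) * Aconst l * I2 r| ≤
          C * (Q : ℝ) ^ (-(1 / 5) : ℝ) := by
  obtain ⟨C₁, hC₁, h₁⟩ := exists_sum_neighbourSum_error l hl hr hr1
  obtain ⟨C₂, hC₂, h₂⟩ := exists_sum_localDensity_sub_I2_le (by omega : 0 < l) hr hr1
  have key : ∀ (s : ℤˣ) (Q : ℕ) (ε : ℝ) (I : Set ℝ), I.OrdConnected → I ⊆ Set.Icc 0 1 → 0 < ε →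
      Q = ⌊1 / ε⌋₊ → 1 ≤ Q →
      |∑ m ∈ Finset.Icc 1 ⌊r * Q⌋₊, 1 / (m : ℝ) *
        neighbourSum l m (max ⌊r * Q⌋₊ (Q - m) + 1) (Q + 1) s ((fun t : ℝ => 1 - t) ⁻¹' I) ε -
          (∫ u in I, 1 / (1 + u ^ 2)) * Aconst l * I2 r| ≤
        (C₁ + C₂) * (Q : ℝ) ^ (-(1 / 5) : ℝ) := by
    intro s Q ε I hIc hI hε hQ hQ1
    have hQ0 : (1 : ℝ) ≤ Q := by exact_mod_cast hQ1
    have e1 := h₁ Q ε s ((fun t : ℝ => 1 - t) ⁻¹' I)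
      (hIc.preimage_anti fun x y h => sub_le_sub_left h 1)
      (fun t ht => by
        have := hI ht
        exact ⟨by linarith [this.2], by linarith [this.1]⟩) hε hQ hQ1
    have e2 := h₂ Q hQ1
    rw [setIntegral_reflWeight_preimage] at e1
    have e3 := abs_setIntegral_inv_one_add_sq_le hI
    have e4 : √(1 / (Q : ℝ)) ≤ (Q : ℝ) ^ (-(1 / 5) : ℝ) := by
      rw [sqrt_eq_rpow, one_div (Q : ℝ), ← rpow_neg_one, ← rpow_mul (by positivity)]
      exact rpow_le_rpow_of_exponent_le hQ0 (by norm_num)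
    set X := ∑ m ∈ Finset.Icc 1 ⌊r * Q⌋₊, 1 / (m : ℝ) *
      neighbourSum l m (max ⌊r * Q⌋₊ (Q - m) + 1) (Q + 1) s ((fun t : ℝ => 1 - t) ⁻¹' I) ε
    set Y := ∑ m ∈ Finset.Icc 1 ⌊r * Q⌋₊, 1 / (m : ℝ) * (localDensity l m *
        ∑ n ∈ Finset.Ico (max ⌊r * Q⌋₊ (Q - m) + 1) (Q + 1), (1 / (n : ℝ) - 1 / Q))
    set c := ∫ u in I, 1 / (1 + u ^ 2 : ℝ)
    calc |X - c * Aconst l * I2 r| = |(X - c * Y) + c * (Y - Aconst l * I2 r)| := by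
          congr 1; ring
      _ ≤ C₁ * (Q : ℝ) ^ (-(1 / 5) : ℝ) + 1 * (C₂ * (Q : ℝ) ^ (-(1 / 5) : ℝ)) := by
          refine (abs_add_le _ _).trans (add_le_add e1 ?_)
          rw [abs_mul]
          refine mul_le_mul e3 (e2.trans ?_) (abs_nonneg _) zero_le_one
          gcongr
      _ = _ := by ring
  refine ⟨C₁ + C₂, by positivity, fun Q ε I hIc hI hε hQ hQ1 => ?_,
    fun Q ε I hIc hI hε hQ hQ1 => ?_⟩
  · rw [Bsum_eq l Q ε I hr.le]
    exact key 1 Q ε I hIc hI hε hQ hQ1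
  · rw [Csum_eq l Q ε I hr.le]
    exact key (-1) Q ε I hIc hI hε hQ hQ1

end FareyPairs

theorem statement8 (l : ℕ) (hl : 2 ≤ l) (lam : ℝ) (hlam : lam ∈ Set.Ioc (0 : ℝ) 1)
    (c c₁ δ K : ℝ) (hc : c ∈ Set.Ioo (0 : ℝ) 1) (hc₁ : c₁ ∈ Set.Ioo (0 : ℝ) 1)
    (hδ : 0 < δ) (hK : 1 ≤ K) :
    ∃ C > 0, ∀ ε : ℝ, 0 < ε → ε < 1 / 2 → ∀ Q : ℕ, Q = ⌊1 / ε⌋₊ →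
      ∀ I : Set ℝ, I ⊆ Set.Icc 0 1 → I.OrdConnected →
      K⁻¹ * (Q : ℝ) ^ (-c) ≤ (volume I).toReal → (volume I).toReal ≤ K * (Q : ℝ) ^ (-c) →
      |Bsum l Q ε I lam - (∫ u in I, 1 / (1 + u ^ 2)) * Aconst l * I2 lam| ≤
        C * (Q : ℝ) ^ (δ + max (max (2 * c₁ - 1 / 2) (-c₁)) (-1)) ∧
      |Csum l Q ε I lam - (∫ u in I, 1 / (1 + u ^ 2)) * Aconst l * I2 lam| ≤
        C * (Q : ℝ) ^ (δ + max (max (2 * c₁ - 1 / 2) (-c₁)) (-1)) := by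
  obtain ⟨hlam0, hlam1⟩ := hlam
  obtain ⟨C, hC0, hB, hCs⟩ := FareyPairs.exists_pairSums_sub_le l hl hlam0 hlam1
  refine ⟨C + 1, by positivity, fun ε hε0 hε1 Q hQ I hI hIc _ _ => ?_⟩
  have hQ1 : 1 ≤ Q := by
    rw [hQ]
    exact Nat.le_floor (by rw [Nat.cast_one, le_div_iff₀ hε0]; linarith)
  have hθ : (-(1 / 5) : ℝ) ≤ δ + max (max (2 * c₁ - 1 / 2) (-c₁)) (-1) := by
    have h1 : 2 * c₁ - 1 / 2 ≤ max (max (2 * c₁ - 1 / 2) (-c₁)) (-1) :=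
      (le_max_left _ _).trans (le_max_left _ _)
    have h2 : -c₁ ≤ max (max (2 * c₁ - 1 / 2) (-c₁)) (-1) :=
      (le_max_right _ _).trans (le_max_left _ _)
    linarith
  have hpow : C * (Q : ℝ) ^ (-(1 / 5) : ℝ) ≤
      (C + 1) * (Q : ℝ) ^ (δ + max (max (2 * c₁ - 1 / 2) (-c₁)) (-1)) := by
    gcongr
    · linarith
    · exact_mod_cast hQ1
  exact ⟨(hB Q ε I hIc hI hε0 hQ hQ1).trans hpow, (hCs Q ε I hIc hI hε0 hQ hQ1).trans hpow⟩
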